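/- Every locally compact Hausdorff topological group whose underlying space is an ANE(4)-space is metrizable. -/

import Mathlib

open Topology

universe u

/-- A topological space `Z` has Lebesgue covering dimension at most `n`:
every finite open cover admits a finite open refinement in which each point
lies in at most `n + 1` members. -/
def CovDimLE (Z : Type u) [TopologicalSpace Z] (n : ℕ) : Prop :=
  ∀ 𝒰 : Finset (Set Z), (∀ U ∈ 𝒰, IsOpen U) → ⋃₀ (𝒰 : Set (Set Z)) = Set.univ →
    ∃ 𝒱 : Finset (Set Z), (∀ V ∈ 𝒱, IsOpen V) ∧ ⋃₀ (𝒱 : Set (Set Z)) = Set.univ ∧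
      (∀ V ∈ 𝒱, ∃ U ∈ 𝒰, V ⊆ U) ∧
      ∀ z : Z, Nat.card {V : Set Z // V ∈ 𝒱 ∧ z ∈ V} ≤ n + 1

/-- `X` is an absolute extensor in dimension `n` (an AE(n)-space): every continuous map
into `X` from a closed subspace of a compact Hausdorff space of covering dimension
at most `n` extends continuously over the whole space. -/
def IsAE (n : ℕ) (X : Type u) [TopologicalSpace X] : Prop :=
  ∀ (Z : Type u) [TopologicalSpace Z], CompactSpace Z → T2Space Z → CovDimLE Z n →
    ∀ Z₀ : Set Z, IsClosed Z₀ → ∀ g₀ : C(Z₀, X),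
      ∃ g : C(Z, X), ∀ z : Z₀, g (z : Z) = g₀ z

/-- `X` is an absolute neighborhood extensor in dimension `4` (an ANE(4)-space):
every continuous map into `X` from a closed subspace `Z₀` of a compact Hausdorff
space of covering dimension at most `4` extends continuously over some open
neighborhood of `Z₀`. -/
def IsANE4 (X : Type u) [TopologicalSpace X] : Prop :=
  ∀ (Z : Type u) [TopologicalSpace Z], CompactSpace Z → T2Space Z → CovDimLE Z 4 →
    ∀ Z₀ : Set Z, IsClosed Z₀ → ∀ g₀ : C(Z₀, X),
      ∃ (U : Set Z) (_ : IsOpen U) (hZ₀U : Z₀ ⊆ U) (g : C(U, X)),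
        ∀ (z : Z) (hz : z ∈ Z₀), g ⟨z, hZ₀U hz⟩ = g₀ ⟨z, hz⟩

/-- The underlying space of `X` is a topological manifold: every point has an open
neighborhood homeomorphic to an open subset of some Euclidean space. -/
def IsTopManifold (X : Type u) [TopologicalSpace X] : Prop :=
  ∀ x : X, ∃ (n : ℕ) (U : Set X) (V : Set (EuclideanSpace ℝ (Fin n))),
    IsOpen U ∧ x ∈ U ∧ IsOpen V ∧ Nonempty (U ≃ₜ V)

/-- The multiplicative equivalence `e` is an isomorphism of topological groups,
i.e. it is continuous with continuous inverse. -/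
def IsTopGroupIso {G H : Type*} [Group G] [Group H] [TopologicalSpace G]
    [TopologicalSpace H] (e : G ≃* H) : Prop :=
  Continuous e ∧ Continuous e.symm

/-- A package consisting of a compact Hausdorff topological group. -/
structure CompactGroupPkg : Type (u + 1) where
  carrier : Type u
  [topology : TopologicalSpace carrier]
  [group : Group carrier]
  [topGroup : IsTopologicalGroup carrier]
  [compact : CompactSpace carrier]
  [t2 : T2Space carrier]

attribute [instance] CompactGroupPkg.topology CompactGroupPkg.group
  CompactGroupPkg.topGroup CompactGroupPkg.compact CompactGroupPkg.t2

/-- `L` is a simple, connected and simply connected compact Lie group: a compact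
Hausdorff topological group whose underlying space is a topological manifold,
which is connected, simply connected, nonabelian, and all of whose closed
normal subgroups other than the whole group are finite. -/
def IsSimpleSCSCLieGroup (L : CompactGroupPkg.{u}) : Prop :=
  IsTopManifold L.carrier ∧ ConnectedSpace L.carrier ∧ SimplyConnectedSpace L.carrier ∧
    (∃ a b : L.carrier, a * b ≠ b * a) ∧
    ∀ N : Subgroup L.carrier, N.Normal → IsClosed (N : Set L.carrier) → N ≠ ⊤ → Finite N

section Covering

/-- A locally constant choice damped by a continuous function vanishing at the discontinuities. -/
lemma continuous_ite_mul_of_eventually {D : Type*} [TopologicalSpace D] {B : D → ℝ}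
    (hB : Continuous B) (P : D → Prop) [DecidablePred P]
    (hP : ∀ x, B x ≠ 0 → ∀ᶠ y in 𝓝 x, (P y ↔ P x)) :
    Continuous fun x => if P x then B x else 0 := by
  rw [continuous_iff_continuousAt]
  intro x
  by_cases hx : B x = 0
  · have h0 : (if P x then B x else 0) = 0 := by simp [hx]
    rw [ContinuousAt, h0]
    have hBx : Filter.Tendsto (fun y => |B y|) (𝓝 x) (𝓝 0) := by
      have := (hB.abs).continuousAt (x := x)
      rw [ContinuousAt, hx, abs_zero] at this
      exact this
    refine squeeze_zero_norm (fun y => ?_) hBx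
    split_ifs <;> simp
  · have : (fun y => if P y then B y else 0) =ᶠ[𝓝 x] fun y => if P x then B y else 0 := by
      filter_upwards [hP x hx] with y hy
      simp [hy]
    refine ContinuousAt.congr ?_ this.symm
    split_ifs
    · exact hB.continuousAt
    · exact continuousAt_const

lemma eventually_floor_eq {t : ℝ} (ht : ∀ k : ℤ, (k : ℝ) ≠ t) : ∀ᶠ s in 𝓝 t, ⌊s⌋ = ⌊t⌋ := by
  have h1 : (⌊t⌋ : ℝ) < t := lt_of_le_of_ne (Int.floor_le t) (ht _)
  filter_upwards [Ioo_mem_nhds h1 (Int.lt_floor_add_one t)] with s hs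
  exact Int.floor_eq_iff.2 ⟨hs.1.le, hs.2⟩

/-- Finite open covers of compact subsets of `ℝⁿ` have partitions of unity of order `n + 1`. -/
lemma exists_partition_of_embedding {n : ℕ} {D : Type*} [TopologicalSpace D] [CompactSpace D]
    (e : D → (Fin n → ℝ)) (hec : Continuous e) (hei : Function.Injective e)
    {ι : Type*} [Fintype ι] (U : ι → Set D) (hU : ∀ i, IsOpen (U i))
    (hcov : ∀ x, ∃ i, x ∈ U i) :
    ∃ ψ : ι → C(D, ℝ), (∀ i x, 0 ≤ ψ i x) ∧ (∀ i x, ψ i x ≠ 0 → x ∈ U i) ∧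
      (∀ x, ∑ i, ψ i x = 1) ∧
      ∀ x, ∃ s : Finset ι, s.card ≤ n + 1 ∧ ∀ i, ψ i x ≠ 0 → i ∈ s := by
  classical
  rcases isEmpty_or_nonempty D with hD | ⟨⟨x₀⟩⟩
  · exact ⟨fun _ => 0, by simp, by simp, fun x => hD.elim x, fun x => hD.elim x⟩
  obtain ⟨i₀, -⟩ := hcov x₀
  have hemb : IsClosedEmbedding e := hec.isClosedEmbedding hei
  choose O hOo hO using fun i => hemb.isInducing.isOpen_iff.1 (hU i)
  obtain ⟨δ, hδ, hleb⟩ := lebesgue_number_lemma_of_metric (s := Set.range e)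
    (isCompact_range hec) hOo (by
      rintro _ ⟨x, rfl⟩
      obtain ⟨i, hi⟩ := hcov x
      rw [← hO i] at hi
      exact Set.mem_iUnion.2 ⟨i, hi⟩)
  set ε : ℝ := δ / 2 with hε
  have hε0 : 0 < ε := by positivity
  let q : Fin (n + 1) → D → Fin n → ℝ := fun c x m => e x m / ε - (c : ℕ) / ((n : ℝ) + 1)
  have hq : ∀ c m, Continuous fun x => q c x m := fun c m => by
    have := (continuous_apply m).comp hec
    exact ((this.div_const ε).sub continuous_const)
  let B : Fin (n + 1) → D → ℝ := fun c x => ∏ m, |Real.sin (q c x m * Real.pi)|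
  have hB : ∀ c, Continuous (B c) := fun c => continuous_finsetProd _ fun m _ =>
    (Real.continuous_sin.comp ((hq c m).mul continuous_const)).abs
  have hB0 : ∀ c x, 0 ≤ B c x := fun c x => Finset.prod_nonneg fun m _ => abs_nonneg _
  have hBne : ∀ c x, B c x ≠ 0 ↔ ∀ m, ∀ k : ℤ, (k : ℝ) ≠ q c x m := by
    intro c x
    simp only [B, Finset.prod_ne_zero_iff, Finset.mem_univ, true_implies, ne_eq, abs_eq_zero,
      Real.sin_eq_zero_iff, not_exists, mul_left_inj' Real.pi_ne_zero]
  let j : Fin (n + 1) → D → Fin n → ℤ := fun c x m => ⌊q c x m⌋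
  have hloc : ∀ c x, B c x ≠ 0 → ∀ᶠ y in 𝓝 x, j c y = j c x := by
    intro c x hx
    rw [hBne] at hx
    have : ∀ m, ∀ᶠ y in 𝓝 x, j c y m = j c x m := fun m =>
      (hq c m).continuousAt.eventually (eventually_floor_eq (hx m))
    filter_upwards [Filter.eventually_all.2 this] with y hy
    exact funext hy
  have hclose : ∀ c x y, j c x = j c y → dist (e y) (e x) < δ := by
    intro c x y hxy
    refine lt_of_le_of_lt ((dist_pi_le_iff hε0.le).2 fun m => ?_) (by linarith : ε < δ)
    have hm : ⌊q c x m⌋ = ⌊q c y m⌋ := congrFun hxy m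
    have h1 := Int.floor_le (q c x m)
    have h2 := Int.lt_floor_add_one (q c x m)
    have h3 := Int.floor_le (q c y m)
    have h4 := Int.lt_floor_add_one (q c y m)
    rw [hm] at h1 h2
    have hd : |q c y m - q c x m| ≤ 1 := by rw [abs_le]; constructor <;> linarith
    have : e y m - e x m = ε * (q c y m - q c x m) := by simp only [q]; field_simp; ring
    rw [Real.dist_eq, this, abs_mul, abs_of_pos hε0]
    nlinarith
  have hidx : ∀ c : Fin (n + 1), ∀ k : Fin n → ℤ, ∃ i, ∀ x, j c x = k → x ∈ U i := by
    intro c k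
    by_cases h : ∃ y, j c y = k
    · obtain ⟨y, hy⟩ := h
      obtain ⟨i, hi⟩ := hleb (e y) ⟨y, rfl⟩
      refine ⟨i, fun x hx => ?_⟩
      rw [← hO i]
      exact hi (hclose c y x (hy.trans hx.symm))
    · exact ⟨i₀, fun x hx => (h ⟨x, hx⟩).elim⟩
  choose a ha using hidx
  have hsum : ∀ x, 0 < ∑ c, B c x := by
    intro x
    by_contra hneg
    have hz : ∀ c, B c x = 0 := by
      have := le_antisymm (not_lt.1 hneg) (Finset.sum_nonneg fun c _ => hB0 c x)
      intro c
      exact (Finset.sum_eq_zero_iff_of_nonneg fun c _ => hB0 c x).1 this c (Finset.mem_univ _)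
    have hz' : ∀ c, ∃ m, ∃ k : ℤ, (k : ℝ) = q c x m := by
      intro c
      by_contra hcon
      push Not at hcon
      exact (hBne c x).2 hcon (hz c)
    choose m k hk using hz'
    obtain ⟨c, c', hne, hcc⟩ := Fintype.exists_ne_map_eq_of_card_lt m (by simp)
    have h1 := hk c
    have h2 := hk c'
    rw [← hcc] at h2
    have hn : (0 : ℝ) < (n : ℝ) + 1 := by positivity
    have h3 : ((k c' - k c) * ((n : ℤ) + 1) : ℤ) = ((c : ℕ) : ℤ) - ((c' : ℕ) : ℤ) := by
      have : ((k c' : ℝ) - k c) * ((n : ℝ) + 1) = ((c : ℕ) : ℝ) - ((c' : ℕ) : ℝ) := by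
        rw [h1, h2]; simp only [q]; field_simp; ring
      exact_mod_cast this
    have hc := c.2
    have hc' := c'.2
    have h4 : k c' - k c = 0 := by
      by_contra h5
      rcases lt_or_gt_of_ne h5 with h6 | h6
      · have : k c' - k c ≤ -1 := by omega
        nlinarith
      · have : 1 ≤ k c' - k c := by omega
        nlinarith
    rw [h4] at h3
    apply hne
    ext
    omega
  let Ψ : ι → D → ℝ := fun i x => (∑ c, if a c (j c x) = i then B c x else 0) / ∑ c, B c x
  have hΨ : ∀ i, Continuous (Ψ i) := fun i =>
    (continuous_finsetSum _ fun c _ => continuous_ite_mul_of_eventually (hB c) _ (by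
      intro x hx
      filter_upwards [hloc c x hx] with y hy
      rw [hy])).div (continuous_finsetSum _ fun c _ => hB c) fun x => (hsum x).ne'
  have hne : ∀ i x, Ψ i x ≠ 0 → ∃ c, a c (j c x) = i := by
    intro i x h
    by_contra hcon
    push Not at hcon
    exact h (by simp [Ψ, hcon])
  refine ⟨fun i => ⟨Ψ i, hΨ i⟩, fun i x => ?_, fun i x h => ?_, fun x => ?_, fun x => ?_⟩
  · refine div_nonneg (Finset.sum_nonneg fun c _ => ?_) (hsum x).le
    split_ifs
    · exact hB0 c x
    · exact le_rfl
  · obtain ⟨c, rfl⟩ := hne i x h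
    exact ha c _ x rfl
  · simp only [ContinuousMap.coe_mk, Ψ]
    rw [← Finset.sum_div, Finset.sum_comm]
    simp only [Finset.sum_ite_eq, Finset.mem_univ, if_true]
    exact div_self (hsum x).ne'
  · refine ⟨Finset.univ.image fun c => a c (j c x), ?_, fun i h => ?_⟩
    · exact Finset.card_image_le.trans (by simp)
    · obtain ⟨c, hc⟩ := hne i x h
      exact Finset.mem_image.2 ⟨c, Finset.mem_univ _, hc⟩

end Covering

section Covering

lemma eq_of_comp_stoneCechUnit {Y : Type*} [TopologicalSpace Y] {f g : StoneCech Y → ℝ}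
    (hf : Continuous f) (hg : Continuous g) (h : ∀ y, f (stoneCechUnit y) = g (stoneCechUnit y))
    (z : StoneCech Y) : f z = g z :=
  congrFun (stoneCech_hom_ext hf hg (funext h)) z

/-- The Stone–Čech compactification of a disjoint union of copies of a compact subset of `ℝⁿ`
has covering dimension at most `n`. -/
lemma covDimLE_stoneCech {n : ℕ} {Λ D : Type u} [TopologicalSpace Λ] [DiscreteTopology Λ]
    [TopologicalSpace D] [CompactSpace D]
    (e : D → (Fin n → ℝ)) (hec : Continuous e) (hei : Function.Injective e) :
    CovDimLE (StoneCech (Λ × D)) n := by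
  classical
  intro 𝒰 hopen hcov
  let ι := {U // U ∈ 𝒰}
  obtain ⟨φ, hφ⟩ := PartitionOfUnity.exists_isSubordinate (X := StoneCech (Λ × D))
    isClosed_univ (fun i : ι => (i : Set (StoneCech (Λ × D)))) (fun i => hopen _ i.2) (by
      intro z _
      have : z ∈ ⋃₀ (𝒰 : Set (Set (StoneCech (Λ × D)))) := by rw [hcov]; trivial
      obtain ⟨U, hU, hz⟩ := this
      exact Set.mem_iUnion.2 ⟨⟨U, hU⟩, hz⟩)
  set ε : ℝ := 1 / (2 * ((Fintype.card ι : ℝ) + 1)) with hε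
  have hε0 : 0 < ε := by positivity
  have hsum : ∀ z, ∑ i, φ i z = 1 := fun z => by
    rw [← finsum_eq_sum_of_fintype]; exact φ.sum_eq_one (Set.mem_univ z)
  have hstep : ∀ l : Λ, ∃ ψ : ι → C(D, ℝ), (∀ i x, 0 ≤ ψ i x) ∧
      (∀ i x, ψ i x ≠ 0 → ε < φ i (stoneCechUnit (l, x))) ∧ (∀ x, ∑ i, ψ i x = 1) ∧
      ∀ x, ∃ s : Finset ι, s.card ≤ n + 1 ∧ ∀ i, ψ i x ≠ 0 → i ∈ s := fun l => by
    refine exists_partition_of_embedding e hec hei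
      (fun i : ι => {x : D | ε < φ i (stoneCechUnit (l, x))}) (fun i => ?_) fun x => ?_
    · exact isOpen_lt continuous_const
        ((φ i).continuous.comp (continuous_stoneCechUnit.comp (by fun_prop)))
    · by_contra hcon
      simp only [Set.mem_ofPred_eq, not_exists, not_lt] at hcon
      have h1 := hsum (stoneCechUnit (l, x))
      have h2 : ∑ i, φ i (stoneCechUnit (l, x)) ≤ ∑ _i : ι, ε := Finset.sum_le_sum fun i _ => hcon i
      rw [h1, Finset.sum_const, Finset.card_univ, nsmul_eq_mul, hε, mul_one_div,
        le_div_iff₀ (by positivity)] at h2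
      have : (0 : ℝ) ≤ Fintype.card ι := by positivity
      linarith
  choose ψ hψ0 hψU hψ1 hψs using hstep
  have hle : ∀ l i x, ψ l i x ≤ 1 := fun l i x => by
    rw [← hψ1 l x]
    exact Finset.single_le_sum (f := fun i => ψ l i x) (fun i _ => hψ0 l i x) (Finset.mem_univ i)
  let Ψ : ι → Λ × D → Set.Icc (0 : ℝ) 1 := fun i y => ⟨ψ y.1 i y.2, hψ0 _ _ _, hle _ _ _⟩
  have hΨ : ∀ i, Continuous (Ψ i) := fun i =>
    (continuous_prod_of_discrete_left.2 fun l => (ψ l i).continuous).subtype_mk _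
  let E : ι → StoneCech (Λ × D) → ℝ := fun i z =>
    ((stoneCechExtend (hΨ i) z : Set.Icc (0 : ℝ) 1) : ℝ)
  have hE : ∀ i, Continuous (E i) := fun i =>
    continuous_subtype_val.comp (continuous_stoneCechExtend (hΨ i))
  have hEu : ∀ i y, E i (stoneCechUnit y) = ψ y.1 i y.2 := fun i y => by
    simp only [E, stoneCechExtend_stoneCechUnit (hΨ i) y, Ψ]
  have hE1 : ∀ z, ∑ i, E i z = 1 := eq_of_comp_stoneCechUnit
    (continuous_finsetSum _ fun i _ => hE i) continuous_const fun y => by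
      simp only [hEu]; exact hψ1 _ _
  have hEφ : ∀ i z, E i z * max (ε - φ i z) 0 = 0 := fun i => eq_of_comp_stoneCechUnit
    ((hE i).mul ((continuous_const.sub (φ i).continuous).max continuous_const))
    continuous_const fun y => by
      by_cases h : ψ y.1 i y.2 = 0
      · rw [hEu, h, zero_mul]
      · rw [max_eq_right (by linarith [hψU _ _ _ h]), mul_zero]
  have hEcard : ∀ z, (Finset.univ.filter fun i => E i z ≠ 0).card ≤ n + 1 := by
    intro z
    set T := Finset.univ.filter fun i => E i z ≠ 0
    by_contra hT
    have hz : ∏ i ∈ T, E i z = 0 := eq_of_comp_stoneCechUnit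
      (f := fun z => ∏ i ∈ T, E i z) (continuous_finsetProd _ fun i _ => hE i)
      continuous_const (fun y => by
        by_contra hne
        rw [← ne_eq, Finset.prod_ne_zero_iff] at hne
        obtain ⟨s, hs, hs'⟩ := hψs y.1 y.2
        refine hT ((Finset.card_le_card fun i hi => hs' i ?_).trans hs)
        have := hne i hi
        rwa [hEu] at this) z
    rw [Finset.prod_eq_zero_iff] at hz
    obtain ⟨i, hi, hi0⟩ := hz
    exact (Finset.mem_filter.1 hi).2 hi0
  refine ⟨Finset.univ.image fun i => {z | E i z ≠ 0}, ?_, ?_, ?_, fun z => ?_⟩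
  · intro V hV
    obtain ⟨i, -, rfl⟩ := Finset.mem_image.1 hV
    exact isOpen_ne_fun (hE i) continuous_const
  · refine Set.eq_univ_of_forall fun z => ?_
    obtain ⟨i, -, hi⟩ := Finset.exists_ne_zero_of_sum_ne_zero (by rw [hE1 z]; exact one_ne_zero)
    exact ⟨_, Finset.mem_coe.2 (Finset.mem_image_of_mem _ (Finset.mem_univ i)), hi⟩
  · intro V hV
    obtain ⟨i, -, rfl⟩ := Finset.mem_image.1 hV
    refine ⟨i, i.2, fun z hz => ?_⟩
    have h1 : max (ε - φ i z) 0 = 0 := (mul_eq_zero.1 (hEφ i z)).resolve_left hz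
    have h2 : ε - φ i z ≤ 0 := by rw [← h1]; exact le_max_left _ _
    exact hφ i (subset_tsupport _ (Function.mem_support.2 (by linarith)))
  · refine le_trans ?_ (hEcard z)
    have hsub : {V : Set (StoneCech (Λ × D)) |
        V ∈ Finset.univ.image (fun i => {z | E i z ≠ 0}) ∧ z ∈ V} ⊆
        ((Finset.univ.filter fun i => E i z ≠ 0).image fun i => {z | E i z ≠ 0} :
          Finset (Set (StoneCech (Λ × D)))) := by
      rintro V ⟨hV, hz⟩
      obtain ⟨i, -, rfl⟩ := Finset.mem_image.1 hV
      exact Finset.mem_coe.2 (Finset.mem_image.2 ⟨i, by simpa using hz, rfl⟩)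
    refine (Nat.card_mono (Finset.finite_toSet _) hsub).trans ?_
    rw [Nat.card_coe_set_eq, Set.ncard_coe_finset]
    exact Finset.card_image_le

end Covering

section LocalExtension

/-- Compact Hausdorff spaces embed into cubes. -/
lemma exists_isClosedEmbedding_cube (C : Type*) [TopologicalSpace C] [CompactSpace C] [T2Space C] :
    IsClosedEmbedding fun (c : C) (f : C(C, unitInterval)) => f c := by
  refine Continuous.isClosedEmbedding (continuous_pi fun f => f.continuous) fun x y hxy => ?_
  by_contra hne
  obtain ⟨f, hf0, hf1, hf⟩ := exists_continuous_zero_one_of_isClosed (isClosed_singleton (x := x))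
    (isClosed_singleton (x := y)) (by simpa using hne)
  have := congrFun hxy ⟨fun c => ⟨f c, hf c⟩, by fun_prop⟩
  have h2 : f x = f y := congrArg Subtype.val this
  rw [hf0 rfl, hf1 rfl] at h2
  simp at h2

/-- In a locally compact `ANE(4)`-space, small maps from closed subsets of compact subsets
of `ℝ⁴` have small extensions. -/
lemma IsANE4.exists_nhds_extension {X : Type u} [TopologicalSpace X] [LocallyCompactSpace X]
    [T2Space X] (h : IsANE4 X) {D : Type u} [TopologicalSpace D] [CompactSpace D]
    (e : D → (Fin 4 → ℝ)) (hec : Continuous e) (hei : Function.Injective e)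
    {S : Set D} (hS : IsClosed S) (p : X) {U : Set X} (hU : U ∈ 𝓝 p) :
    ∃ V ∈ 𝓝 p, ∀ f : C(S, X), (∀ x, f x ∈ V) →
      ∃ F : C(D, X), (∀ x, F x ∈ U) ∧ ∀ x : S, F x = f x := by
  classical
  by_contra! hcon
  have : T2Space D := T2Space.of_injective_continuous hei hec
  obtain ⟨C, hC, hCp⟩ := exists_compact_mem_nhds p
  have : CompactSpace C := isCompact_iff_compactSpace.1 hC
  let Λ := {V : Set X // V ∈ 𝓝 p}
  let _ : TopologicalSpace Λ := ⊥
  have : DiscreteTopology Λ := ⟨rfl⟩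
  choose f hfV hfbad using fun V : Λ => hcon (V.1 ∩ C) (Filter.inter_mem V.2 hCp)
  let Q := C(C, unitInterval) → unitInterval
  let j : C → Q := fun c f => f c
  have hj : IsClosedEmbedding j := exists_isClosedEmbedding_cube C
  let fC : ∀ V : Λ, C(S, C) := fun V => ⟨fun s => ⟨f V s, (hfV V s).2⟩, by fun_prop⟩
  have hext : ∀ V : Λ, ∃ k : C(D, Q), k.restrict S = (⟨j, hj.continuous⟩ : C(C, Q)).comp (fC V) :=
    fun V => ContinuousMap.exists_restrict_eq hS _
  choose k hk using hext
  have hk' : ∀ V (s : S), k V s = j (fC V s) := fun V s => DFunLike.congr_fun (hk V) s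
  let Z := StoneCech (Λ × D)
  have hkc : Continuous fun y : Λ × D => k y.1 y.2 :=
    continuous_prod_of_discrete_left.2 fun V => (k V).continuous
  let H : Z → Q := stoneCechExtend hkc
  have hH : Continuous H := continuous_stoneCechExtend hkc
  have hHu : ∀ y, H (stoneCechUnit y) = k y.1 y.2 := fun y => stoneCechExtend_stoneCechUnit hkc y
  have hbc : ∀ W : Λ, Continuous fun y : Λ × D => decide (y.1.1 ⊆ W.1) := fun W =>
    continuous_prod_of_discrete_left.2 fun V =>
      (continuous_const : Continuous fun _ : D => decide (V.1 ⊆ W.1))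
  let b : Λ → Z → Bool := fun W => stoneCechExtend (hbc W)
  have hb : ∀ W, Continuous (b W) := fun W => continuous_stoneCechExtend (hbc W)
  have hbu : ∀ W y, b W (stoneCechUnit y) = decide (y.1.1 ⊆ W.1) := fun W y =>
    stoneCechExtend_stoneCechUnit (hbc W) y
  let A : Set Z := closure (stoneCechUnit '' {y : Λ × D | y.2 ∈ S})
  let Zi : Set Z := ⋂ W, b W ⁻¹' {true}
  have hZi : IsClosed Zi := isClosed_iInter fun W => (isClosed_discrete _).preimage (hb W)
  have hAcl : IsClosed A := isClosed_closure
  have hAj : ∀ z ∈ A, H z ∈ Set.range j := by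
    refine closure_minimal ?_ (hj.isClosed_range.preimage hH)
    rintro _ ⟨⟨V, d⟩, hd, rfl⟩
    exact ⟨fC V ⟨d, hd⟩, by rw [hHu]; exact (hk' V ⟨d, hd⟩).symm⟩
  have hAW : ∀ W : Λ, ∀ z ∈ A, b W z = false ∨ H z ∈ j '' {c | (c : X) ∈ closure W.1} := by
    intro W
    refine closure_minimal (t := b W ⁻¹' {false} ∪ H ⁻¹' (j '' {c | (c : X) ∈ closure W.1})) ?_ ?_
    · rintro _ ⟨⟨V, d⟩, hd, rfl⟩
      by_cases hVW : V.1 ⊆ W.1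
      · right
        refine ⟨fC V ⟨d, hd⟩, subset_closure (hVW (hfV V ⟨d, hd⟩).1), ?_⟩
        exact ((hHu (V, d)).trans (hk' V ⟨d, hd⟩)).symm
      · left
        rw [Set.mem_preimage, hbu]; simpa using hVW
    · refine IsClosed.union ((isClosed_discrete {false}).preimage (hb W)) (IsClosed.preimage hH ?_)
      exact hj.isClosedMap _ (isClosed_closure.preimage continuous_subtype_val)
  let p' : C := ⟨p, mem_of_mem_nhds hCp⟩
  have hAZi : ∀ z ∈ A, z ∈ Zi → H z = j p' := by
    intro z hzA hz
    obtain ⟨c, hc⟩ := hAj z hzA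
    rw [← hc]
    congr 1
    by_contra hne
    have hne' : (c : X) ≠ p := fun h => hne (Subtype.ext h)
    obtain ⟨O, W, hO, hW, hcO, hpW, hOW⟩ := t2_separation hne'
    rcases hAW ⟨W, hW.mem_nhds hpW⟩ z hzA with h1 | ⟨c', hc', h1⟩
    · have h2 : b ⟨W, hW.mem_nhds hpW⟩ z = true := Set.mem_iInter.1 hz _
      rw [h1] at h2; exact Bool.noConfusion h2
    · rw [← hc] at h1
      have h3 := hj.injective h1
      subst h3
      exact (hOW.closure_right hO).le_bot ⟨hcO, hc'⟩
  let Z₀ : Set Z := A ∪ Zi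
  let H₀ : Z → Q := fun z => if z ∈ Zi then j p' else H z
  have hH₀A : ∀ z ∈ A, H₀ z = H z := fun z hz => by
    by_cases hzi : z ∈ Zi
    · simp only [H₀, hzi, if_true, hAZi z hz hzi]
    · simp only [H₀, hzi, if_false]
  have hH₀Z : ∀ z ∈ Zi, H₀ z = j p' := fun z hz => by simp only [H₀, hz, if_true]
  have hH₀ : ContinuousOn H₀ Z₀ :=
    ContinuousOn.union_of_isClosed (hH.continuousOn.congr hH₀A)
      (continuousOn_const.congr hH₀Z) hAcl hZi
  have hH₀r : ∀ z : Z₀, ∃ c, j c = H₀ z := by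
    rintro ⟨z, hz | hz⟩
    · obtain ⟨c, hc⟩ := hAj z hz
      exact ⟨c, by rw [hc, hH₀A z hz]⟩
    · exact ⟨p', (hH₀Z z hz).symm⟩
  choose c hc using hH₀r
  have hcc : Continuous c := by
    rw [hj.isInducing.continuous_iff]
    have : (j ∘ c) = fun z : Z₀ => H₀ z := funext hc
    rw [this]
    exact continuousOn_iff_continuous_domRestrict.1 hH₀
  obtain ⟨O, hO, hZO, g, hg⟩ := h Z inferInstance inferInstance (covDimLE_stoneCech e hec hei) Z₀
    (hAcl.union hZi) ⟨fun z => (c z : X), by fun_prop⟩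
  have hgcO : ContinuousOn (fun z => if hz : z ∈ O then g ⟨z, hz⟩ else p) O := by
    rw [continuousOn_iff_continuous_domRestrict]
    refine g.continuous.congr fun z => ?_
    simp [z.2]
  let O' : Set Z := O ∩ (fun z => if hz : z ∈ O then g ⟨z, hz⟩ else p) ⁻¹' interior U
  have hO' : IsOpen O' := hgcO.isOpen_inter_preimage hO isOpen_interior
  have hZiO' : Zi ⊆ O' := by
    intro z hz
    have hzO : z ∈ O := hZO (Or.inr hz)
    refine ⟨hzO, ?_⟩
    rw [Set.mem_preimage, dif_pos hzO, hg z (Or.inr hz)]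
    have h1 : c ⟨z, Or.inr hz⟩ = p' := hj.injective (by rw [hc]; exact hH₀Z z hz)
    change (c ⟨z, Or.inr hz⟩ : X) ∈ interior U
    rw [h1]
    exact mem_interior_iff_mem_nhds.2 hU
  obtain ⟨t, ht⟩ := hO'.isClosed_compl.isCompact.elim_finite_subfamily_closed
    (fun W => b W ⁻¹' {true}) (fun W => (isClosed_discrete _).preimage (hb W)) (by
      rw [← Set.disjoint_iff_inter_eq_empty]
      exact Set.disjoint_left.2 fun z hz hz' => hz (hZiO' hz'))
  let V : Λ := ⟨⋂ W ∈ t, W.1, (Filter.biInter_finset_mem t).2 fun W _ => W.2⟩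
  have hV : ∀ d, stoneCechUnit (V, d) ∈ O' := by
    intro d
    by_contra hd
    have : stoneCechUnit (V, d) ∈ (O'ᶜ ∩ ⋂ W ∈ t, b W ⁻¹' {true}) := by
      refine ⟨hd, Set.mem_iInter₂.2 fun W hW => ?_⟩
      rw [Set.mem_preimage, hbu, Set.mem_singleton_iff, decide_eq_true_eq]
      exact Set.biInter_subset_of_mem hW
    rw [ht] at this
    exact this
  let F : C(D, X) := ⟨fun d => g ⟨stoneCechUnit (V, d), (hV d).1⟩, by
    refine g.continuous.comp (Continuous.subtype_mk ?_ _)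
    exact continuous_stoneCechUnit.comp (by fun_prop)⟩
  obtain ⟨s, hs⟩ := hfbad V F fun d => by
    have := (hV d).2
    rw [Set.mem_preimage, dif_pos (hV d).1] at this
    exact interior_subset this
  apply hs
  have hsA : stoneCechUnit (V, (s : D)) ∈ A := subset_closure ⟨(V, (s : D)), s.2, rfl⟩
  change g ⟨stoneCechUnit (V, (s : D)), _⟩ = _
  rw [hg _ (Or.inl hsA)]
  change (c ⟨stoneCechUnit (V, (s : D)), Or.inl hsA⟩ : X) = f V s
  have : c ⟨stoneCechUnit (V, (s : D)), Or.inl hsA⟩ = fC V s := hj.injective (by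
    rw [hc, ← hk' V s]
    exact (hH₀A _ hsA).trans (hHu _))
  rw [this]
  rfl

end LocalExtension

section Chains

/-- Continuous maps from `S` into `V` extend to continuous maps from `D` into `U`. -/
def FillsIn {X D : Type*} [TopologicalSpace X] [TopologicalSpace D] (S : Set D) (V U : Set X) :
    Prop :=
  ∀ f : C(S, X), (∀ x, f x ∈ V) → ∃ F : C(D, X), (∀ x, F x ∈ U) ∧ ∀ x : S, F x = f x

lemma FillsIn.exists_path {X : Type*} [TopologicalSpace X] {V U : Set X}
    (h : FillsIn ({0, 1} : Set unitInterval) V U) {x y : X} (hx : x ∈ V) (hy : y ∈ V) :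
    ∃ γ : C(unitInterval, X), γ 0 = x ∧ γ 1 = y ∧ ∀ t, γ t ∈ U := by
  classical
  let f : C(({0, 1} : Set unitInterval), X) := ⟨fun t => if (t : unitInterval) = 0 then x else y, by
    have : Finite ({0, 1} : Set unitInterval) := Set.toFinite _
    exact continuous_of_discreteTopology⟩
  obtain ⟨F, hF, hFf⟩ := h f fun t => by
    change (if (t : unitInterval) = 0 then x else y) ∈ _
    split_ifs <;> assumption
  refine ⟨F, ?_, ?_, hF⟩
  · exact (hFf ⟨0, by simp⟩).trans (if_pos rfl)
  · exact (hFf ⟨1, by simp⟩).trans (if_neg one_ne_zero)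

lemma FillsIn.mono {X D : Type*} [TopologicalSpace X] [TopologicalSpace D] {S : Set D}
    {V V' U : Set X} (h : FillsIn S V U) (hV : V' ⊆ V) : FillsIn S V' U :=
  fun f hf => h f fun x => hV (hf x)

lemma IsANE4.exists_fillsIn {X : Type u} [TopologicalSpace X] [LocallyCompactSpace X]
    [T2Space X] (h : IsANE4 X) {D : Type} [TopologicalSpace D] [CompactSpace D]
    (e : D → (Fin 4 → ℝ)) (hec : Continuous e) (hei : Function.Injective e)
    {S : Set D} (hS : IsClosed S) (p : X) {U : Set X} (hU : U ∈ 𝓝 p) :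
    ∃ V ∈ 𝓝 p, FillsIn S V U := by
  obtain ⟨V, hV, hVU⟩ := h.exists_nhds_extension (D := ULift.{u} D) (fun d => e d.down)
    (hec.comp continuous_uliftDown) (hei.comp ULift.down_injective)
    (S := ULift.down ⁻¹' S) (hS.preimage continuous_uliftDown) p hU
  refine ⟨V, hV, fun f hf => ?_⟩
  obtain ⟨F, hF, hFf⟩ := hVU ⟨fun x => f ⟨x.1.down, x.2⟩, by
    exact f.continuous.comp
      ((continuous_uliftDown.comp continuous_subtype_val).subtype_mk _)⟩ fun x => hf _
  exact ⟨⟨fun d => F ⟨d⟩, F.continuous.comp continuous_uliftUp⟩, fun x => hF _,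
    fun x => hFf ⟨⟨x⟩, x.2⟩⟩

/-- The closed unit ball of `ℂ²`. -/
abbrev ComplexBall : Type := {w : ℂ × ℂ // ‖w.1‖ ^ 2 + ‖w.2‖ ^ 2 ≤ 1}

/-- The unit sphere of `ℂ²`, as a subset of the closed ball. -/
def complexSphere : Set ComplexBall := {w | ‖w.1.1‖ ^ 2 + ‖w.1.2‖ ^ 2 = 1}

/-- The boundary of the unit square. -/
def squareBoundary : Set (unitInterval × unitInterval) :=
  {p | p.1 = 0 ∨ p.1 = 1 ∨ p.2 = 0 ∨ p.2 = 1}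

instance : CompactSpace ComplexBall := by
  refine isCompact_iff_compactSpace.1 (Metric.isCompact_of_isClosed_isBounded ?_ ?_)
  · have hc : IsClosed {w : ℂ × ℂ | ‖w.1‖ ^ 2 + ‖w.2‖ ^ 2 ≤ 1} :=
      isClosed_le (by fun_prop) continuous_const
    exact hc
  · refine (Metric.isBounded_closedBall (x := (0 : ℂ × ℂ)) (r := 1)).subset fun w hw => ?_
    have hw' : ‖w.1‖ ^ 2 + ‖w.2‖ ^ 2 ≤ 1 := hw
    rw [mem_closedBall_zero_iff, Prod.norm_def, max_le_iff]
    constructor <;> nlinarith [norm_nonneg w.1, norm_nonneg w.2, sq_nonneg ‖w.1‖, sq_nonneg ‖w.2‖]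

/-- A decreasing sequence of neighborhoods of `1` in a topological group along which
paths, squares and four-dimensional balls can be filled. -/
structure FillingChain (G : Type*) [Group G] [TopologicalSpace G] where
  V : ℕ → Set G
  isOpen : ∀ n, IsOpen (V n)
  one_mem : ∀ n, 1 ∈ V n
  div_mem : ∀ n, ∀ x ∈ V (n + 1), ∀ y ∈ V (n + 1), x * y⁻¹ ∈ V n
  isCompact : IsCompact (closure (V 0))
  fillsIn_path : ∀ n, FillsIn ({0, 1} : Set unitInterval) (V (n + 1)) (V n)
  fillsIn_square : ∀ n, FillsIn squareBoundary (V (n + 1)) (V n)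
  fillsIn_ball : ∀ n, FillsIn complexSphere (V (n + 1)) (V n)

lemma IsANE4.nonempty_fillingChain {G : Type u} [Group G] [TopologicalSpace G]
    [IsTopologicalGroup G] [LocallyCompactSpace G] [T2Space G] (h : IsANE4 G) :
    Nonempty (FillingChain G) := by
  have hstep : ∀ U : {U : Set G // IsOpen U ∧ (1 : G) ∈ U}, ∃ V : {V : Set G // IsOpen V ∧ 1 ∈ V},
      (∀ x ∈ V.1, ∀ y ∈ V.1, x * y⁻¹ ∈ U.1) ∧ FillsIn ({0, 1} : Set unitInterval) V.1 U.1 ∧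
      FillsIn squareBoundary V.1 U.1 ∧ FillsIn complexSphere V.1 U.1 := by
    rintro ⟨U, hU, h1⟩
    have hU1 := hU.mem_nhds h1
    obtain ⟨A, hA, hAU⟩ : ∃ A ∈ 𝓝 (1 : G), ∀ x ∈ A, ∀ y ∈ A, x * y⁻¹ ∈ U := by
      obtain ⟨A, hA, hAU⟩ := exists_nhds_split_inv hU1
      exact ⟨A, hA, fun x hx y hy => by simpa [div_eq_mul_inv] using hAU x hx y hy⟩
    obtain ⟨B, hB, hBU⟩ := h.exists_fillsIn (D := unitInterval)
      (fun t _ => (t : ℝ)) (by fun_prop) (fun x y hxy => Subtype.ext (congrFun hxy 0))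
      (S := {0, 1}) (Set.toFinite _).isClosed 1 hU1
    obtain ⟨C, hC, hCU⟩ := h.exists_fillsIn (D := unitInterval × unitInterval)
      (fun p => ![(p.1 : ℝ), (p.2 : ℝ), 0, 0])
      (by refine continuous_pi fun i => ?_; fin_cases i <;> simp <;> fun_prop)
      (fun x y hxy => Prod.ext (Subtype.ext (congrFun hxy 0)) (Subtype.ext (congrFun hxy 1)))
      (S := squareBoundary) (by
        refine IsClosed.union (isClosed_eq continuous_fst continuous_const) (IsClosed.union
          (isClosed_eq continuous_fst continuous_const) (IsClosed.union
          (isClosed_eq continuous_snd continuous_const)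
            (isClosed_eq continuous_snd continuous_const)))) 1 hU1
    obtain ⟨E, hE, hEU⟩ := h.exists_fillsIn (D := ComplexBall)
      (fun p => ![p.1.1.re, p.1.1.im, p.1.2.re, p.1.2.im])
      (by refine continuous_pi fun i => ?_; fin_cases i <;> simp <;> fun_prop)
      (fun x y hxy => Subtype.ext (Prod.ext
        (Complex.ext (congrFun hxy 0) (congrFun hxy 1))
        (Complex.ext (congrFun hxy 2) (congrFun hxy 3))))
      (S := complexSphere) (isClosed_eq (by fun_prop) continuous_const) 1 hU1
    have hn : A ∩ B ∩ C ∩ E ∈ 𝓝 (1 : G) := by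
      refine Filter.inter_mem (Filter.inter_mem (Filter.inter_mem hA hB) hC) hE
    obtain ⟨W, hW, hWo, hW1⟩ := mem_nhds_iff.1 hn
    exact ⟨⟨W, hWo, hW1⟩, fun x hx y hy => hAU x (hW hx).1.1.1 y (hW hy).1.1.1,
      hBU.mono fun x hx => (hW hx).1.1.2, hCU.mono fun x hx => (hW hx).1.2,
      hEU.mono fun x hx => (hW hx).2⟩
  choose next hnext using hstep
  obtain ⟨K, hK, hK1⟩ := exists_compact_mem_nhds (1 : G)
  let V : ℕ → {V : Set G // IsOpen V ∧ (1 : G) ∈ V} := fun n =>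
    Nat.rec ⟨interior K, isOpen_interior, mem_interior_iff_mem_nhds.2 hK1⟩ (fun _ U => next U) n
  exact ⟨{
    V := fun n => (V n).1
    isOpen := fun n => (V n).2.1
    one_mem := fun n => (V n).2.2
    div_mem := fun n => (hnext (V n)).1
    isCompact := hK.of_isClosed_subset isClosed_closure
      (closure_minimal interior_subset hK.isClosed)
    fillsIn_path := fun n => (hnext (V n)).2.1
    fillsIn_square := fun n => (hnext (V n)).2.2.1
    fillsIn_ball := fun n => (hnext (V n)).2.2.2 }⟩

namespace FillingChain

variable {G : Type*} [Group G] [TopologicalSpace G] (c : FillingChain G)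

lemma subset_succ (n : ℕ) : c.V (n + 1) ⊆ c.V n := fun x hx => by
  simpa using c.div_mem n x hx 1 (c.one_mem _)

lemma antitone : Antitone c.V := antitone_nat_of_succ_le c.subset_succ

lemma inv_mem {n : ℕ} {x : G} (hx : x ∈ c.V (n + 1)) : x⁻¹ ∈ c.V n := by
  simpa using c.div_mem n 1 (c.one_mem _) x hx

lemma mul_mem {n : ℕ} {x y : G} (hx : x ∈ c.V (n + 2)) (hy : y ∈ c.V (n + 2)) :
    x * y ∈ c.V n := by
  simpa using c.div_mem n x (c.subset_succ _ hx) y⁻¹ (c.inv_mem hy)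

/-- The intersection of a filling chain is a subgroup. -/
def core : Subgroup G where
  carrier := ⋂ n, c.V n
  one_mem' := Set.mem_iInter.2 c.one_mem
  mul_mem' hx hy := Set.mem_iInter.2 fun _ =>
    c.mul_mem (Set.mem_iInter.1 hx _) (Set.mem_iInter.1 hy _)
  inv_mem' hx := Set.mem_iInter.2 fun _ => c.inv_mem (Set.mem_iInter.1 hx _)

lemma mem_core {x : G} : x ∈ c.core ↔ ∀ n, x ∈ c.V n := Set.mem_iInter

lemma core_subset (n : ℕ) : (c.core : Set G) ⊆ c.V n := fun _ hx => c.mem_core.1 hx n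

/-- Any two points of the core are joined by paths in every member of the chain. -/
lemma exists_path (n : ℕ) {x y : G} (hx : x ∈ c.V (n + 1)) (hy : y ∈ c.V (n + 1)) :
    ∃ γ : C(unitInterval, G), γ 0 = x ∧ γ 1 = y ∧ ∀ t, γ t ∈ c.V n :=
  (c.fillsIn_path n).exists_path hx hy

variable [IsTopologicalGroup G]

lemma closure_subset (n : ℕ) : closure (c.V (n + 1)) ⊆ c.V n := by
  intro x hx
  obtain ⟨y, hy, hyV⟩ := mem_closure_iff.1 hx {y | x⁻¹ * y ∈ c.V (n + 1)}
    ((c.isOpen _).preimage (by fun_prop)) (by simpa using c.one_mem _)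
  simpa using c.div_mem n y hyV (x⁻¹ * y) hy

lemma isClosed_core : IsClosed (c.core : Set G) := by
  have : (c.core : Set G) = ⋂ n, closure (c.V n) := by
    refine Set.Subset.antisymm (fun x hx => Set.mem_iInter.2 fun n =>
      subset_closure (c.mem_core.1 hx n)) fun x hx => c.mem_core.2 fun n =>
      c.closure_subset n (Set.mem_iInter.1 hx _)
  rw [this]
  exact isClosed_iInter fun _ => isClosed_closure

lemma isCompact_core : IsCompact (c.core : Set G) :=
  c.isCompact.of_isClosed_subset c.isClosed_core
    ((c.core_subset 0).trans subset_closure)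

instance : CompactSpace c.core := isCompact_iff_compactSpace.1 c.isCompact_core

lemma exists_subset {O : Set G} (hO : IsOpen O) (h : (c.core : Set G) ⊆ O) :
    ∃ n, c.V n ⊆ O := by
  obtain ⟨t, ht⟩ := (c.isCompact.diff hO).elim_finite_subfamily_closed
    (fun n => closure (c.V n)) (fun n => isClosed_closure) (by
      rw [← Set.disjoint_iff_inter_eq_empty]
      exact Set.disjoint_left.2 fun x hx hx' => hx.2 (h (c.mem_core.2 fun n =>
        c.closure_subset n (Set.mem_iInter.1 hx' _))))
  refine ⟨t.sup id, fun x hx => ?_⟩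
  by_contra hxO
  have : x ∈ (closure (c.V 0) \ O) ∩ ⋂ n ∈ t, closure (c.V n) :=
    ⟨⟨subset_closure (c.antitone (Nat.zero_le _) hx), hxO⟩, Set.mem_iInter₂.2 fun n hn =>
      subset_closure (c.antitone (Finset.le_sup (f := id) hn) hx)⟩
  rw [ht] at this
  exact this

lemma metrizableSpace_of_core_eq_bot [T2Space G] (h : c.core = ⊥) :
    TopologicalSpace.MetrizableSpace G := by
  have hb : (𝓝 (1 : G)).HasCountableBasis (fun _ : ℕ => True) c.V := by
    refine ⟨⟨fun s => ⟨fun hs => ?_, fun ⟨n, _, hn⟩ => ?_⟩⟩, Set.to_countable _⟩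
    · obtain ⟨O, hOs, hO, hO1⟩ := mem_nhds_iff.1 hs
      obtain ⟨n, hn⟩ := c.exists_subset hO (by rw [h]; simpa using hO1)
      exact ⟨n, trivial, hn.trans hOs⟩
    · exact Filter.mem_of_superset ((c.isOpen n).mem_nhds (c.one_mem n)) hn
  have hc : (𝓝 (1 : G)).IsCountablyGenerated := hb.isCountablyGenerated
  let _ : UniformSpace G := IsTopologicalGroup.rightUniformSpace G
  have : (uniformity G).IsCountablyGenerated :=
    Filter.comap.isCountablyGenerated _ _
  exact UniformSpace.metrizableSpace

lemma isPreconnected_core [T2Space G] : IsPreconnected (c.core : Set G) := by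
  rw [isPreconnected_iff_subset_of_fully_disjoint_closed c.isClosed_core]
  intro A B hA hB hAB hd
  have hsep := SeparatedNhds.of_isCompact_isCompact (c.isCompact_core.inter_right hA)
    (c.isCompact_core.inter_right hB) (hd.mono Set.inter_subset_right Set.inter_subset_right)
  obtain ⟨P, Q, hP, hQ, hAP, hBQ, hPQ⟩ := hsep
  by_contra! hcon
  obtain ⟨hcA, hcB⟩ := hcon
  obtain ⟨x, hx, hxA⟩ := Set.not_subset.1 hcA
  obtain ⟨y, hy, hyB⟩ := Set.not_subset.1 hcB
  have hxQ : x ∈ Q := hBQ ⟨hx, (hAB hx).resolve_left hxA⟩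
  have hyP : y ∈ P := hAP ⟨hy, (hAB hy).resolve_right hyB⟩
  obtain ⟨n, hn⟩ := c.exists_subset (hP.union hQ) fun z hz =>
    (hAB hz).imp (fun h => hAP ⟨hz, h⟩) fun h => hBQ ⟨hz, h⟩
  obtain ⟨γ, h0, h1, hγ⟩ := c.exists_path n (c.mem_core.1 hx _) (c.mem_core.1 hy _)
  have hr : IsPreconnected (Set.range γ) := isPreconnected_range γ.continuous
  obtain ⟨z, -, hzP, hzQ⟩ := hr P Q hP hQ
    (by rintro _ ⟨t, rfl⟩; exact hn (hγ t)) ⟨y, ⟨1, h1⟩, hyP⟩ ⟨x, ⟨0, h0⟩, hxQ⟩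
  exact hPQ.le_bot ⟨hzP, hzQ⟩

lemma connectedSpace_core [T2Space G] : ConnectedSpace c.core :=
  isConnected_iff_connectedSpace.1 ⟨⟨1, c.core.one_mem⟩, c.isPreconnected_core⟩

end FillingChain

end Chains

section MaurerCartan

variable {E 𝔸 : Type*} [NormedAddCommGroup E] [NormedSpace ℝ E] [NormedRing 𝔸]
  [NormedAlgebra ℝ 𝔸] [CompleteSpace 𝔸]

/-- The logarithmic derivative `H⁻¹ dH` of a map into a Banach algebra. -/
noncomputable def logFDeriv (H : E → 𝔸) (v x : E) : 𝔸 := Ring.inverse (H x) * fderiv ℝ H x v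

lemma exists_hasFDerivAt_logFDeriv {H : E → 𝔸} {x : E} (hH : ContDiffAt ℝ 2 H x)
    (hx : IsUnit (H x)) (v : E) :
    ∃ L : E →L[ℝ] 𝔸, HasFDerivAt (logFDeriv H v) L x ∧
      ∀ w, L w = -(logFDeriv H w x * logFDeriv H v x) +
        Ring.inverse (H x) * fderiv ℝ (fderiv ℝ H) x w v := by
  obtain ⟨u, hu⟩ := hx
  have h1 : HasFDerivAt H (fderiv ℝ H x) x :=
    (hH.differentiableAt (by norm_num)).hasFDerivAt
  have h2 : HasFDerivAt (fderiv ℝ H) (fderiv ℝ (fderiv ℝ H) x) x :=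
    ((hH.fderiv_right (m := 1) (by norm_num)).differentiableAt (by norm_num)).hasFDerivAt
  have h3 := hasFDerivAt_ringInverse (𝕜 := ℝ) u
  rw [hu] at h3
  replace h3 := h3.comp x h1
  have h4 := h2.clm_apply (hasFDerivAt_const v x)
  refine ⟨_, h3.mul' h4, fun w => ?_⟩
  have hi : (↑u⁻¹ : 𝔸) = Ring.inverse (H x) := by rw [← hu, Ring.inverse_unit]
  simp [logFDeriv, hi, mul_assoc]
  exact add_comm _ _

/-- The pullback along `H` of the invariant three-form defined by a trace `τ`. -/
noncomputable def cartanForm (τ : 𝔸 →L[ℝ] ℝ) (H : E → 𝔸) (u v w x : E) : ℝ :=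
  τ (logFDeriv H u x * (logFDeriv H v x * logFDeriv H w x - logFDeriv H w x * logFDeriv H v x))

lemma exists_hasFDerivAt_cartanForm (τ : 𝔸 →L[ℝ] ℝ) {H : E → 𝔸} {x : E}
    (hH : ContDiffAt ℝ 2 H x) (hx : IsUnit (H x)) (u v w : E) :
    ∃ L : E →L[ℝ] ℝ, HasFDerivAt (cartanForm τ H u v w) L x ∧
      ∀ e, L e =
        let A := fun u => logFDeriv H u x
        let A' := fun u e => -(A e * A u) + Ring.inverse (H x) * fderiv ℝ (fderiv ℝ H) x e u
        τ (A' u e * (A v * A w - A w * A v) +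
          A u * (A' v e * A w + A v * A' w e - (A' w e * A v + A w * A' v e))) := by
  obtain ⟨U, hU, hU'⟩ := exists_hasFDerivAt_logFDeriv hH hx u
  obtain ⟨V, hV, hV'⟩ := exists_hasFDerivAt_logFDeriv hH hx v
  obtain ⟨W, hW, hW'⟩ := exists_hasFDerivAt_logFDeriv hH hx w
  refine ⟨_, τ.hasFDerivAt.comp x (hU.mul' ((hV.mul' hW).sub (hW.mul' hV))), fun e => ?_⟩
  simp only [← hU', ← hV', ← hW', ContinuousLinearMap.comp_apply]
  congr 1
  simp
  abel_nf

/-- The pulled back three-form is closed. -/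
lemma cartanForm_closed (τ : 𝔸 →L[ℝ] ℝ) (hτ : ∀ x y, τ (x * y) = τ (y * x)) {H : E → 𝔸} {x : E}
    (hH : ContDiffAt ℝ 2 H x) (hx : IsUnit (H x)) (e₀ e₁ e₂ e₃ : E) :
    fderiv ℝ (cartanForm τ H e₁ e₂ e₃) x e₀ - fderiv ℝ (cartanForm τ H e₀ e₂ e₃) x e₁ +
      fderiv ℝ (cartanForm τ H e₀ e₁ e₃) x e₂ - fderiv ℝ (cartanForm τ H e₀ e₁ e₂) x e₃ = 0 := by
  obtain ⟨L₀, h₀, h₀'⟩ := exists_hasFDerivAt_cartanForm τ hH hx e₁ e₂ e₃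
  obtain ⟨L₁, h₁, h₁'⟩ := exists_hasFDerivAt_cartanForm τ hH hx e₀ e₂ e₃
  obtain ⟨L₂, h₂, h₂'⟩ := exists_hasFDerivAt_cartanForm τ hH hx e₀ e₁ e₃
  obtain ⟨L₃, h₃, h₃'⟩ := exists_hasFDerivAt_cartanForm τ hH hx e₀ e₁ e₂
  rw [h₀.fderiv, h₁.fderiv, h₂.fderiv, h₃.fderiv, h₀', h₁', h₂', h₃']
  have hsymm : IsSymmSndFDerivAt ℝ H x := hH.isSymmSndFDerivAt (by simp)
  set R := Ring.inverse (H x)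
  simp only
  generalize logFDeriv H e₀ x = a
  generalize logFDeriv H e₁ x = b
  generalize logFDeriv H e₂ x = c
  generalize logFDeriv H e₃ x = d
  rw [hsymm e₁ e₀, hsymm e₂ e₀, hsymm e₃ e₀, hsymm e₂ e₁, hsymm e₃ e₁, hsymm e₃ e₂]
  generalize R * fderiv ℝ (fderiv ℝ H) x e₀ e₁ = p01
  generalize R * fderiv ℝ (fderiv ℝ H) x e₀ e₂ = p02
  generalize R * fderiv ℝ (fderiv ℝ H) x e₀ e₃ = p03
  generalize R * fderiv ℝ (fderiv ℝ H) x e₁ e₂ = p12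
  generalize R * fderiv ℝ (fderiv ℝ H) x e₁ e₃ = p13
  generalize R * fderiv ℝ (fderiv ℝ H) x e₂ e₃ = p23
  have r2 : ∀ y z w, τ (y * (z * (a * w))) = τ (a * (w * (y * z))) := fun y z w => by
    rw [← mul_assoc, hτ, mul_assoc]
  have r3 : ∀ y z w, τ (y * (a * (z * w))) = τ (a * (z * (w * y))) := fun y z w => by
    rw [hτ]; simp only [mul_assoc]
  have m : ∀ p y z, τ (y * (p * z)) = τ (p * (z * y)) := fun p y z => by
    rw [hτ]; simp only [mul_assoc]
  have l : ∀ p y z, τ (y * (z * p)) = τ (p * (y * z)) := fun p y z => by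
    rw [hτ p]; simp only [mul_assoc]
  simp only [mul_add, add_mul, mul_sub, mul_neg, neg_mul, mul_assoc, map_add, map_sub,
    map_neg, r2, r3, m p02, m p03, m p12, m p13, m p23, l p02, l p03, l p12,
    l p13, l p23]
  ring

end MaurerCartan

section CartanIntegral

lemma Fin.insertNth_eq_add_smul_single {n : ℕ} (i : Fin (n + 1)) (p q : ℝ) (y : Fin n → ℝ) :
    i.insertNth (α := fun _ => ℝ) p y =
      i.insertNth (α := fun _ => ℝ) q y + (p - q) • Pi.single i 1 := by
  rw [Fin.insertNth_eq_iff]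
  refine ⟨by simp, funext fun j => ?_⟩
  simp [Fin.removeNth]

variable {𝔸 : Type*} [NormedRing 𝔸] [NormedAlgebra ℝ 𝔸] [CompleteSpace 𝔸]

section

variable {E : Type*} [NormedAddCommGroup E] [NormedSpace ℝ E]

omit [CompleteSpace 𝔸] in
lemma logFDeriv_eq_of_hasDerivAt {H : E → 𝔸} {x v : E} (hH : DifferentiableAt ℝ H x) {d : 𝔸}
    (hd : HasDerivAt (fun s : ℝ => H (x + s • v)) d 0) :
    logFDeriv H v x = Ring.inverse (H x) * d := by
  have h1 : HasDerivAt (fun s : ℝ => x + s • v) v 0 := by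
    simpa using ((hasDerivAt_id (0 : ℝ)).smul_const v).const_add x
  have h2 := HasFDerivAt.comp_hasDerivAt (f := fun s : ℝ => x + s • v) (l := H)
    (l' := fderiv ℝ H x) 0 (by simpa using hH.hasFDerivAt) h1
  rw [logFDeriv, hd.unique h2]

omit [CompleteSpace 𝔸] in
lemma logFDeriv_eq_zero_of_forall_eq {H : E → 𝔸} {x v : E} (hH : DifferentiableAt ℝ H x)
    (h : ∀ s : ℝ, H (x + s • v) = H x) : logFDeriv H v x = 0 := by
  rw [logFDeriv_eq_of_hasDerivAt hH (d := 0), mul_zero]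
  simp only [h]
  exact hasDerivAt_const _ _

omit [CompleteSpace 𝔸] in
lemma logFDeriv_add_right {H : E → 𝔸} {w : E} (h : ∀ x, H (x + w) = H x) (v x : E) :
    logFDeriv H v (x + w) = logFDeriv H v x := by
  have : (fun x => H (x + w)) = H := funext h
  rw [logFDeriv, logFDeriv, h, ← fderiv_comp_add_right, this]

omit [CompleteSpace 𝔸] in
lemma logFDeriv_add_left (H : E → 𝔸) (v w x : E) :
    logFDeriv H (v + w) x = logFDeriv H v x + logFDeriv H w x := by
  simp [logFDeriv, mul_add]

omit [CompleteSpace 𝔸] in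
lemma logFDeriv_sub_left (H : E → 𝔸) (v w x : E) :
    logFDeriv H (v - w) x = logFDeriv H v x - logFDeriv H w x := by
  simp [logFDeriv, mul_sub]

lemma differentiableAt_cartanForm (τ : 𝔸 →L[ℝ] ℝ) {H : E → 𝔸} {x : E}
    (hH : ContDiffAt ℝ 2 H x) (hx : IsUnit (H x)) (u v w : E) :
    DifferentiableAt ℝ (cartanForm τ H u v w) x := by
  obtain ⟨L, hL, -⟩ := exists_hasFDerivAt_cartanForm τ hH hx u v w
  exact hL.differentiableAt

end

/-- The box parametrizing a homotopy of maps from the three-sphere. -/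
noncomputable def sphereBox : Fin 4 → ℝ := ![1, 2 * Real.pi, Real.pi / 2, 2 * Real.pi]

lemma sphereBox_nonneg : 0 ≤ sphereBox := by
  intro i
  fin_cases i <;> simp [sphereBox] <;> positivity

/-- Homotopy invariance of the integral of the invariant three-form over the three-sphere. -/
lemma integral_cartanForm_eq (τ : 𝔸 →L[ℝ] ℝ) (hτ : ∀ x y, τ (x * y) = τ (y * x))
    (e : Fin 4 → Fin 4 → ℝ) (he : ∀ i, e i = Pi.single i 1)
    {H : (Fin 4 → ℝ) → 𝔸} (hH : ContDiff ℝ 2 H) (hunit : ∀ x ∈ Set.Icc (0 : Fin 4 → ℝ) sphereBox, IsUnit (H x))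
    (h1 : ∀ x, H (x + (2 * Real.pi) • e 1) = H x) (h3 : ∀ x, H (x + (2 * Real.pi) • e 3) = H x)
    (hb : ∀ x, x 2 = 0 → ∀ s : ℝ, H (x + s • (e 1 - e 3)) = H x)
    (hb' : ∀ x, x 2 = Real.pi / 2 → ∀ s : ℝ, H (x + s • (e 1 + e 3)) = H x) :
    ∫ y in Set.Icc ((0 : Fin 4 → ℝ) ∘ (0 : Fin 4).succAbove) (sphereBox ∘ (0 : Fin 4).succAbove),
      cartanForm τ H (e 1) (e 2) (e 3) ((0 : Fin 4).insertNth (α := fun _ => ℝ) 1 y) =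
    ∫ y in Set.Icc ((0 : Fin 4 → ℝ) ∘ (0 : Fin 4).succAbove) (sphereBox ∘ (0 : Fin 4).succAbove),
      cartanForm τ H (e 1) (e 2) (e 3) ((0 : Fin 4).insertNth (α := fun _ => ℝ) 0 y) := by
  have hd : ∀ x, DifferentiableAt ℝ H x := fun x => hH.differentiable (by norm_num) x
  let ω : Fin 4 → Fin 4 → Fin 4 → (Fin 4 → ℝ) → ℝ := fun i j k => cartanForm τ H (e i) (e j) (e k)
  have hω : ∀ i j k, ∀ x ∈ Set.Icc (0 : Fin 4 → ℝ) sphereBox, DifferentiableAt ℝ (ω i j k) x :=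
    fun i j k x hx => differentiableAt_cartanForm τ hH.contDiffAt (hunit x hx) _ _ _
  let F : Fin 4 → (Fin 4 → ℝ) → ℝ :=
    ![ω 1 2 3, fun x => -ω 0 2 3 x, ω 0 1 3, fun x => -ω 0 1 2 x]
  have hF : ∀ i, ∀ x ∈ Set.Icc (0 : Fin 4 → ℝ) sphereBox, DifferentiableAt ℝ (F i) x := by
    intro i x hx
    fin_cases i
    · exact hω _ _ _ x hx
    · exact (hω _ _ _ x hx).fun_neg
    · exact hω _ _ _ x hx
    · exact (hω _ _ _ x hx).fun_neg
  have hdiv : ∀ x ∈ Set.Icc (0 : Fin 4 → ℝ) sphereBox,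
      ∑ i, fderiv ℝ (F i) x (Pi.single i 1) = 0 := by
    intro x hx
    have := cartanForm_closed τ hτ hH.contDiffAt (hunit x hx) (e 0) (e 1) (e 2) (e 3)
    rw [Fin.sum_univ_four]
    simp only [F, Matrix.cons_val_zero, Matrix.cons_val_one, Matrix.cons_val, fderiv_fun_neg,
      ← he, _root_.neg_apply, ω]
    linarith
  have key := MeasureTheory.integral_divergence_of_hasFDerivAt_off_countable' 0 sphereBox
    sphereBox_nonneg F (fun i x => fderiv ℝ (F i) x) ∅ Set.countable_empty
    (fun i x hx => (hF i x hx).continuousAt.continuousWithinAt)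
    (fun x hx i => (hF i x ⟨fun j => (hx.1 j trivial).1.le, fun j =>
      (hx.1 j trivial).2.le⟩).hasFDerivAt)
    ((MeasureTheory.integrableOn_zero).congr_fun (fun x hx => (hdiv x hx).symm)
      measurableSet_Icc)
  rw [MeasureTheory.setIntegral_congr_fun measurableSet_Icc hdiv, MeasureTheory.integral_zero,
    Fin.sum_univ_four] at key
  have f1 : ∀ y, F 1 ((1 : Fin 4).insertNth (α := fun _ => ℝ) (sphereBox 1) y) =
      F 1 ((1 : Fin 4).insertNth (α := fun _ => ℝ) ((0 : Fin 4 → ℝ) 1) y) := by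
    intro y
    have hx := Fin.insertNth_eq_add_smul_single (1 : Fin 4) (sphereBox 1) ((0 : Fin 4 → ℝ) 1) y
    have h2 : sphereBox 1 - (0 : Fin 4 → ℝ) 1 = 2 * Real.pi := by simp [sphereBox]
    rw [h2, ← he] at hx
    rw [hx]
    simp only [F, Matrix.cons_val_one, Matrix.cons_val_zero, ω, cartanForm,
      logFDeriv_add_right h1]
  have f3 : ∀ y, F 3 ((3 : Fin 4).insertNth (α := fun _ => ℝ) (sphereBox 3) y) =
      F 3 ((3 : Fin 4).insertNth (α := fun _ => ℝ) ((0 : Fin 4 → ℝ) 3) y) := by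
    intro y
    have hx := Fin.insertNth_eq_add_smul_single (3 : Fin 4) (sphereBox 3) ((0 : Fin 4 → ℝ) 3) y
    have h2 : sphereBox 3 - (0 : Fin 4 → ℝ) 3 = 2 * Real.pi := by simp [sphereBox]
    rw [h2, ← he] at hx
    rw [hx]
    simp only [F, Matrix.cons_val, ω, cartanForm, logFDeriv_add_right h3]
  have f2 : ∀ y, F 2 ((2 : Fin 4).insertNth (α := fun _ => ℝ) (sphereBox 2) y) = 0 := by
    intro y
    have h0 := logFDeriv_eq_zero_of_forall_eq (hd _) (hb' ((2 : Fin 4).insertNth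
      (α := fun _ => ℝ) (sphereBox 2) y) (by simp [sphereBox]))
    rw [logFDeriv_add_left, add_eq_zero_iff_eq_neg] at h0
    simp only [F, Matrix.cons_val, ω, cartanForm, h0]
    simp
  have f2' : ∀ y, F 2 ((2 : Fin 4).insertNth (α := fun _ => ℝ) ((0 : Fin 4 → ℝ) 2) y) = 0 := by
    intro y
    have h0 := logFDeriv_eq_zero_of_forall_eq (hd _) (hb ((2 : Fin 4).insertNth
      (α := fun _ => ℝ) ((0 : Fin 4 → ℝ) 2) y) (by simp))
    rw [logFDeriv_sub_left, sub_eq_zero] at h0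
    simp only [F, Matrix.cons_val, ω, cartanForm, h0]
    simp
  simp only [f1, f2, f2', f3, sub_self, add_zero] at key
  have hs : sphereBox 0 = 1 := by simp [sphereBox]
  rw [hs] at key
  exact (sub_eq_zero.1 key.symm)

end CartanIntegral

section OneParameter

variable {𝔸 : Type*} [NormedRing 𝔸] [NormedAlgebra ℝ 𝔸] [CompleteSpace 𝔸]

open NormedSpace (exp)

lemma exp_add_smul (X : 𝔸) (s t : ℝ) : exp ((s + t) • X) = exp (s • X) * exp (t • X) := by
  let _ : NormedAlgebra ℚ 𝔸 := NormedAlgebra.restrictScalars ℚ ℝ 𝔸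
  rw [add_smul]
  exact NormedSpace.exp_add_of_commute (((Commute.refl X).smul_left s).smul_right t)

lemma exp_neg_smul_mul (X : 𝔸) (t : ℝ) : exp ((-t) • X) * exp (t • X) = 1 := by
  rw [← exp_add_smul]; simp

lemma exp_smul_mul_neg (X : 𝔸) (t : ℝ) : exp (t • X) * exp ((-t) • X) = 1 := by
  rw [← exp_add_smul]; simp

lemma isUnit_exp_smul (X : 𝔸) (t : ℝ) : IsUnit (exp (t • X)) :=
  ⟨⟨_, _, exp_smul_mul_neg X t, exp_neg_smul_mul X t⟩, rfl⟩

lemma commute_exp_smul (X : 𝔸) (t : ℝ) : Commute X (exp (t • X)) :=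
  ((Commute.refl X).smul_right t).exp_right

lemma contDiff_exp_smul (X : 𝔸) {n : WithTop ℕ∞} : ContDiff ℝ n fun t : ℝ => exp (t • X) := by
  have : ContDiff ℝ n (exp : 𝔸 → 𝔸) := contDiff_iff_contDiffAt.2 fun x =>
    (NormedSpace.exp_analytic (𝕂 := ℝ) x).contDiffAt
  exact this.comp (contDiff_id.smul contDiff_const)

lemma SemiconjBy.exp_smul {a X Y : 𝔸} (h : SemiconjBy a X Y) (t : ℝ) :
    SemiconjBy a (exp (t • X)) (exp (t • Y)) := by
  let _ : NormedAlgebra ℚ 𝔸 := NormedAlgebra.restrictScalars ℚ ℝ 𝔸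
  refine SemiconjBy.exp_right ?_
  rw [SemiconjBy, mul_smul_comm, smul_mul_assoc, h.eq]

/-- Conjugation by a one-parameter group acting by rotations. -/
lemma exp_smul_rotation {X Y Z : 𝔸} (hX : X * Z - Z * X = (2 : ℝ) • Y)
    (hY : Y * Z - Z * Y = (-2 : ℝ) • X) (t : ℝ) :
    X * exp (t • Z) = exp (t • Z) * (Real.cos (2 * t) • X + Real.sin (2 * t) • Y) := by
  let W : ℝ → 𝔸 := fun t => Real.cos (2 * t) • X + Real.sin (2 * t) • Y
  have h2 : ∀ t, HasDerivAt (fun s : ℝ => 2 * s) 2 t := fun t => by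
    simpa using (hasDerivAt_id t).const_mul (2 : ℝ)
  have hW : ∀ t, HasDerivAt W ((-Real.sin (2 * t) * 2) • X + (Real.cos (2 * t) * 2) • Y) t :=
    fun t => ((h2 t).cos.smul_const X).add ((h2 t).sin.smul_const Y)
  let g : ℝ → 𝔸 := fun t => exp (t • Z) * W t * exp (t • -Z)
  have hg : ∀ t, HasDerivAt g 0 t := fun t => by
    have h := ((hasDerivAt_exp_smul_const Z t).mul (hW t)).mul (hasDerivAt_exp_smul_const' (-Z) t)
    refine h.congr_deriv ?_
    have : exp (t • Z) * Z * W t + exp (t • Z) * ((-Real.sin (2 * t) * 2) • X +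
        (Real.cos (2 * t) * 2) • Y) = exp (t • Z) * W t * Z := by
      have h3 : (-Real.sin (2 * t) * 2) • X + (Real.cos (2 * t) * 2) • Y = W t * Z - Z * W t := by
        simp only [W, add_mul, mul_add, smul_mul_assoc, mul_smul_comm]
        rw [add_sub_add_comm, ← smul_sub, ← smul_sub, hX, hY, smul_smul, smul_smul, add_comm]
        congr 2
        ring
      rw [h3]
      noncomm_ring
    simp only [Pi.mul_apply]
    rw [this]
    generalize exp (t • -Z) = E
    noncomm_ring
  have hc := is_const_of_deriv_eq_zero (fun t => (hg t).differentiableAt)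
    (fun t => (hg t).deriv) t 0
  have h0 : g 0 = X := by simp [g, W]
  have ht : exp (t • -Z) * exp (t • Z) = 1 := by
    rw [smul_neg, ← neg_smul]; exact exp_neg_smul_mul Z t
  rw [h0] at hc
  nth_rw 1 [← hc]
  simp only [g]
  rw [mul_assoc, ht, mul_one]

/-- A triple of elements of an algebra satisfying the commutation relations of `𝔰𝔲(2)`. -/
structure IsSuTriple {R : Type*} [Ring R] [Module ℝ R] (I J K : R) : Prop where
  hIJ : I * J - J * I = (2 : ℝ) • K
  hJK : J * K - K * J = (2 : ℝ) • I
  hKI : K * I - I * K = (2 : ℝ) • J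

namespace IsSuTriple

variable {I J K : 𝔸} (h : IsSuTriple I J K)
include h

lemma I_mul_exp_J (b : ℝ) :
    I * exp (b • J) = exp (b • J) * (Real.cos (2 * b) • I + Real.sin (2 * b) • K) := by
  refine exp_smul_rotation h.hIJ ?_ b
  rw [neg_smul, ← h.hJK, neg_sub]

lemma J_mul_exp_I (a : ℝ) :
    J * exp (a • I) = exp (a • I) * (Real.cos (2 * a) • J - Real.sin (2 * a) • K) := by
  have h1 := exp_smul_rotation (X := J) (Y := -K) (Z := I)
    (by rw [smul_neg, ← h.hIJ, neg_sub])
    (by rw [neg_smul, ← h.hKI]; noncomm_ring) a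
  rw [h1, smul_neg, sub_eq_add_neg]

lemma commute_exp_pi (b : ℝ) : Commute (exp (Real.pi • I)) (exp (b • J)) := by
  have h1 : Commute (exp (Real.pi • I)) J := by
    have := h.J_mul_exp_I Real.pi
    simp only [Real.cos_two_pi, Real.sin_two_pi, one_smul, zero_smul, sub_zero] at this
    exact this.symm
  exact (h1.smul_right b).exp_right

lemma exp_flip (t : ℝ) :
    exp (t • I) * exp ((Real.pi / 2) • J) = exp ((Real.pi / 2) • J) * exp ((-t) • I) := by
  have h1 : SemiconjBy (exp ((Real.pi / 2) • J)) (-I) I := by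
    have := h.I_mul_exp_J (Real.pi / 2)
    rw [mul_div_cancel₀ _ (two_ne_zero' ℝ)] at this
    simp only [Real.cos_pi, Real.sin_pi, neg_smul, one_smul, zero_smul, add_zero] at this
    exact this.symm
  have := (h1.exp_smul t).eq
  rw [smul_neg, ← neg_smul] at this
  exact this.symm

lemma exp_two_pi : exp ((2 * Real.pi) • I) = 1 := by
  have h1 := h.exp_flip Real.pi
  rw [(h.commute_exp_pi (Real.pi / 2)).eq] at h1
  have h2 := (isUnit_exp_smul J (Real.pi / 2)).mul_left_cancel h1
  rw [two_mul, exp_add_smul]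
  nth_rw 1 [h2]
  exact exp_neg_smul_mul I Real.pi

end IsSuTriple

end OneParameter

section SphereMap

/-- Toroidal coordinates on the unit sphere of `ℂ²`. -/
noncomputable def spherePt (a b c : ℝ) : ℂ × ℂ :=
  ((Real.cos b : ℂ) * Complex.exp ((a + c : ℝ) * Complex.I),
    (Real.sin b : ℂ) * Complex.exp ((a - c : ℝ) * Complex.I))

lemma norm_sq_spherePt (a b c : ℝ) : ‖(spherePt a b c).1‖ ^ 2 + ‖(spherePt a b c).2‖ ^ 2 = 1 := by
  simp only [spherePt, norm_mul, Complex.norm_exp_ofReal_mul_I, mul_one, Complex.norm_real,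
    Real.norm_eq_abs, sq_abs, Real.cos_sq_add_sin_sq]

lemma spherePt_add_fst (a b c : ℝ) : spherePt (a + 2 * Real.pi) b c = spherePt a b c := by
  have h (x : ℝ) : Complex.exp ((x + 2 * Real.pi : ℝ) * Complex.I) =
      Complex.exp (x * Complex.I) := by
    have := Complex.exp_periodic (x * Complex.I)
    rw [← this]; push_cast; ring_nf
  simp only [spherePt, add_right_comm, add_sub_right_comm, h]

lemma spherePt_add_trd (a b c : ℝ) : spherePt a b (c + 2 * Real.pi) = spherePt a b c := by
  have h (x : ℝ) : Complex.exp ((x + 2 * Real.pi : ℝ) * Complex.I) =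
      Complex.exp (x * Complex.I) := by
    have := Complex.exp_periodic (x * Complex.I)
    rw [← this]; push_cast; ring_nf
  have h' (x : ℝ) : Complex.exp ((x - 2 * Real.pi : ℝ) * Complex.I) =
      Complex.exp (x * Complex.I) := by
    rw [← h, sub_add_cancel]
  simp only [spherePt, ← add_assoc, ← sub_sub, h, h']

lemma spherePt_zero (a c s : ℝ) : spherePt (a + s) 0 (c - s) = spherePt a 0 c := by
  simp [spherePt]

lemma spherePt_pi_div_two (a c s : ℝ) :
    spherePt (a + s) (Real.pi / 2) (c + s) = spherePt a (Real.pi / 2) c := by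
  simp [spherePt]

lemma contDiff_spherePt {n : WithTop ℕ∞} :
    ContDiff ℝ n fun x : Fin 4 → ℝ => spherePt (x 1) (x 2) (x 3) := by
  have h (i : Fin 4) : ContDiff ℝ n fun x : Fin 4 → ℝ => x i := contDiff_apply ℝ ℝ i
  have hc {f : (Fin 4 → ℝ) → ℝ} (hf : ContDiff ℝ n f) : ContDiff ℝ n fun x => (f x : ℂ) :=
    Complex.ofRealCLM.contDiff.comp hf
  exact ((hc (h 2).cos).mul ((hc ((h 1).add (h 3))).mul contDiff_const).cexp).prodMk
    ((hc (h 2).sin).mul ((hc ((h 1).sub (h 3))).mul contDiff_const).cexp)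

end SphereMap

section SuMap

open NormedSpace (exp)

variable {𝔸 : Type*} [NormedRing 𝔸] [NormedAlgebra ℝ 𝔸] [CompleteSpace 𝔸]

/-- The map from the three-sphere to an algebra determined by two generators of `𝔰𝔲(2)`, in
toroidal coordinates. -/
noncomputable def suMap (I J : 𝔸) (a b c : ℝ) : 𝔸 := exp (a • I) * exp (b • J) * exp (c • I)

lemma isUnit_suMap (I J : 𝔸) (a b c : ℝ) : IsUnit (suMap I J a b c) :=
  ((isUnit_exp_smul I a).mul (isUnit_exp_smul J b)).mul (isUnit_exp_smul I c)

lemma contDiff_suMap (I J : 𝔸) {n : WithTop ℕ∞} :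
    ContDiff ℝ n fun x : Fin 4 → ℝ => suMap I J (x 1) (x 2) (x 3) := by
  have h (i : Fin 4) : ContDiff ℝ n fun x : Fin 4 → ℝ => x i := contDiff_apply ℝ ℝ i
  exact (((contDiff_exp_smul I).comp (h 1)).mul ((contDiff_exp_smul J).comp (h 2))).mul
    ((contDiff_exp_smul I).comp (h 3))

lemma suMap_zero (I J : 𝔸) (a c s : ℝ) : suMap I J (a + s) 0 (c - s) = suMap I J a 0 c := by
  simp only [suMap, zero_smul, NormedSpace.exp_zero, mul_one, ← exp_add_smul]
  congr 2; ring

namespace IsSuTriple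

variable {I J K : 𝔸} (h : IsSuTriple I J K)
include h

lemma K_mul_exp_I (a : ℝ) :
    K * exp (a • I) = exp (a • I) * (Real.cos (2 * a) • K + Real.sin (2 * a) • J) := by
  refine exp_smul_rotation h.hKI ?_ a
  rw [neg_smul, ← h.hIJ, neg_sub]

lemma suMap_pi_div_two (a c s : ℝ) :
    suMap I J (a + s) (Real.pi / 2) (c + s) = suMap I J a (Real.pi / 2) c := by
  simp only [suMap, h.exp_flip, mul_assoc, ← exp_add_smul]
  congr 3; ring

lemma suMap_add_fst (a b c : ℝ) : suMap I J (a + 2 * Real.pi) b c = suMap I J a b c := by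
  simp only [suMap, exp_add_smul, h.exp_two_pi, mul_one]

lemma suMap_add_trd (a b c : ℝ) : suMap I J a b (c + 2 * Real.pi) = suMap I J a b c := by
  simp only [suMap, exp_add_smul, h.exp_two_pi, mul_one]

lemma hasDerivAt_suMap_fst (a b c : ℝ) :
    HasDerivAt (fun s => suMap I J (a + s) b c) (suMap I J a b c *
      (Real.cos (2 * b) • I + Real.sin (2 * b) •
        (Real.cos (2 * c) • K + Real.sin (2 * c) • J))) 0 := by
  have h1 := ((hasDerivAt_exp_smul_const I (a + 0)).comp_const_add a 0).mul_const
    (exp (b • J)) |>.mul_const (exp (c • I))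
  refine h1.congr_deriv ?_
  rw [add_zero, mul_assoc _ I, h.I_mul_exp_J, ← mul_assoc, mul_assoc, suMap, mul_assoc _ (exp (c • I))]
  congr 1
  rw [add_mul, smul_mul_assoc, smul_mul_assoc, h.K_mul_exp_I, (commute_exp_smul I c).eq]
  simp only [mul_add, mul_smul_comm]

lemma hasDerivAt_suMap_snd (a b c : ℝ) :
    HasDerivAt (fun s => suMap I J a (b + s) c) (suMap I J a b c *
      (Real.cos (2 * c) • J - Real.sin (2 * c) • K)) 0 := by
  have h1 := ((hasDerivAt_exp_smul_const J (b + 0)).comp_const_add b 0).const_mul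
    (exp (a • I)) |>.mul_const (exp (c • I))
  refine h1.congr_deriv ?_
  rw [add_zero, ← mul_assoc, mul_assoc, h.J_mul_exp_I, suMap, mul_assoc _ (exp (c • I))]

omit h in
lemma hasDerivAt_suMap_trd (I J : 𝔸) (a b c : ℝ) :
    HasDerivAt (fun s => suMap I J a b (c + s)) (suMap I J a b c * I) 0 := by
  have h1 := ((hasDerivAt_exp_smul_const I (c + 0)).comp_const_add c 0).const_mul
    (exp (a • I) * exp (b • J))
  refine h1.congr_deriv ?_
  rw [add_zero, suMap, ← mul_assoc]

variable {τ : 𝔸 →L[ℝ] ℝ} (hτ : ∀ x y, τ (x * y) = τ (y * x))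
include hτ

lemma trace_mul_eq (p q r s : ℝ) :
    τ ((p • I + q • (r • K + s • J)) * ((r • J - s • K) * I - I * (r • J - s • K))) =
      -2 * q * (r ^ 2 + s ^ 2) * τ (K * K) := by
  have e1 : (r • J - s • K) * I - I * (r • J - s • K) = (-2 : ℝ) • (r • K + s • J) := by
    have : (r • J - s • K) * I - I * (r • J - s • K) =
        -(r • (I * J - J * I)) - s • (K * I - I * K) := by
      simp only [sub_mul, mul_sub, smul_mul_assoc, mul_smul_comm, smul_sub]
      abel
    rw [this, h.hIJ, h.hKI]
    module
  have hIK : τ (I * K) = 0 := by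
    have : τ ((2 : ℝ) • I * K) = 0 := by
      rw [← h.hJK, sub_mul, map_sub, hτ, ← mul_assoc, sub_self]
    simpa [smul_mul_assoc] using this
  have hIJ : τ (I * J) = 0 := by
    have : τ ((2 : ℝ) • I * J) = 0 := by
      rw [← h.hJK, sub_mul, map_sub, mul_assoc, hτ J]
      simp [mul_assoc]
    simpa [smul_mul_assoc] using this
  have hJK : τ (J * K) = 0 := by
    have : τ ((2 : ℝ) • J * K) = 0 := by
      rw [← h.hKI, sub_mul, map_sub, mul_assoc, hτ K]
      simp [mul_assoc]
    simpa [smul_mul_assoc] using this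
  have hJJ : τ (J * J) = τ (K * K) := by
    have : τ ((2 : ℝ) • J * J) = τ (K * (2 : ℝ) • K) := by
      rw [← h.hIJ]
      nth_rw 1 [← h.hKI]
      rw [sub_mul, map_sub, mul_sub, map_sub, mul_assoc, mul_assoc, hτ I, mul_assoc]
    simpa [smul_mul_assoc, mul_smul_comm] using this
  rw [e1]
  simp only [mul_smul_comm, smul_mul_assoc, add_mul, mul_add, map_add, map_smul, smul_add,
    smul_eq_mul, hIK, hIJ, hJK, hJJ, hτ K J]
  ring

end IsSuTriple

end SuMap

section Obstruction

open NormedSpace (exp)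

variable {𝔸 : Type*} [NormedRing 𝔸] [NormedAlgebra ℝ 𝔸] [CompleteSpace 𝔸]

lemma cartanForm_suMap {I J K : 𝔸} (h : IsSuTriple I J K) {τ : 𝔸 →L[ℝ] ℝ}
    (hτ : ∀ x y, τ (x * y) = τ (y * x)) {e : Fin 4 → Fin 4 → ℝ} (he : ∀ i, e i = Pi.single i 1)
    {H : (Fin 4 → ℝ) → 𝔸} (hH : Differentiable ℝ H)
    (h1 : ∀ x, x 0 = 1 → H x = suMap I J (x 1) (x 2) (x 3)) {x : Fin 4 → ℝ} (hx : x 0 = 1) :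
    cartanForm τ H (e 1) (e 2) (e 3) x = -2 * Real.sin (2 * x 2) * τ (K * K) := by
  have key {i : Fin 4} (hi : i ≠ 0) {A : 𝔸}
      (hd : HasDerivAt (fun s : ℝ => suMap I J ((x + s • e i) 1) ((x + s • e i) 2)
        ((x + s • e i) 3)) (suMap I J (x 1) (x 2) (x 3) * A) 0) : logFDeriv H (e i) x = A := by
    rw [logFDeriv_eq_of_hasDerivAt (hH x) (d := suMap I J (x 1) (x 2) (x 3) * A), h1 x hx,
      ← mul_assoc, Ring.inverse_mul_cancel _ (isUnit_suMap _ _ _ _ _), one_mul]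
    have : (fun s : ℝ => H (x + s • e i)) = fun s : ℝ => suMap I J ((x + s • e i) 1)
        ((x + s • e i) 2) ((x + s • e i) 3) := by
      funext s
      refine h1 _ ?_
      simp [he, hx, hi.symm]
    rw [this]
    exact hd
  have l1 := key (i := 1) (by decide) (by
    simpa [he, -smul_add] using h.hasDerivAt_suMap_fst (x 1) (x 2) (x 3))
  have l2 := key (i := 2) (by decide) (by simpa [he] using h.hasDerivAt_suMap_snd (x 1) (x 2) (x 3))
  have l3 := key (i := 3) (by decide)
    (by simpa [he] using IsSuTriple.hasDerivAt_suMap_trd I J (x 1) (x 2) (x 3))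
  rw [cartanForm, l1, l2, l3, h.trace_mul_eq hτ, Real.cos_sq_add_sin_sq, mul_one]

lemma integral_sin_sphereBox_pos :
    0 < ∫ y in Set.Icc ((0 : Fin 4 → ℝ) ∘ (0 : Fin 4).succAbove)
      (sphereBox ∘ (0 : Fin 4).succAbove), Real.sin (2 * y 1) := by
  have hcont : Continuous fun y : Fin 3 → ℝ => Real.sin (2 * y 1) := by fun_prop
  have hb : ∀ y ∈ Set.Icc ((0 : Fin 4 → ℝ) ∘ (0 : Fin 4).succAbove)
      (sphereBox ∘ (0 : Fin 4).succAbove), 0 ≤ y 1 ∧ y 1 ≤ Real.pi / 2 := fun y hy =>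
    ⟨by simpa using hy.1 1, by simpa [sphereBox] using hy.2 1⟩
  rw [MeasureTheory.setIntegral_pos_iff_support_of_nonneg_ae]
  · have hU : IsOpen (Set.univ.pi fun i : Fin 3 => Set.Ioo (0 : ℝ) (sphereBox (i.succ))) :=
      isOpen_set_pi Set.finite_univ fun i _ => isOpen_Ioo
    have hpos (i : Fin 3) : 0 < sphereBox i.succ := by
      fin_cases i <;> simp [sphereBox, Real.pi_pos]
    refine (hU.measure_pos MeasureTheory.volume ⟨fun i => sphereBox i.succ / 2, fun i _ =>
      ⟨half_pos (hpos i), half_lt_self (hpos i)⟩⟩).trans_le (MeasureTheory.measure_mono ?_)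
    intro y hy
    refine ⟨?_, fun i => by simpa using (hy i trivial).1.le,
      fun i => by simpa using (hy i trivial).2.le⟩
    have h1 : y 1 ∈ Set.Ioo 0 (sphereBox (Fin.succ 1)) := hy 1 trivial
    have h2 : sphereBox (Fin.succ 1) = Real.pi / 2 := by simp [sphereBox]
    rw [h2] at h1
    exact (Real.sin_pos_of_pos_of_lt_pi (by linarith [h1.1]) (by linarith [h1.2])).ne'
  · refine (MeasureTheory.ae_restrict_iff' measurableSet_Icc).2 (.of_forall fun y hy => ?_)
    obtain ⟨h1, h2⟩ := hb y hy
    exact Real.sin_nonneg_of_nonneg_of_le_pi (by linarith) (by linarith)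
  · exact hcont.continuousOn.integrableOn_compact isCompact_Icc

/-- The map from the three-sphere determined by an `𝔰𝔲(2)` triple does not extend to a map from
the ball to the group of units. -/
theorem IsSuTriple.false_of_extension [FiniteDimensional ℝ 𝔸] {I J K : 𝔸} (h : IsSuTriple I J K)
    {τ : 𝔸 →L[ℝ] ℝ} (hτ : ∀ x y, τ (x * y) = τ (y * x)) (hK : τ (K * K) ≠ 0)
    (Φ : C(ComplexBall, 𝔸)) (hΦ : ∀ w, IsUnit (Φ w))
    (hf : ∀ a b c, b ∈ Set.Icc 0 (Real.pi / 2) → ∀ w : ComplexBall, w.1 = spherePt a b c →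
      Φ w = suMap I J a b c) : False := by
  have hcl : IsClosedEmbedding (Subtype.val : ComplexBall → ℂ × ℂ) :=
    continuous_subtype_val.isClosedEmbedding Subtype.val_injective
  obtain ⟨Ψ, hΨ⟩ := ContinuousMap.exists_extension' hcl Φ
  have hΨ (w : ComplexBall) : Ψ w.1 = Φ w := congrFun hΨ w
  obtain ⟨δ, hδ, hδU⟩ := (isCompact_range Φ.continuous).exists_thickening_subset_open
    (Units.isOpen (R := 𝔸)) (by rintro _ ⟨w, rfl⟩; exact hΦ w)
  obtain ⟨F, hF, hFΨ, -⟩ := Ψ.continuous.exists_contDiff_approx 2 (ε := fun _ => δ / 2)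
    continuous_const (fun _ => half_pos hδ)
  let u : (Fin 4 → ℝ) → ℂ × ℂ := fun x => spherePt (x 1) (x 2) (x 3)
  let f : (Fin 4 → ℝ) → 𝔸 := fun x => suMap I J (x 1) (x 2) (x 3)
  let H : (Fin 4 → ℝ) → 𝔸 := fun x => F (x 0 • u x) + x 0 • (f x - F (u x))
  have h0 : ContDiff ℝ 2 fun x : Fin 4 → ℝ => x 0 := contDiff_apply ℝ ℝ 0
  have hH : ContDiff ℝ 2 H := (hF.comp (h0.smul contDiff_spherePt)).add
    (h0.smul ((contDiff_suMap I J).sub (hF.comp contDiff_spherePt)))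
  have hHd : Differentiable ℝ H := hH.differentiable (by norm_num)
  have hunit : ∀ x ∈ Set.Icc (0 : Fin 4 → ℝ) sphereBox, IsUnit (H x) := by
    intro x hx
    have ht0 : 0 ≤ x 0 := hx.1 0
    have ht1 : x 0 ≤ 1 := by simpa [sphereBox] using hx.2 0
    have hu := norm_sq_spherePt (x 1) (x 2) (x 3)
    have hw1 : ‖(x 0 • u x).1‖ ^ 2 + ‖(x 0 • u x).2‖ ^ 2 ≤ 1 := by
      rw [Prod.smul_fst, Prod.smul_snd, norm_smul, norm_smul, mul_pow, mul_pow, ← mul_add, hu,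
        mul_one, Real.norm_eq_abs, sq_abs]
      nlinarith
    refine hδU (Metric.mem_thickening_iff.2 ⟨Φ ⟨_, hw1⟩, ⟨_, rfl⟩, ?_⟩)
    have e1 := hFΨ (x 0 • u x)
    have e2 := hFΨ (u x)
    have hfx : Ψ (u x) = f x := by
      have := hf (x 1) (x 2) (x 3) ⟨hx.1 2, by simpa [sphereBox] using hx.2 2⟩ ⟨u x, hu.le⟩ rfl
      exact (hΨ ⟨u x, hu.le⟩).trans this
    rw [hΨ ⟨_, hw1⟩] at e1
    rw [hfx] at e2
    rw [dist_eq_norm] at e1 e2 ⊢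
    rw [← norm_neg, neg_sub] at e2
    calc ‖H x - Φ ⟨x 0 • u x, hw1⟩‖
        = ‖(F (x 0 • u x) - Φ ⟨x 0 • u x, hw1⟩) + x 0 • (f x - F (u x))‖ := by
          congr 1; simp only [H]; abel
      _ ≤ ‖F (x 0 • u x) - Φ ⟨x 0 • u x, hw1⟩‖ + ‖x 0 • (f x - F (u x))‖ := norm_add_le _ _
      _ ≤ ‖F (x 0 • u x) - Φ ⟨x 0 • u x, hw1⟩‖ + ‖f x - F (u x)‖ := by
          gcongr
          rw [norm_smul, Real.norm_eq_abs, abs_of_nonneg ht0]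
          exact mul_le_of_le_one_left (norm_nonneg _) ht1
      _ < δ := by linarith
  have hHeq {x y : Fin 4 → ℝ} (e0 : x 0 = y 0) (eu : u x = u y) (ef : f x = f y) : H x = H y := by
    simp only [H, e0, eu, ef]
  obtain ⟨e, he⟩ : ∃ e : Fin 4 → Fin 4 → ℝ, ∀ i, e i = Pi.single i 1 := ⟨_, fun _ => rfl⟩
  have key := integral_cartanForm_eq τ hτ e he hH hunit
    (fun x => hHeq (by simp [he]) (by simpa [u, he] using spherePt_add_fst _ _ _)
      (by simpa [f, he] using h.suMap_add_fst _ _ _))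
    (fun x => hHeq (by simp [he]) (by simpa [u, he] using spherePt_add_trd _ _ _)
      (by simpa [f, he] using h.suMap_add_trd _ _ _))
    (fun x hx s => hHeq (by simp [he])
      (by simpa [u, he, hx, ← sub_eq_add_neg] using spherePt_zero _ _ _)
      (by simpa [f, he, hx, ← sub_eq_add_neg] using suMap_zero I J _ _ _))
    (fun x hx s => hHeq (by simp [he]) (by simpa [u, he, hx] using spherePt_pi_div_two _ _ _)
      (by simpa [f, he, hx] using h.suMap_pi_div_two _ _ _))
  have hz : ∀ x : Fin 4 → ℝ, x 0 = 0 → cartanForm τ H (e 1) (e 2) (e 3) x = 0 := by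
    intro x hx
    have : logFDeriv H (e 1) x = 0 :=
      logFDeriv_eq_zero_of_forall_eq (hHd x) fun s => by simp [H, he, hx]
    rw [cartanForm, this, zero_mul, map_zero]
  have h1 : ∀ x, x 0 = 1 → H x = suMap I J (x 1) (x 2) (x 3) := by
    intro x hx
    simp [H, f, hx]
  simp only [fun y => hz ((0 : Fin 4).insertNth (α := fun _ => ℝ) 0 y) (by simp),
    fun y => cartanForm_suMap h hτ he hHd h1 (x := (0 : Fin 4).insertNth (α := fun _ => ℝ) 1 y)
      (by simp), MeasureTheory.integral_zero, MeasureTheory.integral_mul_const,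
    MeasureTheory.integral_const_mul] at key
  have hpos := integral_sin_sphereBox_pos
  have h3 (y : Fin 3 → ℝ) : (0 : Fin 4).insertNth (α := fun _ => ℝ) 1 y 2 = y 1 :=
    Fin.insertNth_apply_succAbove (α := fun _ => ℝ) 0 1 y 1
  simp only [h3] at key
  exact mul_ne_zero (mul_ne_zero (by norm_num) hpos.ne') hK key

end Obstruction

section InnerOperator

open scoped InnerProductSpace BoundedContinuousFunction

variable {X E : Type*} [TopologicalSpace X] [CompactSpace X] [NormedAddCommGroup E]
  [InnerProductSpace ℂ E]

/-- The operator sending a vector `f` to the function `x ↦ ⟪k x, f⟫`. -/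
noncomputable def innerOperator (k : C(X, E)) : E →L[ℂ] (X →ᵇ ℂ) :=
  LinearMap.mkContinuous
    { toFun := fun f => BoundedContinuousFunction.mkOfCompact
        ⟨fun x => ⟪k x, f⟫_ℂ, by fun_prop⟩
      map_add' := fun f g => by ext x; exact inner_add_right _ _ _
      map_smul' := fun c f => by ext x; exact inner_smul_right _ _ _ } ‖k‖ fun f => by
    refine (BoundedContinuousFunction.norm_le (by positivity)).2 fun x => ?_
    refine (norm_inner_le_norm _ _).trans ?_
    gcongr
    exact k.norm_coe_le_norm x

@[simp]
lemma innerOperator_apply (k : C(X, E)) (f : E) (x : X) : innerOperator k f x = ⟪k x, f⟫_ℂ := rfl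

lemma isCompactOperator_innerOperator (k : C(X, E)) : IsCompactOperator (innerOperator k) := by
  have key := (isCompactOperator_iff_isCompact_closure_image_closedBall
    (innerOperator k : E →ₗ[ℂ] (X →ᵇ ℂ)) zero_lt_one).2 (by
      refine BoundedContinuousFunction.arzela_ascoli (Metric.closedBall 0 ‖k‖)
        (isCompact_closedBall _ _) _ ?_ ?_
      · rintro _ x ⟨f, hf, rfl⟩
        rw [mem_closedBall_zero_iff] at hf ⊢
        refine (norm_inner_le_norm _ _).trans ?_
        exact (mul_le_of_le_one_right (norm_nonneg _) hf).trans (k.norm_coe_le_norm x)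
      · intro x
        rw [Metric.equicontinuousAt_iff_right]
        intro ε hε
        filter_upwards [(Metric.continuousAt_iff'.1 k.continuous.continuousAt) ε hε] with y hy
        rintro ⟨_, f, hf, rfl⟩
        rw [mem_closedBall_zero_iff] at hf
        change dist ⟪k x, f⟫_ℂ ⟪k y, f⟫_ℂ < ε
        rw [dist_comm, dist_eq_norm, ← inner_sub_left]
        refine (norm_inner_le_norm _ _).trans_lt ?_
        rw [dist_eq_norm] at hy
        exact (mul_le_of_le_one_right (norm_nonneg _) hf).trans_lt hy)
  exact key

end InnerOperator

section Translation

open MeasureTheory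
open scoped InnerProductSpace BoundedContinuousFunction

variable {N : Type*} [Group N] [TopologicalSpace N] [IsTopologicalGroup N] [CompactSpace N]
  [T2Space N] [MeasurableSpace N] [BorelSpace N] (μ : Measure N) [μ.IsHaarMeasure] [μ.Regular]

/-- Left translation on the `L²` space of a compact group. -/
noncomputable def translateL2 (g : N) : Lp ℂ 2 μ →ₗᵢ[ℂ] Lp ℂ 2 μ where
  toFun f := DomMulAct.mk g⁻¹ • f
  map_add' := smul_add _
  map_smul' c f := smul_comm _ c f
  norm_map' f := DomMulAct.norm_smul_Lp _ f

lemma translateL2_mul (g h : N) (f : Lp ℂ 2 μ) :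
    translateL2 μ (g * h) f = translateL2 μ g (translateL2 μ h f) := by
  change DomMulAct.mk (g * h)⁻¹ • f = DomMulAct.mk g⁻¹ • DomMulAct.mk h⁻¹ • f
  rw [smul_smul, ← DomMulAct.mk_mul, mul_inv_rev]

lemma translateL2_one (f : Lp ℂ 2 μ) : translateL2 μ 1 f = f := by
  change DomMulAct.mk (1 : N)⁻¹ • f = f
  rw [inv_one, DomMulAct.mk_one, one_smul]

lemma continuous_translateL2 (f : Lp ℂ 2 μ) : Continuous fun g : N => translateL2 μ g f := by
  have : Fact ((2 : ENNReal) ≠ ⊤) := ⟨by norm_num⟩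
  change Continuous fun g : N => DomMulAct.mk g⁻¹ • f
  exact (DomMulAct.continuous_mk.comp continuous_inv).smul continuous_const

lemma inner_translateL2_left (g : N) (f h : Lp ℂ 2 μ) :
    ⟪translateL2 μ g f, h⟫_ℂ = ⟪f, translateL2 μ g⁻¹ h⟫_ℂ := by
  rw [← (translateL2 μ g⁻¹).inner_map_map, ← translateL2_mul, inv_mul_cancel, translateL2_one]

/-- The class in `L²` of a continuous function. -/
noncomputable abbrev contToL2 : (N →ᵇ ℂ) →L[ℂ] Lp ℂ 2 μ := BoundedContinuousFunction.toLp 2 μ ℂ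

lemma translateL2_contToL2 (g : N) {f h : N →ᵇ ℂ} (hf : ∀ x, h x = f (g⁻¹ * x)) :
    translateL2 μ g (contToL2 μ f) = contToL2 μ h := by
  apply Lp.ext
  change (DomMulAct.mk g⁻¹ • (contToL2 μ f) : Lp ℂ 2 μ) =ᵐ[μ] _
  refine (DomMulAct.smul_Lp_ae_eq _ _).trans ?_
  refine Filter.EventuallyEq.trans ?_ (BoundedContinuousFunction.coeFn_toLp 2 μ ℂ h).symm
  have h1 := BoundedContinuousFunction.coeFn_toLp 2 μ ℂ f
  have h2 := (measurePreserving_smul g⁻¹ μ).quasiMeasurePreserving.ae_eq_comp h1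
  refine h2.trans (.of_forall fun x => ?_)
  simp [hf]

/-- The convolution operator on `L²`. -/
noncomputable def convOperator (k : Lp ℂ 2 μ) : Lp ℂ 2 μ →L[ℂ] Lp ℂ 2 μ :=
  (contToL2 μ).comp (innerOperator ⟨fun g : N => translateL2 μ g k, continuous_translateL2 μ k⟩)

lemma isCompactOperator_convOperator (k : Lp ℂ 2 μ) : IsCompactOperator (convOperator μ k) :=
  (isCompactOperator_innerOperator _).clm_comp (contToL2 μ)

lemma convOperator_translateL2 (k f : Lp ℂ 2 μ) (g : N) :
    convOperator μ k (translateL2 μ g f) = translateL2 μ g (convOperator μ k f) := by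
  refine (translateL2_contToL2 μ g fun x => ?_).symm
  change ⟪translateL2 μ x k, translateL2 μ g f⟫_ℂ = ⟪translateL2 μ (g⁻¹ * x) k, f⟫_ℂ
  rw [translateL2_mul, inner_translateL2_left μ g⁻¹, inv_inv]

lemma isSymmetric_convOperator {φ : N →ᵇ ℂ} (hφ : ∀ x, φ x⁻¹ = φ x)
    (hφ' : ∀ x, starRingEnd ℂ (φ x) = φ x) :
    (convOperator μ (contToL2 μ φ) : Lp ℂ 2 μ →ₗ[ℂ] Lp ℂ 2 μ).IsSymmetric := by
  have hcs {f : N × N → ℂ} : HasCompactSupport f := HasCompactSupport.of_compactSpace f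
  have htr (x : N) : translateL2 μ x (contToL2 μ φ) = contToL2 μ
      (BoundedContinuousFunction.mkOfCompact ⟨fun y => φ (x⁻¹ * y), by fun_prop⟩) :=
    translateL2_contToL2 μ x fun y => rfl
  have hS (f : N →ᵇ ℂ) (x : N) : innerOperator ⟨fun g : N => translateL2 μ g (contToL2 μ φ),
      continuous_translateL2 μ _⟩ (contToL2 μ f) x = ∫ y, f y * φ (x⁻¹ * y) ∂μ := by
    change ⟪translateL2 μ x (contToL2 μ φ), contToL2 μ f⟫_ℂ = _
    rw [htr, BoundedContinuousFunction.inner_toLp]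
    simp [hφ']
  have hd : DenseRange (contToL2 μ) :=
    BoundedContinuousFunction.toLp_denseRange ℂ μ ℂ (by norm_num)
  intro f h
  refine hd.induction_on₂ (p := fun f h => ⟪convOperator μ (contToL2 μ φ) f, h⟫_ℂ =
    ⟪f, convOperator μ (contToL2 μ φ) h⟫_ℂ) ?_ ?_ f h
  · exact isClosed_eq (by fun_prop) (by fun_prop)
  · intro f h
    simp only [convOperator, ContinuousLinearMap.comp_apply]
    rw [BoundedContinuousFunction.inner_toLp, BoundedContinuousFunction.inner_toLp]
    simp only [hS, ← integral_conj, ← integral_const_mul, ← integral_mul_const, map_mul, hφ']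
    rw [integral_integral_swap_of_hasCompactSupport (by fun_prop) hcs]
    congr 1; ext x; congr 1; ext y
    rw [← hφ (x⁻¹ * y)]
    simp only [mul_inv_rev, inv_inv]
    ring

end Translation

section PeterWeyl

open MeasureTheory Module.End
open scoped InnerProductSpace BoundedContinuousFunction

/-- A continuous finite-dimensional unitary matrix representation. -/
structure UnitaryRep (N : Type*) [Group N] [TopologicalSpace N] where
  dim : ℕ
  toHom : N →* Matrix (Fin dim) (Fin dim) ℂ
  continuous : Continuous toHom
  star_mul : ∀ g, star (toHom g) * toHom g = 1

variable {N : Type*} [Group N] [TopologicalSpace N] [IsTopologicalGroup N] [CompactSpace N]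
  [T2Space N] [MeasurableSpace N] [BorelSpace N] (μ : Measure N) [μ.IsHaarMeasure] [μ.Regular]

/-- The matrix representation on a finite-dimensional invariant subspace of `L²`. -/
noncomputable def UnitaryRep.ofInvariant (W : Submodule ℂ (Lp ℂ 2 μ)) [FiniteDimensional ℂ W]
    (hW : ∀ g, ∀ f ∈ W, translateL2 μ g f ∈ W) : UnitaryRep N where
  dim := Module.finrank ℂ W
  toHom :=
    { toFun := fun g => Matrix.of fun i j =>
        ⟪(stdOrthonormalBasis ℂ W i : Lp ℂ 2 μ), translateL2 μ g (stdOrthonormalBasis ℂ W j)⟫_ℂ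
      map_one' := by
        ext i j
        simp only [translateL2_one, Matrix.of_apply, ← Submodule.coe_inner, Matrix.one_apply]
        exact (orthonormal_iff_ite.1 (stdOrthonormalBasis ℂ W).orthonormal i j)
      map_mul' := fun g h => by
        ext i j
        have := (stdOrthonormalBasis ℂ W).sum_repr ⟨_, hW h _ (stdOrthonormalBasis ℂ W j).2⟩
        have h2 := congrArg Subtype.val this
        simp only [AddSubmonoidClass.coe_finsetSum, Submodule.coe_smul,
          OrthonormalBasis.repr_apply_apply, Submodule.coe_inner] at h2
        simp only [Matrix.of_apply, Matrix.mul_apply, translateL2_mul]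
        conv_lhs => rw [← h2]
        simp only [map_sum, map_smul, inner_sum, inner_smul_right]
        exact Finset.sum_congr rfl fun k _ => mul_comm _ _ }
  continuous := by
    refine continuous_matrix fun i j => ?_
    have := continuous_translateL2 μ ((stdOrthonormalBasis ℂ W j : W) : Lp ℂ 2 μ)
    exact continuous_const.inner this
  star_mul g := by
    ext i j
    have := (stdOrthonormalBasis ℂ W).sum_inner_mul_inner
      ⟨_, hW g _ (stdOrthonormalBasis ℂ W i).2⟩ ⟨_, hW g _ (stdOrthonormalBasis ℂ W j).2⟩
    simp only [Submodule.coe_inner, LinearIsometry.inner_map_map] at this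
    simp only [MonoidHom.coe_mk, OneHom.coe_mk, Matrix.mul_apply, Matrix.star_apply,
      Matrix.of_apply, RCLike.star_def, inner_conj_symm, this, Matrix.one_apply]
    simp only [← Submodule.coe_inner]
    exact (orthonormal_iff_ite.1 (stdOrthonormalBasis ℂ W).orthonormal i j)

lemma UnitaryRep.ofInvariant_eq_one {W : Submodule ℂ (Lp ℂ 2 μ)} [FiniteDimensional ℂ W]
    {hW : ∀ g, ∀ f ∈ W, translateL2 μ g f ∈ W} {g : N}
    (hg : (UnitaryRep.ofInvariant μ W hW).toHom g = 1) {f : Lp ℂ 2 μ} (hf : f ∈ W) :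
    translateL2 μ g f = f := by
  let b := stdOrthonormalBasis ℂ W
  have hb (j) : translateL2 μ g (b j : Lp ℂ 2 μ) = b j := by
    have h1 := congrArg Subtype.val (b.sum_repr ⟨_, hW g _ (b j).2⟩)
    have h2 (i) : ⟪(b i : Lp ℂ 2 μ), translateL2 μ g (b j)⟫_ℂ = (1 : Matrix _ _ ℂ) i j :=
      congrFun (congrFun hg i) j
    simpa only [AddSubmonoidClass.coe_finsetSum, Submodule.coe_smul,
          OrthonormalBasis.repr_apply_apply, Submodule.coe_inner, h2, Matrix.one_apply, ite_smul,
          one_smul, zero_smul, Finset.sum_ite_eq', Finset.mem_univ, if_true] using h1.symm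
  have h1 := congrArg Subtype.val (b.sum_repr ⟨f, hf⟩)
  simp only [AddSubmonoidClass.coe_finsetSum, Submodule.coe_smul] at h1
  rw [← h1]
  simp only [map_sum, map_smul, hb]

/-- **Peter–Weyl theorem**: the finite-dimensional unitary representations of a compact group
separate points. -/
theorem UnitaryRep.exists_ne_one {N : Type*} [Group N] [TopologicalSpace N]
    [IsTopologicalGroup N] [CompactSpace N] [T2Space N] {x : N} (hx : x ≠ 1) :
    ∃ ρ : UnitaryRep N, ρ.toHom x ≠ 1 := by
  let _ : MeasurableSpace N := borel N
  have _ : BorelSpace N := ⟨rfl⟩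
  let μ : Measure N := Measure.haar
  obtain ⟨ψ, hψx, hψ1, -⟩ := exists_continuous_zero_one_of_isClosed (isClosed_singleton (x := x))
    (isClosed_singleton (x := (1 : N))) (by simpa using hx)
  replace hψx : ψ x = 0 := hψx rfl
  replace hψ1 : ψ 1 = 1 := hψ1 rfl
  let φ : N →ᵇ ℂ := BoundedContinuousFunction.mkOfCompact
    ⟨fun g => ((ψ g * ψ g⁻¹ : ℝ) : ℂ), by fun_prop⟩
  have hφ (g) : φ g = ((ψ g * ψ g⁻¹ : ℝ) : ℂ) := rfl
  have hsymm := isSymmetric_convOperator μ (φ := φ) (fun g => by rw [hφ, hφ, inv_inv, mul_comm])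
    (fun g => Complex.conj_ofReal _)
  set k := contToL2 μ φ with hk
  have hcomp := isCompactOperator_convOperator μ k
  by_contra! hall
  have hT : (convOperator μ k).comp (translateL2 μ x).toContinuousLinearMap = convOperator μ k := by
    have htop := ContinuousLinearMap.orthogonalComplement_iSup_eigenspaces_eq_bot hcomp hsymm
    rw [← Submodule.topologicalClosure_eq_top_iff] at htop
    refine ContinuousLinearMap.ext_on (s := ((⨆ c, eigenspace (convOperator μ k :
      Module.End ℂ (Lp ℂ 2 μ)) c : Submodule ℂ (Lp ℂ 2 μ)) : Set (Lp ℂ 2 μ))) ?_ ?_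
    · rw [Submodule.span_eq]
      exact Submodule.dense_iff_topologicalClosure_eq_top.2 htop
    · intro f hf
      induction hf using Submodule.iSup_induction' with
      | mem c f hf =>
        by_cases hc : c = 0
        · rw [mem_eigenspace_iff] at hf
          have hf' : convOperator μ k f = 0 := by simpa [hc] using hf
          change convOperator μ k (translateL2 μ x f) = convOperator μ k f
          rw [convOperator_translateL2, hf', map_zero]
        · have := ContinuousLinearMap.finite_dimensional_eigenspace hcomp c hc
          have hW : ∀ g, ∀ f ∈ eigenspace (convOperator μ k : Module.End ℂ (Lp ℂ 2 μ)) c,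
              translateL2 μ g f ∈ eigenspace (convOperator μ k : Module.End ℂ (Lp ℂ 2 μ)) c := by
            intro g f hf
            rw [mem_eigenspace_iff] at hf ⊢
            change convOperator μ k f = c • f at hf
            change convOperator μ k (translateL2 μ g f) = c • translateL2 μ g f
            rw [convOperator_translateL2, hf, map_smul]
          change convOperator μ k (translateL2 μ x f) = convOperator μ k f
          rw [UnitaryRep.ofInvariant_eq_one μ (hall (UnitaryRep.ofInvariant μ _ hW)) hf]
      | zero => simp
      | add f g _ _ hf hg => rw [map_add, map_add, hf, hg]
  have h1 (f : Lp ℂ 2 μ) : ⟪k, translateL2 μ x f⟫_ℂ = ⟪k, f⟫_ℂ := by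
    have h2 := BoundedContinuousFunction.toLp_injective (p := 2) μ (𝕜 := ℂ)
      (DFunLike.congr_fun hT f)
    have h3 := DFunLike.congr_fun h2 1
    change ⟪translateL2 μ 1 k, translateL2 μ x f⟫_ℂ = ⟪translateL2 μ 1 k, f⟫_ℂ at h3
    rwa [translateL2_one] at h3
  have h2 : translateL2 μ x⁻¹ k = k := by
    refine ext_inner_right ℂ fun f => ?_
    rw [inner_translateL2_left, inv_inv, h1]
  rw [hk, translateL2_contToL2 μ x⁻¹ (f := φ) (h := BoundedContinuousFunction.mkOfCompact
    ⟨fun y => φ (x⁻¹⁻¹ * y), by fun_prop⟩) fun y => rfl] at h2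
  have h3 := DFunLike.congr_fun (BoundedContinuousFunction.toLp_injective (p := 2) μ (𝕜 := ℂ) h2) 1
  change φ (x⁻¹⁻¹ * 1) = φ 1 at h3
  simp [hφ, hψx, hψ1] at h3

end PeterWeyl

section OneParameter

open Filter NormedSpace

/-- A continuous homomorphism from a topological group into the unit ball of a normed ring. -/
structure BoundedRep (N 𝔸 : Type*) [Group N] [TopologicalSpace N] [NormedRing 𝔸] where
  toHom : N →* 𝔸
  continuous : Continuous toHom
  norm_le : ∀ n, ‖toHom n‖ ≤ 1

variable {𝔸 : Type*} [NormedRing 𝔸] [NormedAlgebra ℝ 𝔸] [CompleteSpace 𝔸]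

lemma norm_pow_sub_pow_le {R : Type*} [NormedRing R] {a b : R} {C : ℝ} {m : ℕ}
    (ha : ∀ j, ‖a ^ j‖ ≤ 1) (hb : ∀ j ≤ m, ‖b ^ j‖ ≤ C) :
    ‖a ^ m - b ^ m‖ ≤ m * (C * ‖a - b‖) := by
  induction m with
  | zero => simp
  | succ m ih =>
    have h1 : a ^ (m + 1) - b ^ (m + 1) = a * (a ^ m - b ^ m) + (a - b) * b ^ m := by
      rw [pow_succ', pow_succ']; noncomm_ring
    have ha1 : ‖a‖ ≤ 1 := by simpa using ha 1
    have h2 := ih fun j hj => hb j (by omega)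
    have h3 : ‖a * (a ^ m - b ^ m)‖ ≤ m * (C * ‖a - b‖) := by
      refine (norm_mul_le _ _).trans ?_
      nlinarith [norm_nonneg (a ^ m - b ^ m)]
    have h4 : ‖(a - b) * b ^ m‖ ≤ C * ‖a - b‖ := by
      refine (norm_mul_le _ _).trans ?_
      rw [mul_comm]
      exact mul_le_mul_of_nonneg_right (hb m (by omega)) (norm_nonneg _)
    rw [h1]
    refine (norm_add_le _ _).trans ?_
    push_cast
    linarith

lemma tendsto_inv_smul_exp_sub_one (X : 𝔸) :
    Tendsto (fun t : ℝ => t⁻¹ • (exp (t • X) - 1)) (𝓝[≠] 0) (𝓝 X) := by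
  have h := (hasDerivAt_exp_smul_const (𝕂 := ℝ) X (0 : ℝ))
  rw [hasDerivAt_iff_tendsto_slope] at h
  simpa [slope_fun_def] using h

lemma exp_nat_smul (m : ℕ) (X : 𝔸) : exp ((m : ℝ) • X) = exp X ^ m := by
  let _ : NormedAlgebra ℚ 𝔸 := NormedAlgebra.restrictScalars ℚ ℝ 𝔸
  rw [Nat.cast_smul_eq_nsmul, exp_nsmul]

lemma continuous_exp_smul (X : 𝔸) : Continuous fun t : ℝ => exp (t • X) :=
  (contDiff_exp_smul (n := 0) X).continuous

variable {N : Type*} [Group N] [TopologicalSpace N]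

namespace BoundedRep

variable (ρ : BoundedRep N 𝔸)

/-- The property of generating a one-parameter subgroup of the image of `ρ`. -/
def IsGenerator (X : 𝔸) : Prop := ∀ t : ℝ, ∃ n, ρ.toHom n = exp (t • X)

variable {ρ}

lemma isClosed_range [CompactSpace N] : IsClosed (Set.range ρ.toHom) :=
  (isCompact_range ρ.continuous).isClosed

lemma toHom_inv_eq_exp {n : N} {t : ℝ} {X : 𝔸} (h : ρ.toHom n = exp (t • X)) :
    ρ.toHom n⁻¹ = exp ((-t) • X) := by
  have h1 : ρ.toHom n⁻¹ * ρ.toHom n = 1 := by rw [← map_mul]; simp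
  calc ρ.toHom n⁻¹ = ρ.toHom n⁻¹ * (exp (t • X) * exp ((-t) • X)) := by
        rw [exp_smul_mul_neg, mul_one]
    _ = _ := by rw [← mul_assoc, ← h, h1, one_mul]

lemma tendsto_sub_exp {n : ℕ → N} {r : ℕ → ℝ} {X : 𝔸} (hr : ∀ k, 0 < r k)
    (hr0 : Tendsto r atTop (𝓝 0))
    (h : Tendsto (fun k => (r k)⁻¹ • (ρ.toHom (n k) - 1)) atTop (𝓝 X)) :
    Tendsto (fun k => (r k)⁻¹ * ‖ρ.toHom (n k) - exp (r k • X)‖) atTop (𝓝 0) := by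
  have h1 : Tendsto r atTop (𝓝[≠] 0) :=
    tendsto_nhdsWithin_iff.2 ⟨hr0, Eventually.of_forall fun k => (hr k).ne'⟩
  have h2 := (h.sub ((tendsto_inv_smul_exp_sub_one X).comp h1)).norm
  rw [sub_self, norm_zero] at h2
  refine h2.congr fun k => ?_
  rw [Function.comp, ← smul_sub, norm_smul, Real.norm_of_nonneg (inv_pos.2 (hr k)).le]
  congr 2
  abel

lemma isGenerator_of_tendsto [CompactSpace N] {n : ℕ → N} {r : ℕ → ℝ} {X : 𝔸}
    (hr : ∀ k, 0 < r k) (hr0 : Tendsto r atTop (𝓝 0))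
    (h : Tendsto (fun k => (r k)⁻¹ • (ρ.toHom (n k) - 1)) atTop (𝓝 X)) : ρ.IsGenerator X := by
  have key (t : ℝ) (ht : 0 ≤ t) : ∃ n, ρ.toHom n = exp (t • X) := by
    let m : ℕ → ℕ := fun k => ⌊t / r k⌋₊
    have hm (k) : m k * r k ≤ t := by
      have := Nat.floor_le (div_nonneg ht (hr k).le)
      rwa [le_div_iff₀ (hr k)] at this
    have hm' (k) : t - r k ≤ m k * r k := by
      have := (Nat.lt_floor_add_one (t / r k)).le
      rw [div_le_iff₀ (hr k)] at this
      linarith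
    have hmr : Tendsto (fun k => m k * r k) atTop (𝓝 t) := by
      refine tendsto_of_tendsto_of_tendsto_of_le_of_le ?_ tendsto_const_nhds hm' hm
      simpa using tendsto_const_nhds.sub hr0
    obtain ⟨C, hC⟩ := (isCompact_Icc (a := 0) (b := t)).exists_bound_of_continuousOn
      (continuous_exp_smul X).continuousOn
    have hexp (k j : ℕ) : exp (r k • X) ^ j = exp ((j * r k) • X) := by
      rw [mul_smul, exp_nat_smul]
    have hbd (k) : ‖ρ.toHom (n k ^ m k) - exp ((m k * r k) • X)‖
        ≤ t * C * ((r k)⁻¹ * ‖ρ.toHom (n k) - exp (r k • X)‖) := by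
      rw [map_pow, ← hexp]
      refine (norm_pow_sub_pow_le (C := C) (fun j => ?_) fun j hj => ?_).trans ?_
      · rw [← map_pow]; exact ρ.norm_le _
      · rw [hexp]
        refine hC _ ⟨by have := (hr k).le; positivity, le_trans ?_ (hm k)⟩
        have : (j : ℝ) ≤ m k := by exact_mod_cast hj
        exact mul_le_mul_of_nonneg_right this (hr k).le
      · have hC0 : 0 ≤ C := (norm_nonneg _).trans (hC 0 ⟨le_rfl, ht⟩)
        have h1 : (m k : ℝ) = m k * r k * (r k)⁻¹ := by
          rw [mul_assoc, mul_inv_cancel₀ (hr k).ne', mul_one]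
        rw [h1]
        have h2 : 0 ≤ C * ((r k)⁻¹ * ‖ρ.toHom (n k) - exp (r k • X)‖) := by
          have := (hr k).le; positivity
        nlinarith [mul_le_mul_of_nonneg_right (hm k) h2]
    have h1 : Tendsto (fun k => ρ.toHom (n k ^ m k) - exp ((m k * r k) • X)) atTop (𝓝 0) :=
      squeeze_zero_norm hbd (by simpa using (tendsto_sub_exp hr hr0 h).const_mul (t * C))
    have h2 := h1.add (((continuous_exp_smul X).tendsto t).comp hmr)
    simp only [Function.comp, sub_add_cancel, zero_add] at h2
    exact isClosed_range.mem_of_tendsto h2 (Eventually.of_forall fun k => ⟨_, rfl⟩)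
  intro t
  obtain ht | ht := le_total 0 t
  · exact key t ht
  · obtain ⟨n, hn⟩ := key (-t) (by linarith)
    exact ⟨n⁻¹, by simpa using toHom_inv_eq_exp hn⟩

lemma IsGenerator.smul {X : 𝔸} (h : ρ.IsGenerator X) (c : ℝ) : ρ.IsGenerator (c • X) :=
  fun t => by simpa only [smul_smul] using h (t * c)

lemma isGenerator_zero : ρ.IsGenerator (0 : 𝔸) := fun t => ⟨1, by simp⟩

lemma IsGenerator.add [CompactSpace N] {X Y : 𝔸} (hX : ρ.IsGenerator X) (hY : ρ.IsGenerator Y) :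
    ρ.IsGenerator (X + Y) := by
  choose x hx using hX
  choose y hy using hY
  let r : ℕ → ℝ := fun k => 1 / ((k : ℝ) + 1)
  have hr (k) : 0 < r k := by positivity
  have hr0 : Tendsto r atTop (𝓝 0) := tendsto_one_div_add_atTop_nhds_zero_nat
  refine isGenerator_of_tendsto (n := fun k => x (r k) * y (r k)) hr hr0 ?_
  have h1 : Tendsto r atTop (𝓝[≠] 0) :=
    tendsto_nhdsWithin_iff.2 ⟨hr0, Eventually.of_forall fun k => (hr k).ne'⟩
  have h2 := (tendsto_inv_smul_exp_sub_one X).comp h1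
  have h3 := (tendsto_inv_smul_exp_sub_one Y).comp h1
  have h4 := ((continuous_exp_smul Y).tendsto 0).comp hr0
  rw [zero_smul, exp_zero] at h4
  have h5 := (h2.mul h4).add h3
  rw [mul_one] at h5
  refine h5.congr fun k => ?_
  simp only [Function.comp, map_mul, hx, hy, smul_mul_assoc, ← smul_add]
  congr 1
  noncomm_ring

lemma isClosed_isGenerator [CompactSpace N] : IsClosed {X | ρ.IsGenerator X} := by
  have h (t : ℝ) : IsClosed {X : 𝔸 | exp (t • X) ∈ Set.range ρ.toHom} := by
    let _ : NormedAlgebra ℚ 𝔸 := NormedAlgebra.restrictScalars ℚ ℝ 𝔸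
    exact isClosed_range.preimage (exp_continuous.comp (continuous_const_smul t))
  simpa only [IsGenerator, Set.mem_range, Set.ofPred_forall] using isClosed_iInter h

lemma IsGenerator.conj {X : 𝔸} (hX : ρ.IsGenerator X) (n : N) :
    ρ.IsGenerator (ρ.toHom n * X * ρ.toHom n⁻¹) := by
  intro t
  obtain ⟨m, hm⟩ := hX t
  refine ⟨n * m * n⁻¹, ?_⟩
  have h1 : ρ.toHom n⁻¹ * ρ.toHom n = 1 := by rw [← map_mul]; simp
  have h2 : ρ.toHom n * ρ.toHom n⁻¹ = 1 := by rw [← map_mul]; simp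
  have h : SemiconjBy (ρ.toHom n) X (ρ.toHom n * X * ρ.toHom n⁻¹) := by
    rw [SemiconjBy, mul_assoc _ _ (ρ.toHom n), h1, mul_one]
  have h3 := (h.exp_smul t).eq
  rw [map_mul, map_mul, hm, h3, mul_assoc, h2, mul_one]

/-- The Lie algebra of the image of `ρ`. -/
def lieAlg [CompactSpace N] (ρ : BoundedRep N 𝔸) : Submodule ℝ 𝔸 where
  carrier := {X | ρ.IsGenerator X}
  add_mem' := fun h h' => h.add h'
  zero_mem' := isGenerator_zero
  smul_mem' := fun c _ h => h.smul c

lemma bracket_mem_lieAlg [CompactSpace N] {X Y : 𝔸} (hX : X ∈ ρ.lieAlg) (hY : Y ∈ ρ.lieAlg) :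
    X * Y - Y * X ∈ ρ.lieAlg := by
  have h1 : HasDerivAt (fun t : ℝ => exp (t • X) * Y * exp (t • (-X))) (X * Y - Y * X) 0 := by
    have h2 := ((hasDerivAt_exp_smul_const (𝕂 := ℝ) X (0 : ℝ)).mul_const Y).mul
      (hasDerivAt_exp_smul_const (𝕂 := ℝ) (-X) (0 : ℝ))
    refine h2.congr_deriv ?_
    simp [sub_eq_add_neg]
  rw [hasDerivAt_iff_tendsto_slope] at h1
  refine (isClosed_isGenerator (ρ := ρ)).mem_of_tendsto h1 (Eventually.of_forall fun t => ?_)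
  obtain ⟨n, hn⟩ := hX t
  have h3 := toHom_inv_eq_exp hn
  have h4 := hY.conj n
  rw [hn, h3, neg_smul, ← smul_neg] at h4
  change _ ∈ ρ.lieAlg
  rw [slope_def_module]
  refine ρ.lieAlg.smul_mem _ (ρ.lieAlg.sub_mem h4 ?_)
  simpa using hY

lemma eq_top_of_exp_mem [CompactSpace N] [IsTopologicalGroup N] [ConnectedSpace N]
    [FiniteDimensional ℝ 𝔸] {S : Subgroup N} (hS : IsClosed (S : Set N))
    (h : ∀ X ∈ ρ.lieAlg, ∀ t : ℝ, ∀ n, ρ.toHom n = exp (t • X) → n ∈ S) : S = ⊤ := by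
  have : ProperSpace 𝔸 := FiniteDimensional.proper ℝ 𝔸
  have hker (n) (hn : ρ.toHom n = 1) : n ∈ S := h 0 ρ.lieAlg.zero_mem 0 n (by simpa using hn)
  suffices hS1 : (S : Set N) ∈ 𝓝 1 by
    have := IsClopen.eq_univ ⟨hS, Subgroup.isOpen_of_mem_nhds S hS1⟩ ⟨1, S.one_mem⟩
    exact SetLike.coe_injective this
  suffices ∃ ε > 0, ∀ n, ‖ρ.toHom n - 1‖ < ε → n ∈ S by
    obtain ⟨ε, hε, h'⟩ := this
    have hc : Continuous fun n => ‖ρ.toHom n - 1‖ := (ρ.continuous.sub continuous_const).norm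
    exact mem_of_superset ((hc.tendsto 1).eventually_lt_const (by simpa using hε)) h'
  by_contra! hcon
  let r' : ℕ → ℝ := fun k => 1 / ((k : ℝ) + 1)
  have hmin (k : ℕ) : ∃ n ∉ S, ‖ρ.toHom n - 1‖ < r' k ∧
      ∀ s ∈ S, ‖ρ.toHom n - 1‖ ≤ ‖ρ.toHom (n * s) - 1‖ := by
    obtain ⟨n, hn, hnS⟩ := hcon (r' k) (by positivity)
    have hc : Continuous fun s => ‖ρ.toHom (n * s) - 1‖ :=
      ((ρ.continuous.comp (continuous_const_mul n)).sub continuous_const).norm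
    obtain ⟨s, hs, hmin⟩ := hS.isCompact.exists_isMinOn ⟨1, S.one_mem⟩ hc.continuousOn
    refine ⟨n * s, fun hns => hnS ((S.mul_mem_cancel_right hs).1 hns), ?_, fun s' hs' => ?_⟩
    · refine lt_of_le_of_lt (hmin S.one_mem) ?_
      simpa using hn
    · rw [mul_assoc]
      exact hmin (S.mul_mem hs hs')
  choose n hnS hn hmin using hmin
  let r : ℕ → ℝ := fun k => ‖ρ.toHom (n k) - 1‖
  have hr (k) : 0 < r k := norm_pos_iff.2 fun h0 => hnS k (hker _ (sub_eq_zero.1 h0))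
  have hr0 : Tendsto r atTop (𝓝 0) :=
    tendsto_of_tendsto_of_tendsto_of_le_of_le tendsto_const_nhds
      tendsto_one_div_add_atTop_nhds_zero_nat (fun k => (hr k).le) fun k => (hn k).le
  obtain ⟨X, hX, φ, hφ, hlim⟩ := (isCompact_sphere (0 : 𝔸) 1).tendsto_subseq
    (x := fun k => (r k)⁻¹ • (ρ.toHom (n k) - 1)) fun k => by
      rw [mem_sphere_zero_iff_norm, norm_smul, norm_inv, norm_norm, inv_mul_cancel₀ (hr k).ne']
  have hr0' : Tendsto (r ∘ φ) atTop (𝓝 0) := hr0.comp hφ.tendsto_atTop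
  have hXg : ρ.IsGenerator X := isGenerator_of_tendsto (n := n ∘ φ) (fun k => hr (φ k)) hr0' hlim
  have h1 := tendsto_sub_exp (n := n ∘ φ) (fun k => hr (φ k)) hr0' hlim
  have h2 := (((continuous_exp_smul X).comp continuous_neg).norm.tendsto (0 : ℝ)).comp hr0'
  have h3 := h1.mul h2
  rw [zero_mul] at h3
  obtain ⟨k, hk⟩ := (h3.eventually_lt_const one_pos).exists
  simp only [Function.comp] at hk
  obtain ⟨s, hs⟩ := hXg (-r (φ k))
  have h4 := hmin (φ k) s (h X hXg _ s hs)
  have h5 : ρ.toHom (n (φ k) * s) - 1 =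
      (ρ.toHom (n (φ k)) - exp (r (φ k) • X)) * exp ((-r (φ k)) • X) := by
    rw [sub_mul, exp_smul_mul_neg, map_mul, hs]
  rw [h5] at h4
  have h6 := h4.trans (norm_mul_le _ _)
  have h7 := hr (φ k)
  have : r (φ k) * ((r (φ k))⁻¹ * ‖ρ.toHom (n (φ k)) - exp (r (φ k) • X)‖
      * ‖exp ((-r (φ k)) • X)‖) < r (φ k) * 1 := mul_lt_mul_of_pos_left hk h7
  rw [mul_assoc, mul_inv_cancel_left₀ h7.ne', mul_one] at this
  exact absurd h6 (not_le.2 this)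

end BoundedRep
end OneParameter

section SuTriple

open Filter NormedSpace

variable {𝔸 𝔹 : Type*} [NormedRing 𝔸] [NormedAlgebra ℝ 𝔸] [CompleteSpace 𝔸]
  [NormedRing 𝔹] [NormedAlgebra ℝ 𝔹] [CompleteSpace 𝔹]
variable {N : Type*} [Group N] [TopologicalSpace N]

namespace BoundedRep

variable {ρ : BoundedRep N 𝔸}

/-- The elements of `N` whose image under `p ∘ ρ` commutes with `b`. -/
def centralizing (ρ : BoundedRep N 𝔸) (p : 𝔸 →ₐ[ℝ] 𝔹) (b : 𝔹) : Subgroup N where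
  carrier := {n | Commute (p (ρ.toHom n)) b}
  one_mem' := by simp
  mul_mem' := fun {m n} hm hn => by
    rw [Set.mem_ofPred_eq, map_mul, map_mul]
    exact Commute.mul_left hm hn
  inv_mem' := fun {n} hn => by
    have h1 : p (ρ.toHom n⁻¹) * p (ρ.toHom n) = 1 := by rw [← map_mul, ← map_mul]; simp
    have h2 : p (ρ.toHom n) * p (ρ.toHom n⁻¹) = 1 := by rw [← map_mul, ← map_mul]; simp
    exact Commute.units_inv_left (u := ⟨_, _, h2, h1⟩) hn

lemma isClosed_centralizing (p : 𝔸 →ₐ[ℝ] 𝔹) (hp : Continuous p) (b : 𝔹) :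
    IsClosed (ρ.centralizing p b : Set N) :=
  have h : Continuous fun n => p (ρ.toHom n) := hp.comp ρ.continuous
  isClosed_eq (h.mul continuous_const) (continuous_const.mul h)

lemma commute_map_of_lieAlg [CompactSpace N] [IsTopologicalGroup N] [ConnectedSpace N]
    [FiniteDimensional ℝ 𝔸] (p : 𝔸 →ₐ[ℝ] 𝔹) (hp : Continuous p)
    (h : ∀ X ∈ ρ.lieAlg, ∀ Y ∈ ρ.lieAlg, p (X * Y - Y * X) = 0) (m n : N) :
    Commute (p (ρ.toHom m)) (p (ρ.toHom n)) := by
  have hexp (X : 𝔸) (b : 𝔹) (hX : Commute (p X) b) (t : ℝ) : Commute (p (exp (t • X))) b := by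
    let _ : NormedAlgebra ℚ 𝔸 := NormedAlgebra.restrictScalars ℚ ℝ 𝔸
    let _ : NormedAlgebra ℚ 𝔹 := NormedAlgebra.restrictScalars ℚ ℝ 𝔹
    rw [map_exp p hp, map_smul]
    exact (hX.smul_left t).exp_left
  have h1 (Y) (hY : Y ∈ ρ.lieAlg) (n : N) : Commute (p (ρ.toHom n)) (p Y) := by
    have : ρ.centralizing p (p Y) = ⊤ :=
      eq_top_of_exp_mem (isClosed_centralizing p hp _) fun X hX t n hn => by
        change Commute (p (ρ.toHom n)) (p Y)
        rw [hn]
        refine hexp X _ ?_ t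
        have := h X hX Y hY
        rwa [map_sub, map_mul, map_mul, sub_eq_zero] at this
    exact (this ▸ Subgroup.mem_top n : n ∈ ρ.centralizing p (p Y))
  have : ρ.centralizing p (p (ρ.toHom n)) = ⊤ :=
    eq_top_of_exp_mem (isClosed_centralizing p hp _) fun X hX t m hm => by
      change Commute (p (ρ.toHom m)) _
      rw [hm]
      exact hexp X _ (h1 X hX n).symm t
  exact (this ▸ Subgroup.mem_top m : m ∈ ρ.centralizing p (p (ρ.toHom n)))

/-- The orthogonal complement of the kernel of `p` in the Lie algebra, for the form `τ (X * Y)`. -/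
def kerCompl [CompactSpace N] (ρ : BoundedRep N 𝔸) (τ : 𝔸 →L[ℝ] ℝ) (p : 𝔸 →ₐ[ℝ] 𝔹) :
    Submodule ℝ 𝔸 where
  carrier := {X | X ∈ ρ.lieAlg ∧ ∀ Z ∈ ρ.lieAlg, p Z = 0 → τ (X * Z) = 0}
  add_mem' := fun {X Y} hX hY => ⟨add_mem hX.1 hY.1, fun Z hZ hpZ => by
    rw [add_mul, map_add, hX.2 Z hZ hpZ, hY.2 Z hZ hpZ, add_zero]⟩
  zero_mem' := ⟨zero_mem _, fun Z _ _ => by simp⟩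
  smul_mem' := fun c X hX => ⟨Submodule.smul_mem _ c hX.1, fun Z hZ hpZ => by
    rw [smul_mul_assoc, map_smul, hX.2 Z hZ hpZ, smul_zero]⟩

variable [CompactSpace N] {τ : 𝔸 →L[ℝ] ℝ} {p : 𝔸 →ₐ[ℝ] 𝔹}

lemma bracket_mem_kerCompl (hτ : ∀ x y, τ (x * y) = τ (y * x)) {X Y : 𝔸}
    (hX : X ∈ ρ.lieAlg) (hY : Y ∈ ρ.kerCompl τ p) : X * Y - Y * X ∈ ρ.kerCompl τ p := by
  refine ⟨bracket_mem_lieAlg hX hY.1, fun Z hZ hpZ => ?_⟩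
  have h1 := hY.2 (Z * X - X * Z) (bracket_mem_lieAlg hZ hX) (by simp [hpZ])
  rw [← h1, sub_mul, mul_sub, map_sub, map_sub, mul_assoc, hτ X, ← mul_assoc Y Z X, mul_assoc Y X]

lemma exists_sub_mem_kerCompl [FiniteDimensional ℝ 𝔸] (hτ : ∀ x y, τ (x * y) = τ (y * x))
    (hneg : ∀ X ∈ ρ.lieAlg, X ≠ 0 → τ (X * X) < 0) {X : 𝔸} (hX : X ∈ ρ.lieAlg) :
    ∃ Y ∈ ρ.kerCompl τ p, p Y = p X := by
  let g := ρ.lieAlg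
  let B : LinearMap.BilinForm ℝ g :=
    LinearMap.mk₂ ℝ (fun X Y => τ ((X : 𝔸) * Y)) (by simp [add_mul]) (by simp) (by simp [mul_add])
      (by simp)
  have hBs : B.IsSymm := ⟨fun X Y => hτ _ _⟩
  let W : Submodule ℝ g := (LinearMap.ker p.toLinearMap).comap g.subtype
  have hW : (B.restrict W).Nondegenerate := by
    have hs : (B.restrict W).IsSymm := hBs.restrict W
    refine hs.isRefl.nondegenerate_iff_separatingLeft.2 fun x hx => ?_
    by_contra h0
    have h1 := hneg x.1.1 x.1.2 fun h => h0 (Subtype.ext (Subtype.ext h))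
    exact h1.ne (hx x)
  have hc := LinearMap.BilinForm.isCompl_orthogonal_of_restrict_nondegenerate hBs.isRefl hW
  obtain ⟨k, hk, s, hs, hks⟩ := Submodule.mem_sup.1
    (hc.sup_eq_top ▸ Submodule.mem_top : (⟨X, hX⟩ : g) ∈ W ⊔ B.orthogonal W)
  refine ⟨s, ⟨s.2, fun Z hZ hpZ => ?_⟩, ?_⟩
  · have := hs ⟨Z, hZ⟩ hpZ
    rw [hτ]
    exact this
  · have hk' : p (k : 𝔸) = 0 := hk
    have := congrArg (fun x : g => p (x : 𝔸)) hks
    simpa [hk'] using this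

lemma eq_zero_of_mem_kerCompl (hneg : ∀ X ∈ ρ.lieAlg, X ≠ 0 → τ (X * X) < 0) {X : 𝔸}
    (hX : X ∈ ρ.kerCompl τ p) (hpX : p X = 0) : X = 0 := by
  by_contra h
  exact (hneg X hX.1 h).ne (hX.2 X hX.1 hpX)

lemma exists_isSuTriple [FiniteDimensional ℝ 𝔸] (hτ : ∀ x y, τ (x * y) = τ (y * x))
    (hneg : ∀ X ∈ ρ.lieAlg, X ≠ 0 → τ (X * X) < 0) {X₀ Y₀ : 𝔸} (hX₀ : X₀ ∈ ρ.lieAlg)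
    (hY₀ : Y₀ ∈ ρ.lieAlg) (h₀ : p (X₀ * Y₀ - Y₀ * X₀) ≠ 0) :
    ∃ I ∈ ρ.lieAlg, ∃ J ∈ ρ.lieAlg, ∃ K ∈ ρ.lieAlg, IsSuTriple I J K ∧ p I ≠ 0 := by
  let s := ρ.kerCompl τ p
  obtain ⟨X₁, hX₁, hpX⟩ := exists_sub_mem_kerCompl (p := p) hτ hneg hX₀
  obtain ⟨Y₁, hY₁, hpY⟩ := exists_sub_mem_kerCompl (p := p) hτ hneg hY₀
  have h₁ : X₁ * Y₁ - Y₁ * X₁ ≠ 0 := fun h => h₀ <| by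
    rw [map_sub, map_mul, map_mul, ← hpX, ← hpY, ← map_mul, ← map_mul, ← map_sub, h, map_zero]
  have hneg' (X) (hX : X ∈ s) (h : X ≠ 0) : 0 < -τ (X * X) := neg_pos.2 (hneg X hX.1 h)
  have hnn (X) (hX : X ∈ s) : 0 ≤ -τ (X * X) := by
    by_cases h : X = 0
    · simp [h]
    · exact (hneg' X hX h).le
  let q : 𝔸 × 𝔸 → ℝ := fun P => -τ (P.1 * P.1) - τ (P.2 * P.2)
  let A : 𝔸 × 𝔸 → 𝔸 := fun P => P.1 * P.2 - P.2 * P.1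
  let F : 𝔸 × 𝔸 → ℝ := fun P => -τ (A P * A P)
  have hAs (P : 𝔸 × 𝔸) (hP : P ∈ s.prod s) : A P ∈ s := bracket_mem_kerCompl hτ hP.1.1 hP.2
  have hq (P : 𝔸 × 𝔸) (hP : P ∈ s.prod s) (h : P ≠ 0) : 0 < q P := by
    have h1 := hnn _ hP.1
    have h2 := hnn _ hP.2
    by_cases h3 : P.1 = 0
    · have h4 : P.2 ≠ 0 := fun h4 => h (Prod.ext h3 h4)
      have := hneg' _ hP.2 h4
      simp only [q]; linarith
    · have := hneg' _ hP.1 h3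
      simp only [q]; linarith
  have : ProperSpace (𝔸 × 𝔸) := FiniteDimensional.proper ℝ _
  have hcl : IsClosed (s.prod s : Set (𝔸 × 𝔸)) := Submodule.closed_of_finiteDimensional _
  have hcomp : IsCompact (Metric.sphere (0 : 𝔸 × 𝔸) 1 ∩ (s.prod s : Set (𝔸 × 𝔸))) :=
    (isCompact_sphere _ _).inter_right hcl
  have hqc : Continuous q := by fun_prop
  have hFc : Continuous F := by fun_prop
  have hAsmul (c : ℝ) (P : 𝔸 × 𝔸) : A (c • P) = (c * c) • A P := by
    simp only [A, Prod.smul_fst, Prod.smul_snd, smul_mul_smul_comm, smul_sub]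
  have hqsmul (c : ℝ) (P : 𝔸 × 𝔸) : q (c • P) = c ^ 2 * q P := by
    simp only [q, Prod.smul_fst, Prod.smul_snd, smul_mul_smul_comm, map_smul, smul_eq_mul]
    ring
  have hFsmul (c : ℝ) (P : 𝔸 × 𝔸) : F (c • P) = c ^ 4 * F P := by
    simp only [F, hAsmul, smul_mul_smul_comm, map_smul, smul_eq_mul]
    ring
  have hP₁ : (X₁, Y₁) ∈ s.prod s := ⟨hX₁, hY₁⟩
  have hP₁0 : (X₁, Y₁) ≠ 0 := fun h => h₁ <| by
    have h1 : X₁ = 0 := congrArg Prod.fst h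
    simp [h1]
  have hunit (P : 𝔸 × 𝔸) (hP : P ∈ s.prod s) (h : P ≠ 0) :
      ‖P‖⁻¹ • P ∈ Metric.sphere (0 : 𝔸 × 𝔸) 1 ∩ (s.prod s : Set (𝔸 × 𝔸)) := by
    refine ⟨?_, Submodule.smul_mem _ _ hP⟩
    rw [mem_sphere_zero_iff_norm, norm_smul, norm_inv, norm_norm,
      inv_mul_cancel₀ (norm_ne_zero_iff.2 h)]
  obtain ⟨P, ⟨hP1, hPs⟩, hmax⟩ := hcomp.exists_isMaxOn ⟨_, hunit _ hP₁ hP₁0⟩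
    (f := fun P => F P / q P ^ 2) (hFc.continuousOn.div (hqc.pow 2).continuousOn fun P hP => by
      have hP0 : P ≠ 0 := fun h => by simp [h] at hP
      exact (pow_pos (hq P hP.2 hP0) 2).ne')
  have hP0 : P ≠ 0 := fun h => by simp [h] at hP1
  set M := F P / q P ^ 2 with hM
  have hqP := hq P hPs hP0
  have hle (Q : 𝔸 × 𝔸) (hQ : Q ∈ s.prod s) : F Q ≤ M * q Q ^ 2 := by
    by_cases h : Q = 0
    · simp [h, F, A, q]
    · have h1 : F (‖Q‖⁻¹ • Q) / q (‖Q‖⁻¹ • Q) ^ 2 ≤ M := hmax (hunit Q hQ h)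
      have h2 : (‖Q‖⁻¹) ≠ 0 := inv_ne_zero (norm_ne_zero_iff.2 h)
      have h3 : F (‖Q‖⁻¹ • Q) / q (‖Q‖⁻¹ • Q) ^ 2 = F Q / q Q ^ 2 := by
        rw [hFsmul, hqsmul, mul_pow, ← pow_mul, mul_div_mul_left _ _ (pow_ne_zero 4 h2)]
      rw [h3, div_le_iff₀ (pow_pos (hq Q hQ h) 2)] at h1
      exact h1
  have hMpos : 0 < M := by
    have h1 := hle _ hP₁
    have h2 : 0 < F (X₁, Y₁) := hneg' _ (hAs _ hP₁) h₁
    have h3 := pow_pos (hq _ hP₁ hP₁0) 2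
    by_contra hM0
    nlinarith
  have heq : F P = M * q P ^ 2 := by
    rw [hM, div_mul_cancel₀ _ (pow_pos hqP 2).ne']
  have hFP : 0 < F P := by rw [heq]; positivity
  have hA0 : A P ≠ 0 := fun h => by simp [F, h] at hFP
  obtain ⟨X, Y⟩ := P
  have hXs : X ∈ s := hPs.1
  have hYs : Y ∈ s := hPs.2
  set C := A (X, Y) with hC
  have hCs : C ∈ s := hAs _ hPs
  set μ := 2 * M * q (X, Y) with hμ
  have hμpos : 0 < μ := by positivity
  have hderiv (V W : 𝔸) (hV : V ∈ s) (hW : W ∈ s) :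
      τ (C * ((V * Y - Y * V) + (X * W - W * X))) = μ * (τ (X * V) + τ (Y * W)) := by
    have dX : HasDerivAt (fun t : ℝ => X + t • V) V 0 := by
      simpa using ((hasDerivAt_id (0 : ℝ)).smul_const V).const_add X
    have dY : HasDerivAt (fun t : ℝ => Y + t • W) W 0 := by
      simpa using ((hasDerivAt_id (0 : ℝ)).smul_const W).const_add Y
    have dA := (dX.mul dY).sub (dY.mul dX)
    have dF := (τ.hasFDerivAt.comp_hasDerivAt (0 : ℝ) (dA.mul dA)).neg
    have dq := ((τ.hasFDerivAt.comp_hasDerivAt (0 : ℝ) (dX.mul dX)).neg).sub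
      (τ.hasFDerivAt.comp_hasDerivAt (0 : ℝ) (dY.mul dY))
    have d := dF.sub ((dq.pow 2).const_mul M)
    have hloc : IsLocalMax (fun t : ℝ => F (X + t • V, Y + t • W)
        - M * q (X + t • V, Y + t • W) ^ 2) 0 := by
      refine Eventually.of_forall fun t => ?_
      simp only [zero_smul, add_zero]
      rw [heq, sub_self]
      exact sub_nonpos.2 (hle _ ⟨s.add_mem hXs (s.smul_mem t hV), s.add_mem hYs (s.smul_mem t hW)⟩)
    have h0 := hloc.hasDerivAt_eq_zero d
    simp only [Pi.mul_apply, Pi.sub_apply, Pi.neg_apply, Function.comp, zero_smul, add_zero,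
      map_add, Nat.cast_ofNat, Nat.add_one_sub_one, pow_one] at h0
    have e1 : C = X * Y - Y * X := rfl
    have e2 : q (X, Y) = -τ (X * X) - τ (Y * Y) := rfl
    have e3 := hτ (V * Y + X * W - (W * X + Y * V)) C
    have e4 := hτ V X
    have e5 := hτ W Y
    rw [← e1, e3, e4, e5] at h0
    rw [hμ, e2, show V * Y - Y * V + (X * W - W * X) = V * Y + X * W - (W * X + Y * V) by abel]
    linarith
  have eC : C = X * Y - Y * X := rfl
  clear_value C
  have hzero (Z) (hZ : Z ∈ s) (h : ∀ V ∈ s, τ (Z * V) = 0) : Z = 0 := by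
    by_contra h0
    have := hneg' Z hZ h0
    rw [h Z hZ] at this
    simp at this
  have hYC : Y * C - C * Y = μ • X := by
    refine sub_eq_zero.1 (hzero _ (s.sub_mem (bracket_mem_kerCompl hτ hYs.1 hCs)
      (s.smul_mem _ hXs)) fun V hV => ?_)
    have h1 := hderiv V 0 hV s.zero_mem
    simp only [mul_zero, zero_mul, sub_self, add_zero, map_zero] at h1
    rw [sub_mul, smul_mul_assoc, map_sub, map_smul, smul_eq_mul, ← h1, sub_mul, mul_sub, map_sub,
      map_sub, mul_assoc Y, hτ Y, mul_assoc, mul_assoc, sub_self]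
  have hCX : C * X - X * C = μ • Y := by
    refine sub_eq_zero.1 (hzero _ (s.sub_mem (bracket_mem_kerCompl hτ hCs.1 hXs)
      (s.smul_mem _ hYs)) fun V hV => ?_)
    have h1 := hderiv 0 V s.zero_mem hV
    simp only [mul_zero, zero_mul, sub_self, zero_add, map_zero] at h1
    rw [sub_mul, smul_mul_assoc, map_sub, map_smul, smul_eq_mul, ← h1, sub_mul, mul_sub, map_sub,
      map_sub, mul_assoc X, hτ X, mul_assoc, mul_assoc, sub_self]
  let α := √(4 / μ)
  have hα0 : 0 < α := Real.sqrt_pos.2 (by positivity)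
  have hα : α * α * μ = 4 := by
    rw [Real.mul_self_sqrt (by positivity), div_mul_cancel₀ _ hμpos.ne']
  have hα2 : α * α / 2 * α * μ = 2 * α := by linear_combination α / 2 * hα
  have hα3 : α * (α * α / 2) * μ = 2 * α := by linear_combination α / 2 * hα
  refine ⟨(α * α / 2) • C, s.smul_mem _ hCs |>.1, α • X, s.smul_mem _ hXs |>.1, α • Y,
    s.smul_mem _ hYs |>.1, ⟨?_, ?_, ?_⟩, ?_⟩
  · rw [smul_mul_smul_comm, smul_mul_smul_comm, mul_comm α (α * α / 2), ← smul_sub, hCX, smul_smul,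
      hα2, smul_smul]
  · rw [smul_mul_smul_comm, smul_mul_smul_comm, ← smul_sub, ← eC, smul_smul]
    congr 1
    ring
  · rw [smul_mul_smul_comm, smul_mul_smul_comm, mul_comm (α * α / 2) α, ← smul_sub, hYC, smul_smul,
      hα3, smul_smul]
  · intro h
    have := eq_zero_of_mem_kerCompl hneg (s.smul_mem _ hCs) h
    exact hA0 ((smul_eq_zero.1 this).resolve_left (by positivity))

end BoundedRep
end SuTriple

section MatrixBound

open Matrix
open scoped Matrix.Norms.L2Operator ComplexOrder

lemma IsSuTriple.one_le_norm {𝔸 : Type*} [NormedRing 𝔸] [NormedAlgebra ℝ 𝔸] [CompleteSpace 𝔸]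
    {I J K : 𝔸} (h : IsSuTriple I J K) (hI : I ≠ 0) : 1 ≤ ‖I‖ := by
  have two {X Y : 𝔸} {Z : 𝔸} (hXY : X * Y - Y * X = (2 : ℝ) • Z) : ‖Z‖ ≤ ‖X‖ * ‖Y‖ := by
    have h1 := norm_sub_le (X * Y) (Y * X)
    rw [hXY, norm_smul] at h1
    have h2 := norm_mul_le X Y
    have h3 := norm_mul_le Y X
    norm_num at h1
    nlinarith
  have hK := two h.hIJ
  have hJ := two h.hKI
  have hII := two h.hJK
  by_contra! hlt
  have h1 : ‖J‖ ≤ ‖I‖ ^ 2 * ‖J‖ := by nlinarith [norm_nonneg I]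
  have h2 : ‖I‖ ^ 2 < 1 := by nlinarith [norm_nonneg I]
  have hJ0 : ‖J‖ = 0 := by nlinarith [norm_nonneg J]
  have : ‖I‖ ≤ 0 := by rw [hJ0] at hII; linarith
  exact hI (norm_le_zero_iff.1 this)

variable {n : ℕ} {I J K : Matrix (Fin n) (Fin n) ℂ}

lemma IsSuTriple.exists_lower (h : IsSuTriple I J K) (hJ : star J = -J)
    (hK : star K = -K) {v : Fin n → ℂ} (hv : v ≠ 0) {l : ℝ} (hl : 0 < l)
    (hIv : I *ᵥ v = (Complex.I * l) • v) :
    ∃ w ≠ 0, I *ᵥ w = (Complex.I * (l - 2 : ℝ)) • w := by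
  set E := J + Complex.I • K with hE
  have c2 (X : Matrix (Fin n) (Fin n) ℂ) : (2 : ℝ) • X = (2 : ℂ) • X := by
    ext; simp
  have h1 := h.hIJ
  have h2 := h.hJK
  have h3 := h.hKI
  rw [c2] at h1 h2 h3
  have hIE : I * E = E * I - (2 * Complex.I) • E := by
    have e1 : I * J = J * I + (2 : ℂ) • K := by rw [← h1]; abel
    have e2 : I * K = K * I - (2 : ℂ) • J := by rw [← h3]; abel
    rw [hE, mul_add, add_mul, mul_smul_comm, smul_mul_assoc, e1, e2, smul_sub, smul_add, smul_smul,
      smul_smul, mul_comm Complex.I 2, mul_assoc 2 Complex.I Complex.I, Complex.I_mul_I]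
    module
  have hstar : Eᴴ = -J + Complex.I • K := by
    rw [← star_eq_conjTranspose, hE, star_add, star_smul, hJ, hK]
    simp
  have hEE : Eᴴ * E = E * Eᴴ - (4 * Complex.I) • I := by
    have e1 : J * K = K * J + (2 : ℂ) • I := by rw [← h2]; abel
    rw [hstar, hE]
    simp only [mul_add, add_mul, mul_smul_comm, smul_mul_assoc, e1, smul_add, smul_smul, neg_mul,
      mul_neg, Complex.I_mul_I]
    module
  refine ⟨E *ᵥ v, fun h0 => ?_, ?_⟩
  · have e1 : (Eᴴ * E) *ᵥ v = 0 := by rw [← mulVec_mulVec, h0, mulVec_zero]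
    rw [hEE, sub_mulVec, smul_mulVec, hIv, smul_smul] at e1
    have e2 : (4 * Complex.I * (Complex.I * l)) = ((-(4 * l) : ℝ) : ℂ) := by
      push_cast
      linear_combination (4 * l : ℂ) * Complex.I_mul_I
    rw [e2] at e1
    have e3 := congrArg (star v ⬝ᵥ ·) e1
    simp only [dotProduct_sub, dotProduct_smul, dotProduct_zero, smul_eq_mul] at e3
    have p1 := (posSemidef_self_mul_conjTranspose E).dotProduct_mulVec_nonneg v
    have p2 : 0 < star v ⬝ᵥ v := dotProduct_star_self_pos_iff.2 hv
    rw [Complex.le_def] at p1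
    rw [Complex.lt_def] at p2
    have e4 := congrArg Complex.re e3
    rw [Complex.sub_re, Complex.re_ofReal_mul] at e4
    have p1' := p1.1
    have p2' := p2.1
    simp only [Complex.zero_re] at e4 p1' p2'
    nlinarith
  · rw [mulVec_mulVec, hIE, sub_mulVec, ← mulVec_mulVec, hIv, mulVec_smul, smul_mulVec, ← sub_smul]
    congr 1
    push_cast
    ring

lemma IsSuTriple.le_of_mulVec_eq (h : IsSuTriple I J K) (hJ : star J = -J)
    (hK : star K = -K) {v : Fin n → ℂ} (hv : v ≠ 0) {l : ℝ}
    (hIv : I *ᵥ v = (Complex.I * l) • v) : l ≤ 2 * n := by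
  by_contra! hl
  have key (k : ℕ) (hk : k ≤ n) : ∃ w ≠ 0, I *ᵥ w = (Complex.I * (l - 2 * k : ℝ)) • w := by
    induction k with
    | zero => exact ⟨v, hv, by simpa using hIv⟩
    | succ k ih =>
      obtain ⟨w, hw, hIw⟩ := ih (by omega)
      have : (k : ℝ) + 1 ≤ n := by exact_mod_cast hk
      obtain ⟨w', hw', hIw'⟩ := h.exists_lower hJ hK hw (by linarith) hIw
      refine ⟨w', hw', ?_⟩
      rw [hIw']
      congr 3
      push_cast
      ring
  choose w hw hIw using fun k : Fin (n + 1) => key k (by omega)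
  have hind := Module.End.eigenvectors_linearIndependent' (toLin' I)
    (fun k : Fin (n + 1) => Complex.I * (l - 2 * (k : ℕ) : ℝ)) (fun a b hab => by
      have h1 := mul_left_cancel₀ Complex.I_ne_zero hab
      have h2 := Complex.ofReal_injective h1
      have h3 : ((a : ℕ) : ℝ) = (b : ℕ) := by linarith
      exact Fin.ext (by exact_mod_cast h3)) w fun k =>
        Module.End.hasEigenvector_iff.2 ⟨Module.End.mem_eigenspace_iff.2 (by
          rw [toLin'_apply]; exact hIw k), hw k⟩
  simpa using hind.fintype_card_le_finrank

lemma IsSuTriple.norm_le (h : IsSuTriple I J K) (hI : star I = -I) (hJ : star J = -J)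
    (hK : star K = -K) : ‖I‖ ≤ 2 * n := by
  obtain _ | _ := isEmpty_or_nonempty (Fin n)
  · rw [Subsingleton.elim I 0, norm_zero]; positivity
  have hH : IsSelfAdjoint (Complex.I • I) := by
    rw [isSelfAdjoint_iff, star_smul, hI]; simp
  obtain ⟨z, hz, hzn⟩ := spectrum.exists_nnnorm_eq_spectralRadius (Complex.I • I)
  rw [hH.spectralRadius_eq_nnnorm, nnnorm_smul] at hzn
  have hzI : ‖z‖ = ‖I‖ := by
    have := congrArg NNReal.toReal (ENNReal.coe_injective hzn)
    simpa using this
  have hre := hH.mem_spectrum_eq_re hz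
  rw [spectrum.mem_iff, isUnit_iff_isUnit_det, isUnit_iff_ne_zero, not_not] at hz
  obtain ⟨v, hv, hv0⟩ := exists_mulVec_eq_zero_iff.2 hz
  rw [sub_mulVec, smul_mulVec, Algebra.algebraMap_eq_smul_one, smul_mulVec, one_mulVec, sub_eq_zero] at hv0
  have hIv : I *ᵥ v = (Complex.I * (-z.re : ℝ)) • v := by
    have := congrArg (fun w => -Complex.I • w) hv0
    simp only [smul_smul, neg_mul, Complex.I_mul_I, neg_neg, one_smul] at this
    rw [← this, hre]
    simp
  rw [← hzI, hre, Complex.norm_real, Real.norm_eq_abs, abs_le]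
  constructor
  · have := h.le_of_mulVec_eq hJ hK hv hIv
    linarith
  · have h' : IsSuTriple (-I) J (-K) := by
      refine ⟨?_, ?_, ?_⟩
      · rw [neg_mul, mul_neg, smul_neg, ← h.hIJ]; abel
      · rw [neg_mul, mul_neg, smul_neg, ← h.hJK]; abel
      · rw [neg_mul_neg, neg_mul_neg, h.hKI]
    have := h'.le_of_mulVec_eq hJ (by rw [star_neg, hK]) hv (l := z.re) (by
      rw [neg_mulVec, hIv, ← neg_smul]; simp)
    simpa using this

lemma norm_le_one_of_star_mul {U : Matrix (Fin n) (Fin n) ℂ} (h : star U * U = 1) : ‖U‖ ≤ 1 := by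
  obtain _ | _ := isEmpty_or_nonempty (Fin n)
  · rw [Subsingleton.elim U 0, norm_zero]; positivity
  have := CStarRing.norm_star_mul_self (x := U)
  rw [h, norm_one] at this
  nlinarith [norm_nonneg U]

end MatrixBound

section FamilyOfTriples

open Filter NormedSpace
open scoped Matrix.Norms.L2Operator ComplexOrder

/-- Complex square matrices. -/
abbrev CMat (d : ℕ) := Matrix (Fin d) (Fin d) ℂ

lemma star_eq_neg_of_exp_unitary {d : ℕ} {X : CMat d}
    (h : ∀ t : ℝ, star (exp (t • X)) * exp (t • X) = 1) : star X = -X := by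
  have h1 (t : ℝ) : exp (t • star X) = exp (t • (-X)) := by
    have h2 : star (exp (t • X)) = exp (t • star X) := by
      rw [star_exp, star_smul, star_trivial]
    calc exp (t • star X) = exp (t • star X) * (exp (t • X) * exp ((-t) • X)) := by
          rw [exp_smul_mul_neg, mul_one]
      _ = _ := by rw [← mul_assoc, ← h2, h, one_mul, neg_smul, smul_neg]
  have h2 := tendsto_inv_smul_exp_sub_one (star X)
  simp only [h1] at h2
  exact tendsto_nhds_unique h2 (tendsto_inv_smul_exp_sub_one (-X))

lemma re_trace_mul_self_neg {d : ℕ} {X : CMat d} (h : star X = -X) (hX : X ≠ 0) :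
    (X * X).trace.re < 0 := by
  have h1 := (Matrix.posSemidef_conjTranspose_mul_self X).trace_nonneg
  have h2 : (X.conjTranspose * X).trace ≠ 0 :=
    fun h0 => hX (Matrix.trace_conjTranspose_mul_self_eq_zero_iff.1 h0)
  have h3 : 0 < (X.conjTranspose * X).trace := lt_of_le_of_ne h1 (Ne.symm h2)
  rw [← Matrix.star_eq_conjTranspose, h, neg_mul, Matrix.trace_neg, Complex.lt_def] at h3
  simpa using h3.1

lemma re_trace_mul_self_nonpos {d : ℕ} {X : CMat d} (h : star X = -X) :
    (X * X).trace.re ≤ 0 := by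
  by_cases hX : X = 0
  · simp [hX]
  · exact (re_trace_mul_self_neg h hX).le

variable {N : Type*} [Group N] [TopologicalSpace N]

/-- The product of a finite family of unitary representations. -/
def UnitaryRep.prod (s : Finset (UnitaryRep N)) :
    BoundedRep N (∀ i : s, CMat (i : UnitaryRep N).dim) where
  toHom := MonoidHom.pi fun i : s => (i : UnitaryRep N).toHom
  continuous := continuous_pi fun i => (i : UnitaryRep N).continuous
  norm_le n := (pi_norm_le_iff_of_nonneg zero_le_one).2 fun i =>
    norm_le_one_of_star_mul ((i : UnitaryRep N).star_mul n)

/-- The sum of the real parts of the traces of a finite family of matrices. -/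
noncomputable def sumReTrace {ι : Type*} [Fintype ι] (d : ι → ℕ) : (∀ i, CMat (d i)) →L[ℝ] ℝ :=
  LinearMap.toContinuousLinearMap
    { toFun := fun X => ∑ i, (X i).trace.re
      map_add' := fun X Y => by simp [Finset.sum_add_distrib]
      map_smul' := fun c X => by simp [Finset.mul_sum] }

lemma exp_pi_apply {ι : Type*} [Fintype ι] {d : ι → ℕ} (X : ∀ i, CMat (d i)) (t : ℝ) (i : ι) :
    exp (t • X) i = exp (t • X i) := by
  let _ : ∀ i, NormedAlgebra ℚ (CMat (d i)) := fun i => NormedAlgebra.restrictScalars ℚ ℝ _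
  exact map_exp (Pi.evalAlgHom ℝ (fun i => CMat (d i)) i) (continuous_apply i) (t • X)

lemma IsSuTriple.map {𝔸 𝔹 : Type*} [NormedRing 𝔸] [NormedAlgebra ℝ 𝔸] [NormedRing 𝔹]
    [NormedAlgebra ℝ 𝔹] {I J K : 𝔸} (h : IsSuTriple I J K) (p : 𝔸 →ₐ[ℝ] 𝔹) :
    IsSuTriple (p I) (p J) (p K) where
  hIJ := by rw [← map_mul, ← map_mul, ← map_sub, h.hIJ, map_smul]
  hJK := by rw [← map_mul, ← map_mul, ← map_sub, h.hJK, map_smul]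
  hKI := by rw [← map_mul, ← map_mul, ← map_sub, h.hKI, map_smul]

lemma UnitaryRep.exists_forall_eq [CompactSpace N] {f : ∀ i : UnitaryRep N, CMat i.dim}
    (h : ∀ s : Finset (UnitaryRep N), ∃ n, ∀ i ∈ s, i.toHom n = f i) :
    ∃ n, ∀ i : UnitaryRep N, i.toHom n = f i := by
  have := isCompact_univ.inter_iInter_nonempty (fun i : UnitaryRep N => {n : N | i.toHom n = f i})
    (fun i => isClosed_eq i.continuous continuous_const) fun s => by
      obtain ⟨n, hn⟩ := h s
      exact ⟨n, Set.mem_univ _, Set.mem_iInter₂.2 hn⟩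
  obtain ⟨n, -, hn⟩ := this
  exact ⟨n, Set.mem_iInter.1 hn⟩

variable [IsTopologicalGroup N] [CompactSpace N] [ConnectedSpace N]

lemma UnitaryRep.exists_triple_finset {s : Finset (UnitaryRep N)} {ρ₀ : UnitaryRep N}
    (hs : ρ₀ ∈ s) (hnc : ¬ ∀ m n, Commute (ρ₀.toHom m) (ρ₀.toHom n)) :
    ∃ I J K : ∀ i : s, CMat (i : UnitaryRep N).dim,
      (∀ i, IsSuTriple (I i) (J i) (K i) ∧ star (I i) = -I i ∧ star (J i) = -J i ∧
        star (K i) = -K i) ∧ I ⟨ρ₀, hs⟩ ≠ 0 ∧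
      (∀ t : ℝ, ∃ n, ∀ i : s, (i : UnitaryRep N).toHom n = exp (t • I i)) ∧
      ∀ t : ℝ, ∃ n, ∀ i : s, (i : UnitaryRep N).toHom n = exp (t • J i) := by
  let ρ := UnitaryRep.prod s
  let p := Pi.evalAlgHom ℝ (fun i : s => CMat (i : UnitaryRep N).dim) ⟨ρ₀, hs⟩
  let τ := sumReTrace fun i : s => (i : UnitaryRep N).dim
  have hgen (X) (hX : X ∈ ρ.lieAlg) (t : ℝ) : ∃ n, ∀ i : s,
      (i : UnitaryRep N).toHom n = exp (t • X i) := by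
    obtain ⟨n, hn⟩ := hX t
    exact ⟨n, fun i => by rw [← exp_pi_apply, ← hn]; rfl⟩
  have hskew (X) (hX : X ∈ ρ.lieAlg) (i : s) : star (X i) = -X i :=
    star_eq_neg_of_exp_unitary fun t => by
      obtain ⟨n, hn⟩ := hgen X hX t
      rw [← hn i, (i : UnitaryRep N).star_mul]
  have hτ (X Y) : τ (X * Y) = τ (Y * X) := by
    exact Finset.sum_congr rfl fun i _ => congrArg Complex.re (Matrix.trace_mul_comm (X i) (Y i))
  have hneg (X) (hX : X ∈ ρ.lieAlg) (hX0 : X ≠ 0) : τ (X * X) < 0 := by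
    obtain ⟨i, hi⟩ := Function.ne_iff.1 hX0
    exact Finset.sum_neg' (fun i _ => re_trace_mul_self_nonpos (hskew X hX i))
      ⟨i, Finset.mem_univ i, re_trace_mul_self_neg (hskew X hX i) hi⟩
  have hex : ∃ X ∈ ρ.lieAlg, ∃ Y ∈ ρ.lieAlg, p (X * Y - Y * X) ≠ 0 := by
    by_contra! hcon
    exact hnc (BoundedRep.commute_map_of_lieAlg p (continuous_apply _) hcon)
  obtain ⟨X, hX, Y, hY, hXY⟩ := hex
  obtain ⟨I, hI, J, hJ, K, hK, hT, hpI⟩ := BoundedRep.exists_isSuTriple hτ hneg hX hY hXY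
  exact ⟨I, J, K, fun i => ⟨hT.map (Pi.evalAlgHom ℝ (fun i : s => CMat (i : UnitaryRep N).dim) i),
    hskew I hI i, hskew J hJ i, hskew K hK i⟩, hpI, hgen I hI, hgen J hJ⟩

theorem UnitaryRep.exists_triple {ρ₀ : UnitaryRep N}
    (hnc : ¬ ∀ m n, Commute (ρ₀.toHom m) (ρ₀.toHom n)) :
    ∃ (I J K : ∀ i : UnitaryRep N, CMat i.dim) (z y : ℝ → N),
      (∀ i, IsSuTriple (I i) (J i) (K i)) ∧ star (K ρ₀) = -K ρ₀ ∧ I ρ₀ ≠ 0 ∧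
      (∀ i t, i.toHom (z t) = exp (t • I i)) ∧ ∀ i t, i.toHom (y t) = exp (t • J i) := by
  classical
  let E := ∀ i : UnitaryRep N, CMat i.dim × CMat i.dim × CMat i.dim
  let C : Finset (UnitaryRep N) → Set E := fun s =>
    {ω | (∀ i, ω i ∈ Metric.closedBall 0 (2 * (i.dim : ℝ))) ∧ 1 ≤ ‖(ω ρ₀).1‖ ∧
      (∀ i ∈ s, IsSuTriple (ω i).1 (ω i).2.1 (ω i).2.2) ∧ star (ω ρ₀).2.2 = -(ω ρ₀).2.2 ∧
      (∀ t : ℝ, ∃ n, ∀ i ∈ s, i.toHom n = exp (t • (ω i).1)) ∧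
      ∀ t : ℝ, ∃ n, ∀ i ∈ s, i.toHom n = exp (t • (ω i).2.1)}
  have c1 (i : UnitaryRep N) : Continuous fun ω : E => (ω i).1 := by fun_prop
  have c2 (i : UnitaryRep N) : Continuous fun ω : E => (ω i).2.1 := by fun_prop
  have c3 (i : UnitaryRep N) : Continuous fun ω : E => (ω i).2.2 := by fun_prop
  have hclosed_exp (s : Finset (UnitaryRep N)) (X : E → ∀ i : UnitaryRep N, CMat i.dim)
      (hX : ∀ i, Continuous fun ω => X ω i) :
      IsClosed {ω | ∀ t : ℝ, ∃ n, ∀ i ∈ s, i.toHom n = exp (t • X ω i)} := by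
    rw [Set.ofPred_forall]
    refine isClosed_iInter fun t => ?_
    have hcont : Continuous fun ω (i : s) => exp (t • X ω i) := by
      refine continuous_pi fun i => ?_
      let _ : NormedAlgebra ℚ (CMat (i : UnitaryRep N).dim) :=
        NormedAlgebra.restrictScalars ℚ ℝ _
      exact exp_continuous.comp ((hX i).const_smul t)
    have := (BoundedRep.isClosed_range (ρ := UnitaryRep.prod s)).preimage hcont
    convert this using 1
    ext ω
    constructor
    · rintro ⟨n, hn⟩
      exact ⟨n, funext fun i => hn i i.2⟩
    · rintro ⟨n, hn⟩
      exact ⟨n, fun i hi => congrFun hn ⟨i, hi⟩⟩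
  have hball : {ω : E | ∀ i, ω i ∈ Metric.closedBall 0 (2 * (i.dim : ℝ))} =
      Set.univ.pi fun i => Metric.closedBall 0 (2 * (i.dim : ℝ)) := by
    ext ω
    exact Set.mem_univ_pi.symm
  have hclosed (s) : IsClosed (C s) := by
    refine IsClosed.and (by
      change IsClosed {ω : E | ∀ i, ω i ∈ Metric.closedBall 0 (2 * (i.dim : ℝ))}
      rw [hball]; exact isClosed_set_pi fun i _ => Metric.isClosed_closedBall) ?_
    refine IsClosed.and (isClosed_le continuous_const (c1 ρ₀).norm) ?_
    refine IsClosed.and ?_ ?_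
    · simp only [Set.ofPred_forall]
      refine isClosed_iInter fun i => isClosed_iInter fun _ => ?_
      have : {ω : E | IsSuTriple (ω i).1 (ω i).2.1 (ω i).2.2} =
          {ω | (ω i).1 * (ω i).2.1 - (ω i).2.1 * (ω i).1 = (2 : ℝ) • (ω i).2.2} ∩
          ({ω | (ω i).2.1 * (ω i).2.2 - (ω i).2.2 * (ω i).2.1 = (2 : ℝ) • (ω i).1} ∩
          {ω | (ω i).2.2 * (ω i).1 - (ω i).1 * (ω i).2.2 = (2 : ℝ) • (ω i).2.1}) := by
        ext ω
        exact ⟨fun h => ⟨h.1, h.2, h.3⟩, fun h => ⟨h.1, h.2.1, h.2.2⟩⟩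
      rw [this]
      exact (isClosed_eq (by fun_prop) (by fun_prop)).inter
        ((isClosed_eq (by fun_prop) (by fun_prop)).inter
        (isClosed_eq (by fun_prop) (by fun_prop)))
    · exact IsClosed.and (isClosed_eq (c3 ρ₀).star (c3 ρ₀).neg)
        (IsClosed.and (hclosed_exp s (fun ω i => (ω i).1) c1)
          (hclosed_exp s (fun ω i => (ω i).2.1) c2))
  have hcomp (s) : IsCompact (C s) := by
    have h1 : IsCompact (Set.univ.pi fun i : UnitaryRep N =>
        Metric.closedBall (0 : CMat i.dim × CMat i.dim × CMat i.dim) (2 * (i.dim : ℝ))) :=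
      isCompact_univ_pi fun i => by
        have : ProperSpace (CMat i.dim) := FiniteDimensional.proper ℝ _
        exact isCompact_closedBall _ _
    exact h1.of_isClosed_subset (hclosed s) fun ω hω i _ => hω.1 i
  have hanti {s s' : Finset (UnitaryRep N)} (h : s ⊆ s') : C s' ⊆ C s :=
    fun ω ⟨h1, h2, h3, h4, h5, h6⟩ => ⟨h1, h2, fun i hi => h3 i (h hi), h4,
      fun t => (h5 t).imp fun n hn i hi => hn i (h hi),
      fun t => (h6 t).imp fun n hn i hi => hn i (h hi)⟩
  have hne (s) : (C s).Nonempty := by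
    have hs : ρ₀ ∈ insert ρ₀ s := Finset.mem_insert_self _ _
    suffices (C (insert ρ₀ s)).Nonempty from this.mono (hanti (Finset.subset_insert _ _))
    obtain ⟨I, J, K, hT, hI, h1, h2⟩ := UnitaryRep.exists_triple_finset hs hnc
    refine ⟨fun i => if hi : i ∈ insert ρ₀ s then (I ⟨i, hi⟩, J ⟨i, hi⟩, K ⟨i, hi⟩) else 0,
      fun i => ?_, ?_, fun i hi => ?_, ?_, fun t => (h1 t).imp fun n hn i hi => ?_,
      fun t => (h2 t).imp fun n hn i hi => ?_⟩
    · by_cases hi : i ∈ insert ρ₀ s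
      · obtain ⟨hT, hI, hJ, hK⟩ := hT ⟨i, hi⟩
        beta_reduce
        rw [dif_pos hi, mem_closedBall_zero_iff, Prod.norm_def, Prod.norm_def]
        refine max_le (hT.norm_le hI hJ hK) (max_le ?_ ?_)
        · exact IsSuTriple.norm_le ⟨hT.hJK, hT.hKI, hT.hIJ⟩ hJ hK hI
        · exact IsSuTriple.norm_le ⟨hT.hKI, hT.hIJ, hT.hJK⟩ hK hI hJ
      · beta_reduce
        rw [dif_neg hi]
        exact Metric.mem_closedBall_self (by positivity)
    · beta_reduce
      rw [dif_pos hs]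
      exact (hT ⟨ρ₀, hs⟩).1.one_le_norm hI
    · beta_reduce
      rw [dif_pos hi]
      exact (hT ⟨i, hi⟩).1
    · beta_reduce
      rw [dif_pos hs]
      exact (hT ⟨ρ₀, hs⟩).2.2.2
    · beta_reduce
      rw [dif_pos hi]
      exact hn ⟨i, hi⟩
    · beta_reduce
      rw [dif_pos hi]
      exact hn ⟨i, hi⟩
  obtain ⟨ω, hω⟩ := IsCompact.nonempty_iInter_of_directed_nonempty_isCompact_isClosed C
    (fun s s' => ⟨s ∪ s', hanti Finset.subset_union_left, hanti Finset.subset_union_right⟩)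
    hne hcomp hclosed
  have hω := Set.mem_iInter.1 hω
  have hz (t : ℝ) := UnitaryRep.exists_forall_eq fun s => (hω s).2.2.2.2.1 t
  have hy (t : ℝ) := UnitaryRep.exists_forall_eq fun s => (hω s).2.2.2.2.2 t
  choose z hz using hz
  choose y hy using hy
  refine ⟨fun i => (ω i).1, fun i => (ω i).2.1, fun i => (ω i).2.2, z, y,
    fun i => (hω {i}).2.2.1 i (Finset.mem_singleton_self i), (hω ∅).2.2.2.1, fun h0 => ?_,
    fun i t => hz t i, fun i t => hy t i⟩
  have := (hω ∅).2.1
  rw [show (ω ρ₀).1 = 0 from h0, norm_zero] at this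
  linarith

end FamilyOfTriples

section SphereToGroup

open NormedSpace (exp)
open Real (pi)

lemma IsSuTriple.suMap_eq_of_spherePt_eq {𝔸 : Type*} [NormedRing 𝔸] [NormedAlgebra ℝ 𝔸]
    [CompleteSpace 𝔸] {I J K : 𝔸} (h : IsSuTriple I J K) {a b c a' b' c' : ℝ}
    (hb : b ∈ Set.Icc 0 (pi / 2)) (hb' : b' ∈ Set.Icc 0 (pi / 2))
    (heq : spherePt a b c = spherePt a' b' c') : suMap I J a b c = suMap I J a' b' c' := by
  have hper : Function.Periodic (fun t : ℝ => exp (t • I)) (2 * pi) := fun t => by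
    simp only [exp_add_smul, h.exp_two_pi, mul_one]
  have hper' (k : ℤ) (t : ℝ) : exp ((t + k * (2 * pi)) • I) = exp (t • I) := hper.int_mul k t
  have h1 : (Real.cos b : ℂ) * Complex.exp ((a + c : ℝ) * Complex.I) =
    Real.cos b' * Complex.exp ((a' + c' : ℝ) * Complex.I) := congrArg Prod.fst heq
  have h2 : (Real.sin b : ℂ) * Complex.exp ((a - c : ℝ) * Complex.I) =
    Real.sin b' * Complex.exp ((a' - c' : ℝ) * Complex.I) := congrArg Prod.snd heq
  have hcos : Real.cos b = Real.cos b' := by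
    have h3 := congrArg norm h1
    simp only [norm_mul, Complex.norm_exp_ofReal_mul_I, mul_one, Complex.norm_real,
      Real.norm_eq_abs] at h3
    rwa [abs_of_nonneg (Real.cos_nonneg_of_mem_Icc ⟨by linarith [hb.1, Real.pi_pos], hb.2⟩),
      abs_of_nonneg (Real.cos_nonneg_of_mem_Icc ⟨by linarith [hb'.1, Real.pi_pos], hb'.2⟩)] at h3
  obtain rfl : b = b' := Real.injOn_cos ⟨hb.1, by linarith [hb.2, Real.pi_pos]⟩
    ⟨hb'.1, by linarith [hb'.2, Real.pi_pos]⟩ hcos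
  have hexp {x y : ℝ} (hxy : Complex.exp (x * Complex.I) = Complex.exp (y * Complex.I)) :
      ∃ k : ℤ, x = y + k * (2 * pi) := by
    obtain ⟨k, hk⟩ := Complex.exp_eq_exp_iff_exists_int.1 hxy
    refine ⟨k, ?_⟩
    have : (x : ℂ) * Complex.I = ((y + k * (2 * pi) : ℝ) : ℂ) * Complex.I := by
      rw [hk]; push_cast; ring
    exact_mod_cast mul_right_cancel₀ Complex.I_ne_zero this
  have hadd (hc : Real.cos b ≠ 0) : ∃ k : ℤ, a + c = a' + c' + k * (2 * pi) :=
    hexp (mul_left_cancel₀ (Complex.ofReal_ne_zero.2 hc) h1)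
  have hsub (hs : Real.sin b ≠ 0) : ∃ k : ℤ, a - c = a' - c' + k * (2 * pi) :=
    hexp (mul_left_cancel₀ (Complex.ofReal_ne_zero.2 hs) h2)
  have hpi := Real.pi_pos
  obtain hb0 | hb0 := hb.1.eq_or_lt
  · subst hb0
    obtain ⟨k, hk⟩ := hadd (by simp)
    have e1 := suMap_zero I J a' (c' + k * (2 * pi)) (a - a')
    rw [add_sub_cancel, show c' + k * (2 * pi) - (a - a') = c by linarith] at e1
    rw [e1, suMap, suMap, hper']
  obtain hb1 | hb1 := hb.2.eq_or_lt
  · subst hb1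
    obtain ⟨k, hk⟩ := hsub (by simp)
    have e1 := h.suMap_pi_div_two (a' + k * (2 * pi)) c' (c - c')
    rw [add_sub_cancel, show a' + k * (2 * pi) + (c - c') = a by linarith] at e1
    rw [e1, suMap, suMap, hper']
  obtain ⟨k, hk⟩ := hadd (Real.cos_pos_of_mem_Ioo ⟨by linarith, hb1⟩).ne'
  obtain ⟨l, hl⟩ := hsub (Real.sin_pos_of_pos_of_lt_pi hb0 (by linarith)).ne'
  have hcomm (m : ℤ) : Commute (exp ((m * pi) • I)) (exp (b • J)) := by
    obtain ⟨j, rfl | rfl⟩ := Int.even_or_odd' m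
    · have := hper' j 0
      rw [zero_smul, NormedSpace.exp_zero, zero_add] at this
      rw [show ((2 * j : ℤ) : ℝ) * pi = j * (2 * pi) by push_cast; ring, this]
      exact Commute.one_left _
    · have := hper' j pi
      rw [show ((2 * j + 1 : ℤ) : ℝ) * pi = pi + j * (2 * pi) by push_cast; ring, this]
      exact h.commute_exp_pi b
  have ha : a = a' + ((k + l : ℤ) : ℝ) * pi := by push_cast; linarith
  have hc : c = -(((k + l : ℤ) : ℝ) * pi) + (c' + k * (2 * pi)) := by push_cast; linarith
  rw [suMap, suMap, ha, exp_add_smul, mul_assoc (exp (a' • I)), (hcomm (k + l)).eq, hc,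
    exp_add_smul I (-(((k + l : ℤ) : ℝ) * pi)), hper']
  simp only [mul_assoc]
  rw [← mul_assoc (exp ((((k + l : ℤ) : ℝ) * pi) • I)), exp_smul_mul_neg, one_mul]

/-- A compact box of toroidal coordinates. -/
abbrev TorusBox : Type := Set.Icc (-pi) pi × Set.Icc (0 : ℝ) (pi / 2) × Set.Icc (-pi) pi

/-- Toroidal coordinates as a map onto the sphere in the complex ball. -/
noncomputable def torusBoxMap (x : TorusBox) : complexSphere :=
  ⟨⟨spherePt x.1 x.2.1 x.2.2, (norm_sq_spherePt _ _ _).le⟩, norm_sq_spherePt _ _ _⟩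

lemma isQuotientMap_torusBoxMap : IsQuotientMap torusBoxMap := by
  have : T2Space complexSphere := inferInstance
  have hcont : Continuous torusBoxMap := by
    refine Continuous.subtype_mk (Continuous.subtype_mk ?_ _) _
    unfold spherePt
    fun_prop
  refine hcont.isClosedMap.isQuotientMap hcont fun w => ?_
  obtain ⟨⟨⟨u, v⟩, hle⟩, hw⟩ := w
  replace hw : ‖u‖ ^ 2 + ‖v‖ ^ 2 = 1 := hw
  have hpi := Real.pi_pos
  have hu := Complex.arg_mem_Ioc u
  have hv := Complex.arg_mem_Ioc v
  have hu1 : ‖u‖ ≤ 1 := by nlinarith [norm_nonneg u, sq_nonneg ‖v‖]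
  refine ⟨⟨⟨(u.arg + v.arg) / 2, by linarith [hu.1, hv.1], by linarith [hu.2, hv.2]⟩,
    ⟨Real.arccos ‖u‖, Real.arccos_nonneg _, Real.arccos_le_pi_div_two.2 (norm_nonneg u)⟩,
    ⟨(u.arg - v.arg) / 2, by linarith [hu.1, hv.2], by linarith [hu.2, hv.1]⟩⟩, ?_⟩
  refine Subtype.ext (Subtype.ext ?_)
  change spherePt _ _ _ = (u, v)
  have hsin : Real.sin (Real.arccos ‖u‖) = ‖v‖ := by
    rw [Real.sin_arccos, ← hw, add_sub_cancel_left, Real.sqrt_sq (norm_nonneg v)]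
  rw [spherePt, Real.cos_arccos (by linarith [norm_nonneg u]) hu1, hsin]
  ext
  · rw [show (u.arg + v.arg) / 2 + (u.arg - v.arg) / 2 = u.arg by ring]
    exact Complex.norm_mul_exp_arg_mul_I u
  · rw [show (u.arg + v.arg) / 2 - (u.arg - v.arg) / 2 = v.arg by ring]
    exact Complex.norm_mul_exp_arg_mul_I v

open scoped Matrix.Norms.L2Operator

variable {N : Type*} [Group N] [TopologicalSpace N] [IsTopologicalGroup N] [CompactSpace N]
  [T2Space N]

lemma UnitaryRep.eq_of_forall {x y : N} (h : ∀ i : UnitaryRep N, i.toHom x = i.toHom y) :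
    x = y := by
  by_contra hne
  obtain ⟨i, hi⟩ := UnitaryRep.exists_ne_one (x := x⁻¹ * y) fun h0 => hne (inv_mul_eq_one.1 h0)
  rw [map_mul, ← h, ← map_mul, inv_mul_cancel, map_one] at hi
  exact hi rfl

lemma UnitaryRep.continuous_of_forall {X : Type*} [TopologicalSpace X] {f : X → N}
    (h : ∀ i : UnitaryRep N, Continuous fun x => i.toHom (f x)) : Continuous f := by
  have he : IsClosedEmbedding fun (n : N) (i : UnitaryRep N) => i.toHom n :=
    (continuous_pi fun i => i.continuous).isClosedEmbedding fun x y hxy =>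
      UnitaryRep.eq_of_forall fun i => congrFun hxy i
  exact he.isInducing.continuous_iff.2 (continuous_pi h)

theorem UnitaryRep.exists_sphere_map {I J K : ∀ i : UnitaryRep N, CMat i.dim} {z y : ℝ → N}
    (hT : ∀ i, IsSuTriple (I i) (J i) (K i)) (hz : ∀ i t, i.toHom (z t) = exp (t • I i))
    (hy : ∀ i t, i.toHom (y t) = exp (t • J i)) :
    ∃ f : C(complexSphere, N), ∀ a b c, b ∈ Set.Icc 0 (pi / 2) → ∀ w : complexSphere,
      w.1.1 = spherePt a b c → ∀ i : UnitaryRep N, i.toHom (f w) = suMap (I i) (J i) a b c := by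
  have hzc : Continuous z := UnitaryRep.continuous_of_forall fun i => by
    simpa only [hz] using continuous_exp_smul (I i)
  have hyc : Continuous y := UnitaryRep.continuous_of_forall fun i => by
    simpa only [hy] using continuous_exp_smul (J i)
  let g : C(TorusBox, N) := ⟨fun x => z x.1 * y x.2.1 * z x.2.2, by fun_prop⟩
  have hg (x) (i : UnitaryRep N) : i.toHom (g x) = suMap (I i) (J i) x.1 x.2.1 x.2.2 := by
    simp only [g, ContinuousMap.coe_mk, map_mul, hz, hy, suMap]
  refine ⟨isQuotientMap_torusBoxMap.lift (f := ⟨_, isQuotientMap_torusBoxMap.continuous⟩) g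
    fun x x' hxx => ?_, fun a b c hb w hw i => ?_⟩
  · refine UnitaryRep.eq_of_forall fun i => ?_
    rw [hg, hg]
    exact (hT i).suMap_eq_of_spherePt_eq x.2.1.2 x'.2.1.2
      (congrArg (fun w : complexSphere => w.1.1) hxx)
  · obtain ⟨x, rfl⟩ := isQuotientMap_torusBoxMap.surjective w
    have h1 := DFunLike.congr_fun (isQuotientMap_torusBoxMap.lift_comp
      (f := ⟨_, isQuotientMap_torusBoxMap.continuous⟩) g fun x x' hxx => by
        refine UnitaryRep.eq_of_forall fun i => ?_
        rw [hg, hg]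
        exact (hT i).suMap_eq_of_spherePt_eq x.2.1.2 x'.2.1.2
          (congrArg (fun w : complexSphere => w.1.1) hxx)) x
    rw [ContinuousMap.comp_apply] at h1
    refine (congrArg i.toHom h1).trans ?_
    rw [hg]
    exact (hT i).suMap_eq_of_spherePt_eq x.2.1.2 hb hw

end SphereToGroup

section Characters

namespace FillingChain

variable {G : Type u} [Group G] [TopologicalSpace G] [IsTopologicalGroup G] [T2Space G]

lemma exists_continuousOn_extension (c : FillingChain G) {E : Type} [TopologicalSpace E]
    [TietzeExtension.{u} E] (f : C(c.core, E)) {P : Set E} (hP : IsOpen P) (hf : ∀ x, f x ∈ P) :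
    ∃ n, ∃ F : G → E, ContinuousOn F (c.V n) ∧ (∀ x ∈ c.V n, F x ∈ P) ∧
      ∀ x : c.core, F x = f x := by
  classical
  let Y : Set G := closure (c.V 0)
  have : CompactSpace Y := isCompact_iff_compactSpace.1 c.isCompact
  have hY : ∀ x : c.core, (x : G) ∈ Y := fun x => subset_closure (c.core_subset 0 x.2)
  let e : c.core → Y := fun x => ⟨x, hY x⟩
  have hec : Continuous e := by fun_prop
  have he : IsClosedEmbedding e := hec.isClosedEmbedding
    fun x y hxy => Subtype.ext (congrArg (fun z : Y => (z : G)) hxy)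
  obtain ⟨F₀, hF₀⟩ := ContinuousMap.exists_extension' he f
  let F : G → E := fun x => if h : x ∈ Y then F₀ ⟨x, h⟩ else f 1
  have hFY : ∀ x (h : x ∈ Y), F x = F₀ ⟨x, h⟩ := fun x h => dif_pos h
  have hFc : ContinuousOn F (c.V 0) := by
    refine ContinuousOn.mono ?_ subset_closure
    rw [continuousOn_iff_continuous_domRestrict]
    refine F₀.continuous.congr fun x => ?_
    exact (hFY x x.2).symm
  have hFf : ∀ x : c.core, F x = f x := fun x => (hFY x (hY x)).trans (congrFun hF₀ x)
  obtain ⟨n, hn⟩ := c.exists_subset (hFc.isOpen_inter_preimage (c.isOpen 0) hP)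
    fun x hx => ⟨c.core_subset 0 hx, by
      rw [Set.mem_preimage, hFf ⟨x, hx⟩]; exact hf _⟩
  exact ⟨n, F, hFc.mono fun x hx => (hn hx).1, fun x hx => (hn hx).2, hFf⟩

lemma exists_circle_extension (c : FillingChain G) (f : C(c.core, Circle)) :
    ∃ n, ∃ F : G → Circle, ContinuousOn F (c.V n) ∧ ∀ x : c.core, F x = f x := by
  classical
  obtain ⟨n, F, hFc, hF0, hF⟩ := c.exists_continuousOn_extension (E := ℂ)
    ⟨fun x => (f x : ℂ), by fun_prop⟩ (P := {0}ᶜ) isOpen_compl_singleton (fun x => by simp)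
  have hn : ∀ z : ℂ, z ≠ 0 → ‖z / ‖z‖‖ = 1 := fun z hz => by simp [hz]
  let F' : G → Circle := fun x => if h : F x ≠ 0 then
    ⟨F x / ‖F x‖, mem_sphere_zero_iff_norm.2 (hn _ h)⟩ else 1
  have hF' : ∀ x, F x ≠ 0 → (F' x : ℂ) = F x / ‖F x‖ := fun x h =>
    congrArg (fun z : Circle => (z : ℂ)) (dif_pos h)
  refine ⟨n, F', ?_, fun x => Circle.ext ?_⟩
  · have hi : IsInducing (fun z : Circle => (z : ℂ)) := ⟨rfl⟩
    rw [hi.continuousOn_iff]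
    refine ContinuousOn.congr (f := fun x => F x / ‖F x‖) ?_ fun x hx => hF' x (hF0 x hx)
    exact hFc.div (Complex.continuous_ofReal.comp_continuousOn hFc.norm)
      fun x hx => by simpa using hF0 x hx
  · rw [hF' _ (by simp [hF]), hF]
    simp [Circle.norm_coe]

end FillingChain

lemma Circle.exists_lift_square (f : C(unitInterval × unitInterval, Circle))
    (p : unitInterval × unitInterval) (r : ℝ) (h : Circle.exp r = f p) :
    ∃ F : C(unitInterval × unitInterval, ℝ), F p = r ∧ ∀ q, Circle.exp (F q) = f q := by
  let π : C(ℝ, unitInterval) := ⟨Set.projIcc 0 1 zero_le_one, continuous_projIcc⟩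
  obtain ⟨F, ⟨hFp, hF⟩, -⟩ := Circle.isCoveringMap_exp.existsUnique_continuousMap_lifts
    (f.comp (π.prodMap π)) ((p.1 : ℝ), (p.2 : ℝ)) r (by simpa [π] using h)
  refine ⟨F.comp ⟨fun q => ((q.1 : ℝ), (q.2 : ℝ)), by fun_prop⟩, hFp, fun q => ?_⟩
  have := congrFun hF ((q.1 : ℝ), (q.2 : ℝ))
  simpa [π] using this

lemma Circle.lift_unique {A : Type*} [TopologicalSpace A] [PreconnectedSpace A] {f g : A → ℝ}
    (hf : Continuous f) (hg : Continuous g) (h : ∀ a, Circle.exp (f a) = Circle.exp (g a)) (a : A)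
    (ha : f a = g a) : f = g :=
  Circle.isCoveringMap_exp.eq_of_comp_eq hf hg (funext h) a ha

lemma continuous_squareBoundary_glue {X : Type*} [TopologicalSpace X] {γ γ' δ β : C(unitInterval, X)}
    (h₀ : γ 0 = β 0) (h₁ : γ 1 = δ 0) (h₂ : γ' 0 = β 1) (h₃ : γ' 1 = δ 1) :
    ∃ f : C(squareBoundary, X), ∀ p : squareBoundary,
      (p.1.1 = 0 → f p = γ p.1.2) ∧ (p.1.1 = 1 → f p = γ' p.1.2) ∧
      (p.1.2 = 0 → f p = β p.1.1) ∧ (p.1.2 = 1 → f p = δ p.1.1) := by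
  classical
  let F : unitInterval × unitInterval → X := fun p => if p.1 = 0 then γ p.2 else
    if p.1 = 1 then γ' p.2 else if p.2 = 0 then β p.1 else δ p.1
  have H0 : ∀ p : unitInterval × unitInterval, p.1 = 0 → F p = γ p.2 := fun p hp => if_pos hp
  have H1 : ∀ p : unitInterval × unitInterval, p.1 = 1 → F p = γ' p.2 := fun p hp => by
    simp [F, hp]
  have H2 : ∀ p : unitInterval × unitInterval, p.2 = 0 → F p = β p.1 := fun p hp => by
    by_cases h : p.1 = 0
    · rw [H0 p h, hp, h, h₀]
    by_cases h' : p.1 = 1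
    · rw [H1 p h', hp, h', h₂]
    simp [F, h, h', hp]
  have H3 : ∀ p : unitInterval × unitInterval, p.2 = 1 → F p = δ p.1 := fun p hp => by
    by_cases h : p.1 = 0
    · rw [H0 p h, hp, h, h₁]
    by_cases h' : p.1 = 1
    · rw [H1 p h', hp, h', h₃]
    simp [F, h, h', hp]
  have hF : ContinuousOn F squareBoundary := by
    have c0 : ContinuousOn F {p | p.1 = 0} :=
      (γ.continuous.comp continuous_snd).continuousOn.congr H0
    have c1 : ContinuousOn F {p | p.1 = 1} :=
      (γ'.continuous.comp continuous_snd).continuousOn.congr H1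
    have c2 : ContinuousOn F {p | p.2 = 0} :=
      (β.continuous.comp continuous_fst).continuousOn.congr H2
    have c3 : ContinuousOn F {p | p.2 = 1} :=
      (δ.continuous.comp continuous_fst).continuousOn.congr H3
    have d0 : IsClosed {p : unitInterval × unitInterval | p.1 = 0} :=
      isClosed_eq continuous_fst continuous_const
    have d1 : IsClosed {p : unitInterval × unitInterval | p.1 = 1} :=
      isClosed_eq continuous_fst continuous_const
    have d2 : IsClosed {p : unitInterval × unitInterval | p.2 = 0} :=
      isClosed_eq continuous_snd continuous_const
    have d3 : IsClosed {p : unitInterval × unitInterval | p.2 = 1} :=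
      isClosed_eq continuous_snd continuous_const
    exact c0.union_of_isClosed (c1.union_of_isClosed (c2.union_of_isClosed c3 d2 d3) d1
      (d2.union d3)) d0 (d1.union (d2.union d3))
  exact ⟨⟨_, continuousOn_iff_continuous_domRestrict.1 hF⟩,
    fun p => ⟨H0 p.1, H1 p.1, H2 p.1, H3 p.1⟩⟩

end Characters

section CharacterLift

lemma Circle.exists_lift_path (f : C(unitInterval, Circle)) (r : ℝ) (h : Circle.exp r = f 0) :
    ∃ F : C(unitInterval, ℝ), F 0 = r ∧ ∀ t, Circle.exp (F t) = f t := by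
  obtain ⟨F, hF0, hF⟩ := Circle.exists_lift_square (f.comp ⟨Prod.fst, continuous_fst⟩) (0, 0) r h
  exact ⟨F.comp ⟨fun t => (t, 0), by fun_prop⟩, hF0, fun t => hF (t, 0)⟩

lemma abs_sub_lt_of_exp_ne {u : C(unitInterval, ℝ)} {ε : ℝ} (hε : 0 < ε)
    (h : ∀ t, Circle.exp (u t - u 0) ≠ Circle.exp ε ∧ Circle.exp (u t - u 0) ≠ Circle.exp (-ε)) :
    |u 1 - u 0| < ε := by
  by_contra! hlt
  obtain ⟨t, ht⟩ : ε ∈ Set.range fun t => |u t - u 0| :=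
    mem_range_of_exists_le_of_exists_ge (by fun_prop) ⟨0, by simpa using hε.le⟩ ⟨1, hlt⟩
  rcases (abs_eq hε.le).1 ht with h' | h'
  · exact (h t).1 (by rw [h'])
  · exact (h t).2 (by rw [h'])

variable {G : Type u} [Group G] [TopologicalSpace G]

lemma FillingChain.lift_endpoint_close (c : FillingChain G) {n : ℕ} {χ : G → Circle}
    (hχ : ContinuousOn χ (c.V n)) {γ γ' δ : C(unitInterval, G)} (hγ : ∀ t, γ t ∈ c.V (n + 1))
    (hγ' : ∀ t, γ' t ∈ c.V (n + 1)) (hδ : ∀ t, δ t ∈ c.V (n + 1)) (h₀ : γ 0 = 1) (h₀' : γ' 0 = 1)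
    (h₁ : γ 1 = δ 0) (h₁' : γ' 1 = δ 1) {F F' : C(unitInterval, ℝ)} (hF0 : F 0 = 0)
    (hF0' : F' 0 = 0) (hF : ∀ t, Circle.exp (F t) = χ (γ t))
    (hF' : ∀ t, Circle.exp (F' t) = χ (γ' t)) {ε : ℝ} (hε : 0 < ε)
    (hδε : ∀ t, χ (δ t) ≠ χ (δ 0) * Circle.exp ε ∧ χ (δ t) ≠ χ (δ 0) * Circle.exp (-ε)) :
    |F' 1 - F 1| < ε := by
  obtain ⟨f, hf⟩ := continuous_squareBoundary_glue (γ := γ) (γ' := γ') (δ := δ)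
    (β := .const _ 1) h₀ h₁ h₀' h₁'
  have hfV : ∀ p, f p ∈ c.V (n + 1) := fun p => by
    obtain ⟨h0, h1, h2, h3⟩ := hf p
    rcases p.2 with hp | hp | hp | hp
    · rw [h0 hp]; exact hγ _
    · rw [h1 hp]; exact hγ' _
    · rw [h2 hp]; exact c.one_mem _
    · rw [h3 hp]; exact hδ _
  obtain ⟨H, hHV, hH⟩ := c.fillsIn_square n f hfV
  have e0 : ∀ t, H (0, t) = γ t := fun t =>
    (hH ⟨(0, t), Or.inl rfl⟩).trans ((hf _).1 rfl)
  have e1 : ∀ t, H (1, t) = γ' t := fun t =>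
    (hH ⟨(1, t), Or.inr (Or.inl rfl)⟩).trans ((hf _).2.1 rfl)
  have e2 : ∀ s, H (s, 0) = 1 := fun s =>
    (hH ⟨(s, 0), Or.inr (Or.inr (Or.inl rfl))⟩).trans ((hf _).2.2.1 rfl)
  have e3 : ∀ s, H (s, 1) = δ s := fun s =>
    (hH ⟨(s, 1), Or.inr (Or.inr (Or.inr rfl))⟩).trans ((hf _).2.2.2 rfl)
  have hχ1 : χ 1 = 1 := by rw [← h₀, ← hF, hF0, Circle.exp_zero]
  obtain ⟨L, hL0, hL⟩ := Circle.exists_lift_square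
    ⟨fun p => χ (H p), hχ.comp_continuous H.continuous hHV⟩ (0, 0) 0
    (by simp [e0, h₀, hχ1])
  simp only [ContinuousMap.coe_mk] at hL
  have l0 : (fun t => L (0, t)) = F := Circle.lift_unique (by fun_prop) (by fun_prop)
    (fun t => by rw [hL, hF, e0]) 0 (hL0.trans hF0.symm)
  have l2 : (fun s => L (s, 0)) = fun _ => 0 := Circle.lift_unique (by fun_prop) (by fun_prop)
    (fun t => by rw [hL, e2, hχ1, Circle.exp_zero]) 0 hL0
  have l1 : (fun t => L (1, t)) = F' := Circle.lift_unique (by fun_prop) (by fun_prop)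
    (fun t => by rw [hL, hF', e1]) 0 ((congrFun l2 1).trans hF0'.symm)
  rw [← l0, ← l1]
  refine abs_sub_lt_of_exp_ne (u := L.comp ⟨fun s => (s, 1), by fun_prop⟩) hε fun t => ?_
  simp only [ContinuousMap.comp_apply, ContinuousMap.coe_mk, Circle.exp_sub, hL, e3]
  simpa only [ne_eq, div_eq_iff_eq_mul'] using hδε t

lemma FillingChain.exists_lift [IsTopologicalGroup G] [LocallyCompactSpace G] [T2Space G]
    (h : IsANE4 G) (c : FillingChain G) (f : C(c.core, Circle)) (hf : f 1 = 1) :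
    ∃ θ : C(c.core, ℝ), ∀ x, Circle.exp (θ x) = f x := by
  obtain ⟨n, χ, hχ, hχf⟩ := c.exists_circle_extension f
  have hχ1 : χ 1 = 1 := (hχf 1).trans hf
  have hV : ∀ {x}, x ∈ c.V (n + 1) → x ∈ c.V n := fun hx => c.antitone n.le_succ hx
  have hpath : ∀ x : c.core, ∃ γ : C(unitInterval, G), γ 0 = 1 ∧ γ 1 = x ∧
      ∀ t, γ t ∈ c.V (n + 1) := fun x =>
    c.exists_path (n + 1) (c.one_mem _) (c.core_subset _ x.2)
  choose γ hγ0 hγ1 hγ using hpath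
  have hlift : ∀ x, ∃ F : C(unitInterval, ℝ), F 0 = 0 ∧ ∀ t, Circle.exp (F t) = χ (γ x t) :=
    fun x => Circle.exists_lift_path ⟨fun t => χ (γ x t),
      hχ.comp_continuous (γ x).continuous fun t => hV (hγ x t)⟩ 0 (by simp [hγ0, hχ1])
  choose F hF0 hF using hlift
  refine ⟨⟨fun x => F x 1, ?_⟩, fun x => (hF x 1).trans (by rw [hγ1, hχf])⟩
  rw [Metric.continuous_iff']
  intro x ε' hε'
  set ε : ℝ := min ε' 1 with hεdef
  have hε : 0 < ε := by positivity
  have hε1 : ε ≤ 1 := min_le_right _ _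
  have hne : ∀ r : ℝ, r ≠ 0 → |r| ≤ 1 → χ x ≠ χ x * Circle.exp r := fun r hr hr1 he => by
    obtain ⟨m, hm⟩ := Circle.exp_eq_one.1 (mul_eq_left.1 he.symm)
    have hm0 : m ≠ 0 := fun h0 => hr (by simp [hm, h0])
    have h1 : (1 : ℝ) ≤ |(m : ℝ)| := by exact_mod_cast Int.one_le_abs hm0
    have := Real.pi_gt_three
    rw [hm, abs_mul, abs_of_pos Real.two_pi_pos] at hr1
    nlinarith
  have hVx : c.V (n + 1) ∈ 𝓝 (x : G) := (c.isOpen _).mem_nhds (c.core_subset _ x.2)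
  have hχx : ContinuousAt χ x := hχ.continuousAt (Filter.mem_of_superset hVx fun _ => hV)
  have hO : c.V (n + 1) ∩ {y | χ y ≠ χ x * Circle.exp ε ∧ χ y ≠ χ x * Circle.exp (-ε)} ∈
      𝓝 (x : G) := Filter.inter_mem hVx
    ((hχx.eventually_ne (hne ε hε.ne' (by rwa [abs_of_pos hε]))).and
      (hχx.eventually_ne (hne (-ε) (by linarith) (by rwa [abs_neg, abs_of_pos hε]))))
  obtain ⟨W, hW, hfill⟩ := h.exists_fillsIn (D := unitInterval)
      (fun t _ => (t : ℝ)) (by fun_prop) (fun x y hxy => Subtype.ext (congrFun hxy 0))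
      (S := {0, 1}) (Set.toFinite _).isClosed (x : G) hO
  filter_upwards [continuous_subtype_val.continuousAt hW] with y hy
  obtain ⟨δ, hδ0, hδ1, hδ⟩ : ∃ δ : C(unitInterval, G), δ 0 = x ∧ δ 1 = y ∧ ∀ t, δ t ∈
      c.V (n + 1) ∩ {y | χ y ≠ χ x * Circle.exp ε ∧ χ y ≠ χ x * Circle.exp (-ε)} := by
    exact hfill.exists_path (mem_of_mem_nhds hW) hy
  rw [Real.dist_eq]
  refine lt_of_lt_of_le ?_ (min_le_left ε' 1)
  exact c.lift_endpoint_close hχ (hγ x) (hγ y) (fun t => (hδ t).1) (hγ0 x) (hγ0 y)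
    ((hγ1 x).trans hδ0.symm) ((hγ1 y).trans hδ1.symm) (hF0 x) (hF0 y) (hF x) (hF y) hε
    (fun t => by rw [hδ0]; exact (hδ t).2)

end CharacterLift

section CommutingRepresentations
open scoped ComplexOrder

lemma Circle.character_eq_one_of_lift {N : Type*} [Group N] [TopologicalSpace N]
    [IsTopologicalGroup N] [CompactSpace N] [ConnectedSpace N] (χ : N →* Circle) (θ : C(N, ℝ))
    (h : ∀ x, Circle.exp (θ x) = χ x) : χ = 1 := by
  have hD : (fun p : N × N => θ (p.1 * p.2) - θ p.1 - θ p.2) = fun _ => -θ 1 := by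
    refine Circle.lift_unique (by fun_prop) (by fun_prop) (fun p => ?_) (1, 1) (by simp)
    have h1 : Circle.exp (-θ 1) = 1 := by rw [Circle.exp_neg, h, map_one, inv_one]
    rw [h1, Circle.exp_sub, Circle.exp_sub, h, h, h, map_mul, mul_div_cancel_left, div_self']
  have hadd : ∀ x y, θ (x * y) - θ 1 = (θ x - θ 1) + (θ y - θ 1) := fun x y => by
    have := congrFun hD (x, y)
    simp only at this
    linarith
  have hpow : ∀ x (k : ℕ), θ (x ^ k) - θ 1 = k * (θ x - θ 1) := fun x k => by
    induction k with
    | zero => simp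
    | succ k ih => rw [pow_succ, hadd, ih]; push_cast; ring
  obtain ⟨C, hC⟩ := isCompact_univ.exists_bound_of_continuousOn
    (f := fun x => θ x - θ 1) (by fun_prop)
  ext x
  suffices hx : θ x = θ 1 by rw [← h, hx, h, map_one]; simp
  by_contra hne
  have hpos : 0 < |θ x - θ 1| := abs_pos.2 (sub_ne_zero.2 hne)
  obtain ⟨k, hk⟩ := exists_nat_gt (C / |θ x - θ 1|)
  have := hC (x ^ k) trivial
  rw [hpow, Real.norm_eq_abs, abs_mul, Nat.abs_cast] at this
  rw [div_lt_iff₀ hpos] at hk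
  linarith

lemma Matrix.mulVec_eq_smul_of_mem_maxGenEigenspace {d : ℕ} {A : Matrix (Fin d) (Fin d) ℂ}
    (hA : Commute (star A) A) {μ : ℂ} {v : Fin d → ℂ}
    (hv : v ∈ Module.End.maxGenEigenspace (Matrix.toLin' A) μ) : A.mulVec v = μ • v := by
  set T : Matrix (Fin d) (Fin d) ℂ := A - μ • 1 with hT
  have hTn : star T * T = T * star T := by
    have h := hA.eq
    simp only [hT, star_sub, star_smul, star_one, sub_mul, mul_sub, h, smul_mul_assoc, one_mul,
      mul_smul_comm, mul_one, smul_sub, smul_comm μ (star μ)]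
    abel
  have hker : ∀ w, T.mulVec (T.mulVec w) = 0 → T.mulVec w = 0 := fun w hw => by
    have h1 : (star T).mulVec (T.mulVec w) = 0 := by
      rw [← Matrix.conjTranspose_mul_self_mulVec_eq_zero, Matrix.star_eq_conjTranspose,
        Matrix.conjTranspose_conjTranspose, ← Matrix.star_eq_conjTranspose, ← hTn,
        ← Matrix.mulVec_mulVec, hw, Matrix.mulVec_zero]
    rwa [Matrix.mulVec_mulVec, Matrix.star_eq_conjTranspose,
      Matrix.conjTranspose_mul_self_mulVec_eq_zero] at h1
  have hTA : Matrix.toLin' A - μ • (1 : Module.End ℂ (Fin d → ℂ)) = Matrix.toLin' T := by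
    rw [hT, map_sub, map_smul, Matrix.toLin'_one]; rfl
  obtain ⟨k, hk⟩ := (Module.End.mem_maxGenEigenspace _ _ _).1 hv
  rw [hTA, ← Matrix.toLin'_pow, Matrix.toLin'_apply] at hk
  have hT1 : T.mulVec v = 0 := by
    induction k with
    | zero => simp at hk; simp [hk]
    | succ k ih =>
      cases k with
      | zero => simpa using hk
      | succ k =>
        refine ih ?_
        rw [pow_succ', pow_succ', ← Matrix.mulVec_mulVec, ← Matrix.mulVec_mulVec] at hk
        rw [pow_succ', ← Matrix.mulVec_mulVec]
        exact hker _ hk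
  rwa [hT, Matrix.sub_mulVec, Matrix.smul_mulVec, Matrix.one_mulVec, sub_eq_zero] at hT1

lemma UnitaryRep.eigenvector_fixed {N : Type*} [Group N] [TopologicalSpace N] (ρ : UnitaryRep N)
    (hN : ∀ χ : N →* Circle, Continuous χ → χ = 1) {χ : N → ℂ} {v : Fin ρ.dim → ℂ} (hv : v ≠ 0)
    (h : ∀ g, (ρ.toHom g).mulVec v = χ g • v) (g : N) : (ρ.toHom g).mulVec v = v := by
  have hq : star v ⬝ᵥ v ≠ 0 := fun h0 => hv (dotProduct_star_self_eq_zero.1 h0)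
  have hinj : ∀ a b : ℂ, a • v = b • v → a = b := fun a b hab => smul_left_injective ℂ hv hab
  have h1 : χ 1 = 1 := hinj _ _ (by rw [← h, map_one, Matrix.one_mulVec, one_smul])
  have hmul : ∀ x y, χ (x * y) = χ x * χ y := fun x y => hinj _ _ (by
    rw [← h, map_mul, ← Matrix.mulVec_mulVec, h y, Matrix.mulVec_smul, h x, smul_smul, mul_comm])
  have hform : ∀ x, χ x = (star v ⬝ᵥ (ρ.toHom x).mulVec v) / (star v ⬝ᵥ v) := fun x => by
    rw [h, dotProduct_smul, smul_eq_mul, mul_div_cancel_right₀ _ hq]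
  have hcont : Continuous χ := by
    have := ρ.continuous
    rw [funext hform]
    fun_prop
  have hnorm : ∀ x, ‖χ x‖ = 1 := fun x => by
    have e1 : star ((ρ.toHom x).mulVec v) ⬝ᵥ (ρ.toHom x).mulVec v = star v ⬝ᵥ v := by
      rw [Matrix.star_mulVec, ← Matrix.dotProduct_mulVec, Matrix.mulVec_mulVec,
        ← Matrix.star_eq_conjTranspose, ρ.star_mul, Matrix.one_mulVec]
    rw [h, star_smul, smul_dotProduct, dotProduct_smul, smul_smul, smul_eq_mul] at e1
    have e2 : star (χ x) * χ x = 1 := mul_right_cancel₀ hq (by rw [e1, one_mul])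
    have e3 : ‖χ x‖ * ‖χ x‖ = 1 := by
      rw [← norm_star (χ x)]
      nth_rewrite 2 [norm_star]
      rw [← norm_mul, e2, norm_one]
    nlinarith [norm_nonneg (χ x)]
  let ψ : N →* Circle :=
    { toFun := fun x => ⟨χ x, mem_sphere_zero_iff_norm.2 (hnorm x)⟩
      map_one' := Circle.ext h1
      map_mul' := fun x y => Circle.ext (hmul x y) }
  have hψ : ψ = 1 := hN ψ (hcont.subtype_mk _)
  have hg : χ g = 1 := congrArg (fun z : Circle => (z : ℂ)) (DFunLike.congr_fun hψ g)
  rw [h, hg, one_smul]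

lemma UnitaryRep.eq_one_of_commute {N : Type*} [Group N] [TopologicalSpace N] (ρ : UnitaryRep N)
    (hN : ∀ χ : N →* Circle, Continuous χ → χ = 1)
    (hc : ∀ m n, Commute (ρ.toHom m) (ρ.toHom n)) (g : N) : ρ.toHom g = 1 := by
  have hnormal : ∀ x, Commute (star (ρ.toHom x)) (ρ.toHom x) := fun x => by
    rw [Commute, SemiconjBy, ρ.star_mul, mul_eq_one_comm.1 (ρ.star_mul x)]
  have htop := Module.End.iSup_iInf_maxGenEigenspace_eq_top_of_iSup_maxGenEigenspace_eq_top_of_commute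
    (fun x => Matrix.toLin' (ρ.toHom x))
    (fun x y _ => by
      change _ = _
      rw [Module.End.mul_eq_comp, Module.End.mul_eq_comp,
        ← Matrix.toLin'_mul, ← Matrix.toLin'_mul, (hc x y).eq])
    (fun x => Module.End.iSup_maxGenEigenspace_eq_top _)
  have hle : (⊤ : Submodule ℂ (Fin ρ.dim → ℂ)) ≤
      LinearMap.ker (Matrix.toLin' (ρ.toHom g) - LinearMap.id) := by
    rw [← htop]
    refine iSup_le fun χ v hv => ?_
    rw [LinearMap.mem_ker, LinearMap.sub_apply, Matrix.toLin'_apply, LinearMap.id_apply,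
      sub_eq_zero]
    by_cases hv0 : v = 0
    · rw [hv0, Matrix.mulVec_zero]
    · exact ρ.eigenvector_fixed hN hv0 (fun x =>
        Matrix.mulVec_eq_smul_of_mem_maxGenEigenspace (hnormal x)
          ((Submodule.mem_iInf _).1 hv x)) g
  apply Matrix.toLin'.injective
  rw [Matrix.toLin'_one]
  ext1 v
  refine LinearMap.ext fun w => ?_
  have := hle (Submodule.mem_top (x := Pi.single v w))
  exact sub_eq_zero.1 (LinearMap.mem_ker.1 this)

end CommutingRepresentations

section Assembly
open scoped Matrix.Norms.L2Operator
open NormedSpace (exp)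

lemma UnitaryRep.isUnit {N : Type*} [Group N] [TopologicalSpace N] (ρ : UnitaryRep N) (g : N) :
    IsUnit (ρ.toHom g) := (Group.isUnit g).map ρ.toHom

lemma FillingChain.character_eq_one {G : Type u} [Group G] [TopologicalSpace G]
    [IsTopologicalGroup G] [LocallyCompactSpace G] [T2Space G] (h : IsANE4 G)
    (c : FillingChain G) (χ : c.core →* Circle) (hχ : Continuous χ) : χ = 1 := by
  have := c.connectedSpace_core
  obtain ⟨θ, hθ⟩ := c.exists_lift h ⟨χ, hχ⟩ (map_one χ)
  exact Circle.character_eq_one_of_lift χ θ hθ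

lemma FillingChain.core_eq_bot {G : Type u} [Group G] [TopologicalSpace G]
    [IsTopologicalGroup G] [LocallyCompactSpace G] [T2Space G] (h : IsANE4 G)
    (c : FillingChain G) : c.core = ⊥ := by
  have := c.connectedSpace_core
  rw [Subgroup.eq_bot_iff_forall]
  intro x hx
  by_contra hx1
  obtain ⟨ρ, hρ⟩ := UnitaryRep.exists_ne_one (x := (⟨x, hx⟩ : c.core))
    fun h0 => hx1 (congrArg Subtype.val h0)
  obtain ⟨I, J, K, z, y, hT, hK, hI, hz, hy⟩ := UnitaryRep.exists_triple (ρ₀ := ρ)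
    fun hc => hρ (ρ.eq_one_of_commute (c.character_eq_one h) hc _)
  obtain ⟨f, hf⟩ := UnitaryRep.exists_sphere_map hT hz hy
  obtain ⟨n, F, hFc, hFu, hF⟩ := c.exists_continuousOn_extension (E := CMat ρ.dim)
    ⟨ρ.toHom, ρ.continuous⟩ (P := {A | IsUnit A}) Units.isOpen ρ.isUnit
  obtain ⟨H, hHV, hH⟩ := c.fillsIn_ball n ⟨fun w => (f w : G), by fun_prop⟩
    fun w => c.core_subset _ (f w).2
  have hK0 : K ρ ≠ 0 := fun h0 => hI (by
    have h1 := (hT ρ).hJK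
    rw [h0, mul_zero, zero_mul, sub_zero] at h1
    exact (smul_eq_zero.1 h1.symm).resolve_left two_ne_zero)
  refine (hT ρ).false_of_extension
    (τ := ((Complex.reCLM : ℂ →L[ℝ] ℝ).comp
      (LinearMap.toContinuousLinearMap (Matrix.traceLinearMap (Fin ρ.dim) ℝ ℂ))))
    (fun A B => ?_) ?_ ⟨fun w => F (H w), hFc.comp_continuous H.continuous hHV⟩
    (fun w => hFu _ (hHV w)) ?_
  · simp [Matrix.trace_mul_comm A B]
  · exact (re_trace_mul_self_neg hK hK0).ne
  · intro a b s hb w hw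
    have hwS : w ∈ complexSphere := by
      change ‖w.1.1‖ ^ 2 + ‖w.1.2‖ ^ 2 = 1
      rw [hw, norm_sq_spherePt]
    have e1 : H w = f ⟨w, hwS⟩ := hH ⟨w, hwS⟩
    change F (H w) = _
    rw [e1, hF]
    exact hf a b s hb ⟨w, hwS⟩ hw ρ

end Assembly

/-- Every locally compact Hausdorff topological group whose underlying space is an
ANE(4)-space is metrizable. -/
theorem locallyCompact_ANE4_group_metrizable (G : Type u) [Group G] [TopologicalSpace G]
    [IsTopologicalGroup G] [LocallyCompactSpace G] [T2Space G] (h : IsANE4 G) :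
    TopologicalSpace.MetrizableSpace G := by
  obtain ⟨c⟩ := h.nonempty_fillingChain
  exact c.metrizableSpace_of_core_eq_bot (c.core_eq_bot h)
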